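/- Suppose p = 2r+1 < p_B(N). Then the system (S) has no nontrivial nonnegative classical solution on ℝ^N × ℝ; that is, every nonnegative classical solution U = (u_1,…,u_m) of (S) defined on all of ℝ^N × ℝ satisfies u_i ≡ 0 for every i = 1,…,m. -/

import Mathlib

open Real Set Metric MeasureTheory

/-- The Laplacian in the space variable, as the sum of second derivatives in
the coordinate directions. -/
noncomputable def lap {N : ℕ} (f : EuclideanSpace ℝ (Fin N) → ℝ)
    (x : EuclideanSpace ℝ (Fin N)) : ℝ :=
  ∑ i, iteratedFDeriv ℝ 2 f x ![EuclideanSpace.single i 1, EuclideanSpace.single i 1]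

open Filter Topology

/-- Euclidean space of dimension `N`. -/
abbrev Eu (N : ℕ) := EuclideanSpace ℝ (Fin N)

/-- Partial derivative in the `i`-th coordinate direction. -/
noncomputable def pd {N : ℕ} (i : Fin N) (f : Eu N → ℝ) (x : Eu N) : ℝ :=
  fderiv ℝ f x (EuclideanSpace.single i 1)

/-- The heat operator applied to `v`. -/
noncomputable def heat {N : ℕ} (v : Eu N → ℝ → ℝ) (x : Eu N) (t : ℝ) : ℝ :=
  deriv (v x) t - lap (fun y => v y t) x

/-- Separate regularity: `C²` in space, `C¹` in time. -/
structure SepReg {N : ℕ} (v : Eu N → ℝ → ℝ) : Prop where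
  space : ∀ t, ContDiff ℝ 2 (fun x => v x t)
  time : ∀ x, ContDiff ℝ 1 (v x)

section Calculus

variable {N : ℕ}

theorem contDiff_pd {f : Eu N → ℝ} {n : ℕ} (hf : ContDiff ℝ (n + 1) f) (i : Fin N) :
    ContDiff ℝ n (pd i f) :=
  (hf.fderiv_right (m := n) (by norm_cast)).clm_apply contDiff_const

theorem contDiff_one_pd {f : Eu N → ℝ} (hf : ContDiff ℝ 2 f) (i : Fin N) :
    ContDiff ℝ 1 (pd i f) := by
  have := contDiff_pd (n := 1) (f := f) (by simpa [one_add_one_eq_two] using hf) i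
  simpa using this

theorem continuous_pd {f : Eu N → ℝ} (hf : ContDiff ℝ 1 f) (i : Fin N) :
    Continuous (pd i f) := by
  have := contDiff_pd (n := 0) (f := f) (by simpa using hf) i
  exact this.continuous

theorem lap_eq {f : Eu N → ℝ} (hf : ContDiff ℝ 2 f) (x : Eu N) :
    lap f x = ∑ i, pd i (pd i f) x := by
  unfold lap
  refine Finset.sum_congr rfl fun i _ => ?_
  rw [iteratedFDeriv_two_apply]
  have hd : DifferentiableAt ℝ (fderiv ℝ f) x :=
    (hf.fderiv_right (m := 1) (by norm_num)).differentiable (by norm_num) x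
  have : pd i f = fun y => fderiv ℝ f y (EuclideanSpace.single i 1) := rfl
  rw [pd, this, fderiv_clm_apply hd (by fun_prop)]
  simp

theorem continuous_lap {f : Eu N → ℝ} (hf : ContDiff ℝ 2 f) : Continuous (lap f) := by
  have : lap f = fun x => ∑ i, pd i (pd i f) x := funext (lap_eq hf)
  rw [this]
  exact continuous_finsetSum _ fun i _ => continuous_pd (contDiff_one_pd hf i) i

theorem lap_congr {f g : Eu N → ℝ} {x : Eu N} (h : f =ᶠ[𝓝 x] g) : lap f x = lap g x := by
  unfold lap
  rw [(h.iteratedFDeriv ℝ 2).eq_of_nhds]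

theorem pd_congr {f g : Eu N → ℝ} {x : Eu N} (h : f =ᶠ[𝓝 x] g) (i : Fin N) :
    pd i f x = pd i g x := by
  rw [pd, pd, h.fderiv_eq]

theorem pd_const (c : ℝ) (i : Fin N) (x : Eu N) : pd i (fun _ => c) x = 0 := by
  simp [pd]

theorem pd_add {f g : Eu N → ℝ} {x : Eu N} (hf : DifferentiableAt ℝ f x)
    (hg : DifferentiableAt ℝ g x) (i : Fin N) :
    pd i (fun y => f y + g y) x = pd i f x + pd i g x := by
  simp [pd, fderiv_fun_add hf hg]

theorem pd_sub {f g : Eu N → ℝ} {x : Eu N} (hf : DifferentiableAt ℝ f x)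
    (hg : DifferentiableAt ℝ g x) (i : Fin N) :
    pd i (fun y => f y - g y) x = pd i f x - pd i g x := by
  simp [pd, fderiv_fun_sub hf hg]

theorem pd_mul {f g : Eu N → ℝ} {x : Eu N} (hf : DifferentiableAt ℝ f x)
    (hg : DifferentiableAt ℝ g x) (i : Fin N) :
    pd i (fun y => f y * g y) x = pd i f x * g x + f x * pd i g x := by
  simp only [pd, fderiv_fun_mul hf hg, add_apply, smul_apply, smul_eq_mul]
  ring

theorem pd_comp {f : Eu N → ℝ} {φ : ℝ → ℝ} {φ' : ℝ} {x : Eu N}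
    (hf : DifferentiableAt ℝ f x) (hφ : HasDerivAt φ φ' (f x)) (i : Fin N) :
    pd i (fun y => φ (f y)) x = φ' * pd i f x := by
  have h := hφ.comp_hasFDerivAt x hf.hasFDerivAt
  rw [pd, HasFDerivAt.fderiv (f := fun y => φ (f y)) h]
  simp [pd]

theorem pd_const_mul (c : ℝ) {f : Eu N → ℝ} {x : Eu N} (hf : DifferentiableAt ℝ f x)
    (i : Fin N) : pd i (fun y => c * f y) x = c * pd i f x := by
  rw [pd_mul (by fun_prop) hf, pd_const]; ring

theorem diff_of_contDiff {n : WithTop ℕ∞} {f : Eu N → ℝ} (hf : ContDiff ℝ n f)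
    (hn : n ≠ 0) (x : Eu N) : DifferentiableAt ℝ f x :=
  hf.differentiable hn x

theorem lap_add {f g : Eu N → ℝ} (hf : ContDiff ℝ 2 f) (hg : ContDiff ℝ 2 g) (x : Eu N) :
    lap (fun y => f y + g y) x = lap f x + lap g x := by
  rw [lap_eq (hf.add hg), lap_eq hf, lap_eq hg, ← Finset.sum_add_distrib]
  refine Finset.sum_congr rfl fun i _ => ?_
  have : pd i (fun y => f y + g y) = fun y => pd i f y + pd i g y := funext fun y =>
    pd_add (diff_of_contDiff hf (by norm_num) y) (diff_of_contDiff hg (by norm_num) y) i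
  rw [this, pd_add (diff_of_contDiff (contDiff_one_pd hf i) (by norm_num) x)
    (diff_of_contDiff (contDiff_one_pd hg i) (by norm_num) x)]

theorem lap_const_mul (c : ℝ) {f : Eu N → ℝ} (hf : ContDiff ℝ 2 f) (x : Eu N) :
    lap (fun y => c * f y) x = c * lap f x := by
  rw [lap_eq (contDiff_const.mul hf), lap_eq hf, Finset.mul_sum]
  refine Finset.sum_congr rfl fun i _ => ?_
  have : pd i (fun y => c * f y) = fun y => c * pd i f y := funext fun y =>
    pd_const_mul c (diff_of_contDiff hf (by norm_num) y) i
  rw [this, pd_const_mul c (diff_of_contDiff (contDiff_one_pd hf i) (by norm_num) x)]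

theorem lap_const (c : ℝ) (x : Eu N) : lap (fun _ : Eu N => c) x = 0 := by
  rw [lap_eq contDiff_const]
  refine Finset.sum_eq_zero fun i _ => ?_
  have : pd i (fun _ : Eu N => c) = fun _ => 0 := funext fun y => pd_const c i y
  rw [this, pd_const]

theorem lap_sub {f g : Eu N → ℝ} (hf : ContDiff ℝ 2 f) (hg : ContDiff ℝ 2 g) (x : Eu N) :
    lap (fun y => f y - g y) x = lap f x - lap g x := by
  have h1 : (fun y => f y - g y) = fun y => f y + (-1) * g y := by ext; ring
  rw [h1, lap_add hf (contDiff_const.mul hg), lap_const_mul _ hg]; ring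

theorem lap_sum {ι : Type*} (s : Finset ι) {f : ι → Eu N → ℝ}
    (hf : ∀ j ∈ s, ContDiff ℝ 2 (f j)) (x : Eu N) :
    lap (fun y => ∑ j ∈ s, f j y) x = ∑ j ∈ s, lap (f j) x := by
  classical
  induction s using Finset.induction_on with
  | empty => simpa using lap_const 0 x
  | insert a s ha ih =>
    simp only [Finset.sum_insert ha]
    rw [lap_add (hf a (by simp)) (ContDiff.sum fun j hj => hf j (by simp [hj])),
      ih fun j hj => hf j (by simp [hj])]

theorem lap_mul {f g : Eu N → ℝ} (hf : ContDiff ℝ 2 f) (hg : ContDiff ℝ 2 g) (x : Eu N) :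
    lap (fun y => f y * g y) x
      = lap f x * g x + 2 * ∑ i, pd i f x * pd i g x + f x * lap g x := by
  rw [lap_eq (hf.mul hg), lap_eq hf, lap_eq hg, Finset.mul_sum, Finset.sum_mul, Finset.mul_sum,
    ← Finset.sum_add_distrib, ← Finset.sum_add_distrib]
  refine Finset.sum_congr rfl fun i _ => ?_
  have hf' := fun y => diff_of_contDiff hf (by norm_num) y
  have hg' := fun y => diff_of_contDiff hg (by norm_num) y
  have hf'' := fun y => diff_of_contDiff (contDiff_one_pd hf i) (by norm_num) y
  have hg'' := fun y => diff_of_contDiff (contDiff_one_pd hg i) (by norm_num) y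
  have : pd i (fun y => f y * g y) = fun y => pd i f y * g y + f y * pd i g y := funext fun y =>
    pd_mul (hf' y) (hg' y) i
  rw [this, pd_add ((hf'' x).fun_mul (hg' x)) ((hf' x).fun_mul (hg'' x)), pd_mul (hf'' x) (hg' x),
    pd_mul (hf' x) (hg'' x)]
  ring

theorem lap_comp {f : Eu N → ℝ} {φ φ' φ'' : ℝ → ℝ} (hf : ContDiff ℝ 2 f)
    (hφ2 : ContDiff ℝ 2 (fun y => φ (f y)))
    (x : Eu N) (hφ : ∀ᶠ y in 𝓝 x, HasDerivAt φ (φ' (f y)) (f y))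
    (hφ' : HasDerivAt φ' (φ'' (f x)) (f x)) :
    lap (fun y => φ (f y)) x
      = φ'' (f x) * ∑ i, pd i f x ^ 2 + φ' (f x) * lap f x := by
  rw [lap_eq hφ2, lap_eq hf, Finset.mul_sum, Finset.mul_sum, ← Finset.sum_add_distrib]
  refine Finset.sum_congr rfl fun i _ => ?_
  have hf' := fun y => diff_of_contDiff hf (by norm_num) y
  have hf'' := fun y => diff_of_contDiff (contDiff_one_pd hf i) (by norm_num) y
  have : pd i (fun y => φ (f y)) =ᶠ[𝓝 x] fun y => φ' (f y) * pd i f y := by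
    filter_upwards [hφ] with y hy
    exact pd_comp (hf' y) hy i
  rw [pd_congr this, pd_mul (f := fun y => φ' (f y)) (hφ'.differentiableAt.comp x (hf' x)) (hf'' x), pd_comp (hf' x) hφ']
  ring

theorem hasCompactSupport_pd {f : Eu N → ℝ} (hf : HasCompactSupport f) (i : Fin N) :
    HasCompactSupport (pd i f) :=
  (hf.fderiv (𝕜 := ℝ)).comp_left (g := fun L : Eu N →L[ℝ] ℝ => L (EuclideanSpace.single i 1))
    (by simp)

theorem hasCompactSupport_lap {f : Eu N → ℝ} (hf : HasCompactSupport f) :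
    HasCompactSupport (lap f) := by
  refine HasCompactSupport.of_support_subset_isCompact (K := tsupport f) hf fun x hx => ?_
  by_contra h
  apply hx
  have : f =ᶠ[𝓝 x] fun _ => 0 := by
    filter_upwards [(isClosed_tsupport f).isOpen_compl.mem_nhds h] with y hy
    exact image_eq_zero_of_notMem_tsupport hy
  rw [lap_congr this, lap_const]

theorem integral_pd_eq_zero {f : Eu N → ℝ} (hf : ContDiff ℝ 1 f) (hc : HasCompactSupport f)
    (i : Fin N) : ∫ x, pd i f x = 0 := by
  have h1 : Integrable (pd i f) :=
    (continuous_pd hf i).integrable_of_hasCompactSupport (hasCompactSupport_pd hc i)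
  have h2 : Integrable f := hf.continuous.integrable_of_hasCompactSupport hc
  have h := integral_mul_fderiv_eq_neg_fderiv_mul_of_integrable (𝕜 := ℝ) (μ := (volume : Measure (Eu N)))
    (f := fun _ => 1) (g := f) (v := EuclideanSpace.single i 1) (by simp)
    (by simp only [one_mul]; exact h1) (by simp only [one_mul]; exact h2)
    (fun x _ => by fun_prop) (fun x _ => diff_of_contDiff hf (by norm_num) x)
  simpa [pd] using h

theorem integral_mul_lap {ψ f : Eu N → ℝ} (hψ : ContDiff ℝ 2 ψ) (hc : HasCompactSupport ψ)
    (hf : ContDiff ℝ 2 f) : ∫ x, ψ x * lap f x = ∫ x, lap ψ x * f x := by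
  have hf' := fun y => diff_of_contDiff hf (by norm_num) y
  have hψ' := fun y => diff_of_contDiff hψ (by norm_num) y
  have hf'' := fun i y => diff_of_contDiff (contDiff_one_pd hf i) (by norm_num) y
  have hψ'' := fun i y => diff_of_contDiff (contDiff_one_pd hψ i) (by norm_num) y
  have key : ∫ x, ∑ i, pd i (fun y => ψ y * pd i f y - pd i ψ y * f y) x = 0 := by
    rw [integral_finsetSum]
    · refine Finset.sum_eq_zero fun i _ => integral_pd_eq_zero ?_ ?_ i
      · exact ((hψ.of_le (by norm_num)).mul (contDiff_one_pd hf i)).sub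
          ((contDiff_one_pd hψ i).mul (hf.of_le (by norm_num)))
      · exact hc.mul_right.sub (hasCompactSupport_pd hc i).mul_right
    · intro i _
      refine (continuous_pd ?_ i).integrable_of_hasCompactSupport (hasCompactSupport_pd ?_ i)
      · exact ((hψ.of_le (by norm_num)).mul (contDiff_one_pd hf i)).sub
          ((contDiff_one_pd hψ i).mul (hf.of_le (by norm_num)))
      · exact hc.mul_right.sub (hasCompactSupport_pd hc i).mul_right
  have e : ∀ x, ∑ i, pd i (fun y => ψ y * pd i f y - pd i ψ y * f y) x
      = ψ x * lap f x - lap ψ x * f x := by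
    intro x
    rw [lap_eq hf, lap_eq hψ, Finset.mul_sum, Finset.sum_mul, ← Finset.sum_sub_distrib]
    refine Finset.sum_congr rfl fun i _ => ?_
    rw [pd_sub ((hψ' x).fun_mul (hf'' i x)) ((hψ'' i x).fun_mul (hf' x)), pd_mul (hψ' x) (hf'' i x),
      pd_mul (hψ'' i x) (hf' x)]
    ring
  simp_rw [e] at key
  rw [integral_sub] at key
  · linarith
  · exact (hψ.continuous.mul (continuous_lap hf)).integrable_of_hasCompactSupport hc.mul_right
  · exact ((continuous_lap hψ).mul hf.continuous).integrable_of_hasCompactSupport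
      (hasCompactSupport_lap hc).mul_right

theorem hasDerivAt_max_pow (n : ℕ) (y : ℝ) :
    HasDerivAt (fun y : ℝ => max y 0 ^ (n + 2)) ((n + 2 : ℕ) * max y 0 ^ (n + 1)) y := by
  rcases lt_trichotomy y 0 with h | h | h
  · have h1 : (fun y : ℝ => max y 0 ^ (n + 2)) =ᶠ[𝓝 y] fun _ => 0 := by
      filter_upwards [Iio_mem_nhds h] with z hz
      rw [max_eq_right (le_of_lt hz)]; simp
    rw [max_eq_right h.le]
    simpa using (hasDerivAt_const y (0 : ℝ)).congr_of_eventuallyEq h1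
  · subst h
    have h2 : HasDerivAt (fun y : ℝ => max y 0 ^ (n + 2)) 0 0 := by
      rw [hasDerivAt_iff_isLittleO_nhds_zero]
      simp only [zero_add, max_self, smul_zero, sub_zero]
      refine Asymptotics.IsBigO.trans_isLittleO (g := fun h : ℝ => h ^ (n + 2)) ?_ ?_
      · refine Asymptotics.IsBigO.of_bound 1 (Eventually.of_forall fun h => ?_)
        simp only [ne_eq, Nat.add_eq_zero_iff, OfNat.ofNat_ne_zero, and_false, not_false_eq_true,
          zero_pow, sub_zero, norm_pow, one_mul]
        refine pow_le_pow_left₀ (norm_nonneg _) ?_ _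
        rcases le_total h 0 with h0 | h0
        · simp [max_eq_right h0]
        · simp [max_eq_left h0]
      · exact Asymptotics.isLittleO_pow_id (by omega)
    simpa using h2
  · have h1 : (fun y : ℝ => max y 0 ^ (n + 2)) =ᶠ[𝓝 y] fun y => y ^ (n + 2) := by
      filter_upwards [Ioi_mem_nhds h] with z hz
      rw [max_eq_left (le_of_lt hz)]
    rw [max_eq_left h.le]
    simpa using (hasDerivAt_pow (n + 2) y).congr_of_eventuallyEq h1

theorem contDiff_max_sq : ContDiff ℝ 1 (fun y : ℝ => max y 0 ^ 2) := by
  rw [contDiff_one_iff_deriv]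
  have h : ∀ y : ℝ, HasDerivAt (fun y : ℝ => max y 0 ^ 2) (2 * max y 0) y := fun y => by
    simpa using hasDerivAt_max_pow 0 y
  refine ⟨fun y => (h y).differentiableAt, ?_⟩
  have : deriv (fun y : ℝ => max y 0 ^ 2) = fun y => 2 * max y 0 := funext fun y => (h y).deriv
  rw [this]; fun_prop

theorem integral_mul_sq_max_mul_lap_nonpos {χ g : Eu N → ℝ} (hχ : ContDiff ℝ 1 χ)
    (hc : HasCompactSupport χ) (h0 : ∀ x, 0 ≤ χ x) (hg : ContDiff ℝ 2 g)
    (hz : ∀ i x, pd i χ x * max (g x) 0 = 0) :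
    ∫ x, χ x * max (g x) 0 ^ 2 * lap g x ≤ 0 := by
  have hg' := fun y => diff_of_contDiff hg (by norm_num) y
  have hχ' := fun y => diff_of_contDiff hχ (by norm_num) y
  have hg'' := fun i y => diff_of_contDiff (contDiff_one_pd hg i) (by norm_num) y
  have hm : ContDiff ℝ 1 (fun x => max (g x) 0 ^ 2) :=
    contDiff_max_sq.comp (hg.of_le (by norm_num))
  have hm' := fun y => diff_of_contDiff hm (by norm_num) y
  have hF : ∀ i, ContDiff ℝ 1 (fun x => χ x * max (g x) 0 ^ 2 * pd i g x) := fun i =>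
    (hχ.mul hm).mul (contDiff_one_pd hg i)
  have hFc : ∀ i, HasCompactSupport (fun x => χ x * max (g x) 0 ^ 2 * pd i g x) := fun i =>
    hc.mul_right.mul_right
  have key : ∫ x, ∑ i, pd i (fun x => χ x * max (g x) 0 ^ 2 * pd i g x) x = 0 := by
    rw [integral_finsetSum]
    · exact Finset.sum_eq_zero fun i _ => integral_pd_eq_zero (hF i) (hFc i) i
    · intro i _
      exact (continuous_pd (hF i) i).integrable_of_hasCompactSupport (hasCompactSupport_pd (hFc i) i)
  have e : ∀ x, χ x * max (g x) 0 ^ 2 * lap g x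
      ≤ ∑ i, pd i (fun x => χ x * max (g x) 0 ^ 2 * pd i g x) x := by
    intro x
    rw [lap_eq hg, Finset.mul_sum]
    refine Finset.sum_le_sum fun i _ => ?_
    have h2 : HasDerivAt (fun y : ℝ => max y 0 ^ 2) (2 * max (g x) 0) (g x) := by
      simpa using hasDerivAt_max_pow 0 (g x)
    rw [pd_mul ((hχ' x).fun_mul (hm' x)) (hg'' i x), pd_mul (hχ' x) (hm' x), pd_comp (hg' x) h2]
    have h3 := hz i x
    have h4 : 0 ≤ χ x * (2 * max (g x) 0 * pd i g x) * pd i g x := by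
      have : 0 ≤ χ x * max (g x) 0 * (pd i g x) ^ 2 :=
        mul_nonneg (mul_nonneg (h0 x) (le_max_right _ _)) (sq_nonneg _)
      linarith
    have h5 : pd i χ x * max (g x) 0 ^ 2 = 0 := by rw [sq, ← mul_assoc, h3, zero_mul]
    rw [h5]; linarith
  calc _ ≤ ∫ x, ∑ i, pd i (fun x => χ x * max (g x) 0 ^ 2 * pd i g x) x := by
        refine integral_mono ?_ ?_ e
        · exact ((hχ.continuous.mul hm.continuous).mul
            (continuous_lap hg)).integrable_of_hasCompactSupport hc.mul_right.mul_right
        · refine integrable_finsetSum _ fun i _ => ?_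
          exact (continuous_pd (hF i) i).integrable_of_hasCompactSupport
            (hasCompactSupport_pd (hFc i) i)
    _ = 0 := key

end Calculus

section Comparison

variable {N : ℕ}

theorem eventually_slope_integral_lt {h : Eu N → ℝ → ℝ} {K : Set (Eu N)} (hK : IsCompact K)
    {t η C : ℝ} (hη : 0 < η) (hcont : ∀ s ∈ Icc t (t + η), Continuous fun x => h x s)
    (hsupp : ∀ x ∉ K, ∀ s ∈ Icc t (t + η), h x s = 0)
    (hfwd : ∀ x ∈ K, ∀ s ∈ Icc t (t + η), h x s ≤ h x t + C * (s - t)) {q Q : Eu N → ℝ}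
    (hq : ∀ x, HasDerivWithinAt (h x) (q x) (Ici t) t) (hqQ : ∀ x, q x ≤ Q x)
    (hQ : Integrable Q) {r : ℝ} (hr : ∫ x, Q x < r) :
    ∀ᶠ s in 𝓝[>] t, slope (fun s => ∫ x, h x s) t s < r := by
  have hI : ∀ s ∈ Icc t (t + η), Integrable fun x => h x s := fun s hs =>
    (hcont s hs).integrable_of_hasCompactSupport
      (HasCompactSupport.intro hK fun x hx => hsupp x hx s hs)
  have ht : t ∈ Icc t (t + η) := ⟨le_rfl, by linarith⟩
  have hnear : ∀ᶠ s in 𝓝[>] t, s ∈ Ioc t (t + η) :=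
    Ioc_mem_nhdsGT (by linarith)
  have hS : ∀ s ∈ Ioc t (t + η), Integrable fun x => slope (h x) t s := by
    intro s hs
    simp only [slope, vsub_eq_sub, smul_eq_mul]
    exact ((hI s ⟨hs.1.le, hs.2⟩).sub (hI t ht)).const_mul _
  have hlim : Tendsto (fun s => ∫ x, max (slope (h x) t s) (Q x)) (𝓝[>] t) (𝓝 (∫ x, Q x)) := by
    refine tendsto_integral_filter_of_dominated_convergence
      (fun x => K.indicator (fun _ => |C|) x + |Q x|) ?_ ?_ ?_ ?_
    · filter_upwards [hnear] with s hs
      exact ((hS s hs).sup hQ).aestronglyMeasurable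
    · filter_upwards [hnear] with s hs
      refine Eventually.of_forall fun x => ?_
      have hs0 : 0 < s - t := by linarith [hs.1]
      have h1 : slope (h x) t s ≤ K.indicator (fun _ => |C|) x := by
        by_cases hx : x ∈ K
        · rw [indicator_of_mem hx, slope_def_field, div_le_iff₀ hs0]
          have := hfwd x hx s ⟨hs.1.le, hs.2⟩
          nlinarith [le_abs_self C]
        · rw [indicator_of_notMem hx, slope_def_field, hsupp x hx s ⟨hs.1.le, hs.2⟩,
            hsupp x hx t ht]
          simp
      have h2 : 0 ≤ K.indicator (fun _ => |C|) x := indicator_nonneg (fun _ _ => abs_nonneg C) x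
      rw [Real.norm_eq_abs, abs_le]
      constructor
      · have := le_max_right (slope (h x) t s) (Q x)
        linarith [neg_abs_le (Q x)]
      · refine max_le ?_ ?_
        · linarith [abs_nonneg (Q x)]
        · linarith [le_abs_self (Q x)]
    · refine Integrable.add ?_ hQ.abs
      exact (integrable_indicator_iff hK.measurableSet).2
        (integrableOn_const (hK.measure_lt_top.ne))
    · refine Eventually.of_forall fun x => ?_
      have h1 : Tendsto (slope (h x) t) (𝓝[>] t) (𝓝 (q x)) := by
        have := hasDerivWithinAt_iff_tendsto_slope.1 (hq x)
        simpa using this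
      have h2 := h1.max (tendsto_const_nhds (x := Q x))
      rwa [max_eq_right (hqQ x)] at h2
  filter_upwards [hlim.eventually (gt_mem_nhds hr), hnear] with s hs1 hs2
  refine lt_of_le_of_lt ?_ hs1
  have : slope (fun s => ∫ x, h x s) t s = ∫ x, slope (h x) t s := by
    simp only [slope, vsub_eq_sub, smul_eq_mul]
    rw [integral_const_mul, integral_sub (hI s ⟨hs2.1.le, hs2.2⟩) (hI t ht)]
  rw [this]
  exact integral_mono (hS s hs2) ((hS s hs2).sup hQ) fun x => le_max_left _ _

/-- A one-sided growth estimate for the integral of a function that is forward upper Lipschitz. -/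
theorem integral_sub_le_of_forward {h : Eu N → ℝ → ℝ} {K : Set (Eu N)} (hK : IsCompact K)
    {a b M : ℝ} (hab : a ≤ b) (hcont : ∀ s ∈ Icc a b, Continuous fun x => h x s)
    (hsupp : ∀ x ∉ K, ∀ s ∈ Icc a b, h x s = 0) (hbd : ∀ x, ∀ s ∈ Icc a b, |h x s| ≤ M)
    (htime : ∀ x, ContinuousOn (h x) (Icc a b))
    (hfwd : ∀ t ∈ Ioo a b, ∀ x ∈ K, ∃ ρ > 0, ∃ C, ∀ y ∈ ball x ρ, ∀ s ∈ Icc t (t + ρ),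
      h y s ≤ h y t + C * (s - t))
    {q Q : ℝ → Eu N → ℝ} (hq : ∀ t ∈ Ioo a b, ∀ x, HasDerivAt (h x) (q t x) t)
    (hqQ : ∀ t ∈ Ioo a b, ∀ x, q t x ≤ Q t x) (hQ : ∀ t ∈ Ioo a b, Integrable (Q t))
    {B B' : ℝ → ℝ} (hB : ContinuousOn B (Icc a b)) (hB' : ∀ t ∈ Ioo a b, HasDerivAt B (B' t) t)
    (hQB : ∀ t ∈ Ioo a b, ∫ x, Q t x ≤ B' t) :
    (∫ x, h x b) - ∫ x, h x a ≤ B b - B a := by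
  rcases hab.eq_or_lt with rfl | hab
  · simp
  have hNc : ContinuousOn (fun s => ∫ x, h x s) (Icc a b) := by
    intro s0 hs0
    refine tendsto_integral_filter_of_dominated_convergence (K.indicator fun _ => M) ?_ ?_ ?_ ?_
    · filter_upwards [self_mem_nhdsWithin] with s hs
      exact (hcont s hs).aestronglyMeasurable
    · filter_upwards [self_mem_nhdsWithin] with s hs
      refine Eventually.of_forall fun x => ?_
      by_cases hx : x ∈ K
      · rw [indicator_of_mem hx]; exact hbd x s hs
      · rw [indicator_of_notMem hx, hsupp x hx s hs]; simp
    · exact (integrable_indicator_iff hK.measurableSet).2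
        (integrableOn_const (hK.measure_lt_top.ne))
    · exact Eventually.of_forall fun x => htime x s0 hs0
  have main : ∀ a' ∈ Ioo a b, (∫ x, h x b) - ∫ x, h x a' ≤ B b - B a' := by
    intro a' ha'
    have hsub : Icc a' b ⊆ Icc a b := Icc_subset_Icc_left ha'.1.le
    have := image_le_of_liminf_slope_right_le_deriv_boundary (f := fun s => ∫ x, h x s)
      (B := fun s => B s + ((∫ x, h x a') - B a')) (B' := B') (a := a') (b := b)
      (hNc.mono hsub) (by simp) ((hB.mono hsub).add continuousOn_const)
      (fun t ht => ((hB' t ⟨ha'.1.trans_le ht.1, ht.2⟩).add_const _).hasDerivWithinAt) ?_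
      (right_mem_Icc.2 ha'.2.le)
    · linarith
    · intro t ht r hr
      have ht' : t ∈ Ioo a b := ⟨ha'.1.trans_le ht.1, ht.2⟩
      obtain ⟨η, hη, C, hC⟩ : ∃ η > 0, ∃ C, ∀ x ∈ K, ∀ s ∈ Icc t (t + η),
          h x s ≤ h x t + C * (s - t) := by
        choose! ρ hρ C hC using hfwd t ht'
        obtain ⟨F, hF, hKF⟩ := hK.elim_nhds_subcover (fun x => ball x (ρ x))
          (fun x hx => ball_mem_nhds x (hρ x hx))
        rcases F.eq_empty_or_nonempty with rfl | hne
        · refine ⟨1, one_pos, 0, fun x hx => ?_⟩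
          exact absurd (hKF hx) (by simp)
        · refine ⟨F.inf' hne ρ, (Finset.lt_inf'_iff _).2 fun x hx => hρ x (hF x hx), F.sup' hne C,
            fun x hx s hs => ?_⟩
          obtain ⟨z, hz, hxz⟩ := mem_iUnion₂.1 (hKF hx)
          have h1 := hC z (hF z hz) x hxz s ⟨hs.1, hs.2.trans (by
            have := Finset.inf'_le ρ hz
            linarith)⟩
          have h2 : C z ≤ F.sup' hne C := Finset.le_sup' C hz
          have h3 : 0 ≤ s - t := by linarith [hs.1]
          nlinarith
      set η' := min η (b - t) with hη'
      have hη'0 : 0 < η' := lt_min hη (by linarith [ht.2])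
      have hs' : ∀ s ∈ Icc t (t + η'), s ∈ Icc a b := fun s hs =>
        ⟨by linarith [hs.1, ht'.1], by linarith [hs.2, min_le_right η (b - t)]⟩
      refine (eventually_slope_integral_lt hK hη'0 (fun s hs => hcont s (hs' s hs))
        (fun x hx s hs => hsupp x hx s (hs' s hs))
        (fun x hx s hs => hC x hx s ⟨hs.1, by linarith [hs.2, min_le_left η (b - t)]⟩)
        (fun x => (hq t ht' x).hasDerivWithinAt) (hqQ t ht') (hQ t ht')
        ((hQB t ht').trans_lt hr)).frequently
  have hl : Tendsto (fun a' => (∫ x, h x b) - ∫ x, h x a') (𝓝[>] a)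
      (𝓝 ((∫ x, h x b) - ∫ x, h x a)) := by
    refine tendsto_const_nhds.sub ?_
    exact (hNc a (left_mem_Icc.2 hab.le)).mono_left
      (nhdsWithin_le_of_mem (Icc_mem_nhdsGT hab))
  have hr : Tendsto (fun a' => B b - B a') (𝓝[>] a) (𝓝 (B b - B a)) := by
    refine tendsto_const_nhds.sub ?_
    exact (hB a (left_mem_Icc.2 hab.le)).mono_left
      (nhdsWithin_le_of_mem (Icc_mem_nhdsGT hab))
  refine le_of_tendsto_of_tendsto hl hr ?_
  filter_upwards [Ioo_mem_nhdsGT hab] with a' ha' using main a' ha'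

theorem SepReg.hasDerivAt {v : Eu N → ℝ → ℝ} (hv : SepReg v) (x : Eu N) (t : ℝ) :
    HasDerivAt (v x) (deriv (v x) t) t :=
  ((hv.time x).differentiable (by norm_num) t).hasDerivAt

theorem SepReg.sub {v w : Eu N → ℝ → ℝ} (hv : SepReg v) (hw : SepReg w) :
    SepReg fun x t => v x t - w x t :=
  ⟨fun t => (hv.space t).sub (hw.space t), fun x => (hv.time x).sub (hw.time x)⟩

theorem deriv_eq_heat_add (v : Eu N → ℝ → ℝ) (x : Eu N) (t : ℝ) :
    deriv (v x) t = heat v x t + lap (fun y => v y t) x := by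
  unfold heat; ring

/-- Cutoff functions. -/
theorem exists_cutoff (x₁ : Eu N) {ρ : ℝ} (hρ : 0 < ρ) : ∃ χ : Eu N → ℝ,
    ContDiff ℝ 3 χ ∧ (∀ x, 0 ≤ χ x) ∧ (∀ x, χ x ≤ 1) ∧ (∀ x ∈ closedBall x₁ (ρ / 2), χ x = 1) ∧
    (∀ x ∉ ball x₁ ρ, χ x = 0) ∧ HasCompactSupport χ ∧
    (∀ x, (dist x x₁ < ρ / 2 ∨ ρ < dist x x₁) → ∀ i, pd i χ x = 0) := by
  let f : ContDiffBump x₁ := ⟨ρ / 2, ρ, by linarith, by linarith⟩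
  refine ⟨f, f.contDiff, fun x => f.nonneg, fun x => f.le_one,
    fun x hx => f.one_of_mem_closedBall hx, fun x hx => ?_, f.hasCompactSupport, ?_⟩
  · exact f.zero_of_le_dist (by simpa using hx)
  · rintro x (h | h) i
    · have : (f : Eu N → ℝ) =ᶠ[𝓝 x] fun _ => 1 := by
        filter_upwards [isOpen_ball.mem_nhds (mem_ball.2 h)] with y hy
        exact f.one_of_mem_closedBall (ball_subset_closedBall hy)
      rw [pd_congr this, pd_const]
    · have : (f : Eu N → ℝ) =ᶠ[𝓝 x] fun _ => 0 := by
        filter_upwards [isClosed_closedBall.isOpen_compl.mem_nhds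
          (show x ∈ (closedBall x₁ ρ)ᶜ by simpa using h)] with y hy
        exact f.zero_of_le_dist (by simpa using (le_of_lt (by simpa using hy)))
      rw [pd_congr this, pd_const]

theorem comparison {v z : Eu N → ℝ → ℝ} (hv : SepReg v) (hz : SepReg z) {x₁ : Eu N}
    {ρ a b M : ℝ} (hρ : 0 < ρ) (hab : a ≤ b)
    (hinit : ∀ x ∈ closedBall x₁ ρ, z x a ≤ v x a)
    (hann : ∀ x ∈ closedBall x₁ ρ, ρ / 2 ≤ dist x x₁ → ∀ t ∈ Icc a b, z x t ≤ v x t)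
    (hheat : ∀ x ∈ closedBall x₁ ρ, ∀ t ∈ Ioo a b, heat z x t ≤ heat v x t)
    (hbd : ∀ x ∈ closedBall x₁ ρ, ∀ t ∈ Icc a b, z x t - v x t ≤ M)
    (hfwd : ∀ t ∈ Ioo a b, ∀ x ∈ closedBall x₁ ρ, ∃ ρ' > 0, ∃ C, ∀ y ∈ ball x ρ',
      ∀ s ∈ Icc t (t + ρ'), max (z y s - v y s) 0 ≤ max (z y t - v y t) 0 + C * (s - t)) :
    z x₁ b ≤ v x₁ b := by
  obtain ⟨χ, hχ, hχ0, hχ1, hχin, hχout, hχc, hχpd⟩ := exists_cutoff x₁ hρ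
  set g : Eu N → ℝ → ℝ := fun x t => z x t - v x t with hg
  have hgr : SepReg g := hz.sub hv
  have hM : 0 ≤ max M 0 := le_max_right _ _
  have hgM : ∀ x ∈ closedBall x₁ ρ, ∀ t ∈ Icc a b, max (g x t) 0 ≤ max M 0 := fun x hx t ht =>
    max_le_max (hbd x hx t ht) le_rfl
  have hcube : ∀ y : ℝ, HasDerivAt (fun y : ℝ => max y 0 ^ 3) (3 * max y 0 ^ 2) y := fun y => by
    simpa using hasDerivAt_max_pow 1 y
  have key := integral_sub_le_of_forward (h := fun x t => χ x * max (g x t) 0 ^ 3)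
    (isCompact_closedBall x₁ ρ) (a := a) (b := b) (M := max M 0 ^ 3) hab
    (fun s _ => hχ.continuous.mul (((hgr.space s).continuous.max continuous_const).pow 3))
    (fun x hx s _ => by rw [hχout x (fun h => hx (ball_subset_closedBall h)), zero_mul])
    (fun x s hs => by
      have h0 : 0 ≤ χ x * max (g x s) 0 ^ 3 :=
        mul_nonneg (hχ0 x) (pow_nonneg (le_max_right _ _) 3)
      rw [abs_of_nonneg h0]
      by_cases hx : x ∈ closedBall x₁ ρ
      · calc _ ≤ 1 * max (g x s) 0 ^ 3 :=
              mul_le_mul_of_nonneg_right (hχ1 x) (pow_nonneg (le_max_right _ _) 3)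
          _ ≤ _ := by
              rw [one_mul]
              exact pow_le_pow_left₀ (le_max_right _ _) (hgM x hx s hs) 3
      · rw [hχout x (fun h => hx (ball_subset_closedBall h)), zero_mul]
        positivity)
    (fun x => (continuous_const.mul
      (((hgr.time x).continuous.max continuous_const).pow 3)).continuousOn)
    (by
      intro t ht x hx
      obtain ⟨ρ', hρ', C, hC⟩ := hfwd t ht x hx
      refine ⟨min ρ' (b - t), lt_min hρ' (by linarith [ht.2]), 3 * max M 0 ^ 2 * |C|,
        fun y hy s hs => ?_⟩
      have hs0 : 0 ≤ s - t := by linarith [hs.1]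
      by_cases hyb : y ∈ closedBall x₁ ρ
      · have h1 := hC y (ball_subset_ball (min_le_left _ _) hy) s
          ⟨hs.1, by linarith [hs.2, min_le_left ρ' (b - t)]⟩
        have hsI : s ∈ Icc a b := ⟨by linarith [ht.1], by linarith [hs.2, min_le_right ρ' (b - t)]⟩
        have hA := hgM y hyb s hsI
        have hB := hgM y hyb t ⟨ht.1.le, ht.2.le⟩
        have hA0 : 0 ≤ max (g y s) 0 := le_max_right _ _
        have hB0 : 0 ≤ max (g y t) 0 := le_max_right _ _
        change max (g y s) 0 ≤ max (g y t) 0 + C * (s - t) at h1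
        have hCC : C * (s - t) ≤ |C| * (s - t) := mul_le_mul_of_nonneg_right (le_abs_self C) hs0
        have hCC0 : 0 ≤ |C| * (s - t) := mul_nonneg (abs_nonneg C) hs0
        generalize max (g y s) 0 = A at *
        generalize max (g y t) 0 = D at *
        generalize max M 0 = L at *
        rw [show 3 * L ^ 2 * |C| * (s - t) = 3 * L ^ 2 * (|C| * (s - t)) by ring]
        generalize |C| * (s - t) = E at *
        have h3 : A ^ 3 ≤ D ^ 3 + 3 * L ^ 2 * E := by
          rcases le_total A D with hAD | hAD
          · have := pow_le_pow_left₀ hA0 hAD 3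
            have : 0 ≤ 3 * L ^ 2 * E := by positivity
            linarith
          · have e : A ^ 3 = D ^ 3 + (A - D) * (A ^ 2 + A * D + D ^ 2) := by ring
            rw [e]
            have h4 : A ^ 2 + A * D + D ^ 2 ≤ 3 * L ^ 2 := by nlinarith
            have h5 : A - D ≤ E := by linarith
            have h6 : (A - D) * (A ^ 2 + A * D + D ^ 2) ≤ E * (3 * L ^ 2) :=
              mul_le_mul h5 h4 (by positivity) hCC0
            linarith
        have h0 : 0 ≤ 3 * L ^ 2 * E := by positivity
        have h1' := hχ1 y
        have h0' := hχ0 y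
        have h7 : χ y * A ^ 3 ≤ χ y * (D ^ 3 + 3 * L ^ 2 * E) := mul_le_mul_of_nonneg_left h3 h0'
        have h8 : χ y * (3 * L ^ 2 * E) ≤ 3 * L ^ 2 * E := mul_le_of_le_one_left h0 h1'
        nlinarith
      · rw [hχout y (fun h => hyb (ball_subset_closedBall h))]
        simp only [zero_mul, zero_add]
        positivity)
    (q := fun t x => χ x * (3 * max (g x t) 0 ^ 2 * deriv (g x) t))
    (Q := fun t x => 3 * (χ x * max (g x t) 0 ^ 2 * lap (fun y => g y t) x))
    (fun t _ x => ((hcube (g x t)).comp t (hgr.hasDerivAt x t)).const_mul (χ x))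
    (by
      intro t ht x
      by_cases hx : x ∈ closedBall x₁ ρ
      · have h1 : deriv (g x) t ≤ lap (fun y => g y t) x := by
          have e1 : deriv (g x) t = deriv (z x) t - deriv (v x) t :=
            ((hz.hasDerivAt x t).sub (hv.hasDerivAt x t)).deriv
          have e2 : lap (fun y => g y t) x = lap (fun y => z y t) x - lap (fun y => v y t) x :=
            lap_sub (hz.space t) (hv.space t) x
          have := hheat x hx t ht
          unfold heat at this
          rw [e1, e2]; linarith
        have h2 : 0 ≤ 3 * (χ x * max (g x t) 0 ^ 2) :=
          mul_nonneg (by norm_num) (mul_nonneg (hχ0 x) (sq_nonneg _))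
        have := mul_le_mul_of_nonneg_left h1 h2
        linarith
      · simp [hχout x (fun h => hx (ball_subset_closedBall h))])
    (fun t _ => ((hχ.continuous.mul (((hgr.space t).continuous.max continuous_const).pow 2)).mul
      (continuous_lap (hgr.space t))).integrable_of_hasCompactSupport hχc.mul_right.mul_right
        |>.const_mul 3)
    (B := fun _ => 0) (B' := fun _ => 0) continuousOn_const (fun t _ => hasDerivAt_const t 0)
    (by
      intro t ht
      rw [integral_const_mul]
      have := integral_mul_sq_max_mul_lap_nonpos (hχ.of_le (by norm_num)) hχc hχ0 (hgr.space t)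
        (fun i x => by
          by_cases h : dist x x₁ < ρ / 2 ∨ ρ < dist x x₁
          · rw [hχpd x h, zero_mul]
          · push Not at h
            have := hann x (mem_closedBall.2 h.2) h.1 t ⟨ht.1.le, ht.2.le⟩
            rw [max_eq_right (by simp only [hg]; linarith), mul_zero])
      linarith)
  have hzero : ∫ x, χ x * max (g x a) 0 ^ 3 = 0 := by
    refine integral_eq_zero_of_ae (Eventually.of_forall fun x => ?_)
    simp only [Pi.zero_apply]
    by_cases hx : x ∈ closedBall x₁ ρ
    · rw [max_eq_right (by simp only [hg]; linarith [hinit x hx])]; simp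
    · simp [hχout x (fun h => hx (ball_subset_closedBall h))]
  simp only [hzero, sub_zero] at key
  by_contra hcon
  push Not at hcon
  have hpos : 0 < ∫ x, χ x * max (g x b) 0 ^ 3 := by
    refine Continuous.integral_pos_of_hasCompactSupport_nonneg_nonzero (x := x₁)
      (hχ.continuous.mul (((hgr.space b).continuous.max continuous_const).pow 3)) hχc.mul_right
      (fun x => mul_nonneg (hχ0 x) (pow_nonneg (le_max_right _ _) 3)) ?_
    rw [hχin x₁ (mem_closedBall_self (by linarith)), one_mul]
    have : 0 < g x₁ b := by simp only [hg]; linarith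
    rw [max_eq_left this.le]
    positivity
  linarith

end Comparison

/-- If the closure of a nonempty set is covered by countably many closed sets, one of them contains
a portion of the closure around a point of the set. -/
theorem exists_portion {X : Type*} [MetricSpace X] [CompleteSpace X] {A : Set X} (hA : A.Nonempty)
    {F : ℕ → Set X} (hF : ∀ k, IsClosed (F k)) (hcov : ∀ P ∈ closure A, ∃ k, P ∈ F k) :
    ∃ k, ∃ P ∈ A, ∃ ε > 0, ball P ε ∩ closure A ⊆ F k := by
  have hcl : IsClosed (closure A) := isClosed_closure
  have : CompleteSpace (closure A) := hcl.completeSpace_coe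
  have : Nonempty (closure A) := ⟨⟨hA.some, subset_closure hA.some_mem⟩⟩
  obtain ⟨k, hk⟩ := nonempty_interior_of_iUnion_of_closed
    (f := fun k => ((↑) : closure A → X) ⁻¹' F k)
    (fun k => (hF k).preimage continuous_subtype_val)
    (by
      ext P
      simp only [mem_iUnion, mem_preimage, mem_univ, iff_true]
      exact hcov P P.2)
  obtain ⟨P, hP⟩ := hk
  obtain ⟨V, hV, hVo, hPV⟩ := mem_interior.1 hP
  obtain ⟨O, hO, rfl⟩ := isOpen_induced_iff.1 hVo
  obtain ⟨Q, hQO, hQA⟩ := mem_closure_iff.1 P.2 O hO hPV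
  obtain ⟨ε, hε, hball⟩ := Metric.isOpen_iff.1 hO Q hQO
  exact ⟨k, Q, hQA, ε, hε, fun R hR => hV (a := ⟨R, hR.2⟩) (hball hR.1)⟩

section Forward

variable {N : ℕ}

/-- Forward domination of `v` at `(x, t)`. -/
def FD (v : Eu N → ℝ → ℝ) (x : Eu N) (t : ℝ) : Prop :=
  ∃ ρ > 0, ∃ C, ∀ y ∈ ball x ρ, ∀ s ∈ Icc t (t + ρ), v y t - C * (s - t) ≤ v y s

theorem contDiff_normSq_sub (x₁ : Eu N) {n : WithTop ℕ∞} :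
    ContDiff ℝ n (fun x : Eu N => ‖x - x₁‖ ^ 2) :=
  (contDiff_id.sub contDiff_const).norm_sq ℝ

theorem pd_normSq_sub (x₁ : Eu N) (i : Fin N) (x : Eu N) :
    pd i (fun x : Eu N => ‖x - x₁‖ ^ 2) x = 2 * (x i - x₁ i) := by
  have h : HasFDerivAt (fun x : Eu N => ‖x - x₁‖ ^ 2) (2 • innerSL ℝ (x - x₁)) x := by
    have h1 := (hasStrictFDerivAt_norm_sq (x - x₁)).hasFDerivAt
    have h2 : HasFDerivAt (fun x : Eu N => x - x₁) (ContinuousLinearMap.id ℝ (Eu N)) x :=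
      (hasFDerivAt_id x).sub_const x₁
    exact h1.comp x h2
  rw [pd, h.fderiv]
  simp [innerSL_apply_apply, EuclideanSpace.inner_single_right]

theorem pd_coord (c : ℝ) (i j : Fin N) (x : Eu N) :
    pd i (fun x : Eu N => x j - c) x = if i = j then 1 else 0 := by
  have h : HasFDerivAt (fun x : Eu N => x j - c) (EuclideanSpace.proj j : Eu N →L[ℝ] ℝ) x :=
    (EuclideanSpace.proj j : Eu N →L[ℝ] ℝ).hasFDerivAt.sub_const c
  rw [pd, h.fderiv]
  simp [eq_comm]

theorem lap_normSq_sub (x₁ x : Eu N) : lap (fun x : Eu N => ‖x - x₁‖ ^ 2) x = 2 * N := by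
  rw [lap_eq (contDiff_normSq_sub x₁)]
  have : ∀ i : Fin N, pd i (fun x : Eu N => ‖x - x₁‖ ^ 2) = fun x => 2 * (x i - x₁ i) :=
    fun i => funext fun y => pd_normSq_sub x₁ i y
  have h2 : ∀ i : Fin N, pd i (fun x : Eu N => 2 * (x i - x₁ i)) x = 2 := fun i => by
    rw [pd_const_mul 2 (f := fun x : Eu N => x i - x₁ i)]
    · rw [pd_coord]; simp
    · exact ((EuclideanSpace.proj i : Eu N →L[ℝ] ℝ).differentiableAt).sub_const _
  simp only [this, h2]
  simp [mul_comm]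

/-- Barrier functions. -/
noncomputable def barrier (f : Eu N → ℝ) (x₁ : Eu N) (A c D t₀ : ℝ) (x : Eu N) (t : ℝ) : ℝ :=
  f x - A * ‖x - x₁‖ ^ 2 - c - D * (t - t₀)

theorem sepReg_barrier {f : Eu N → ℝ} (hf : ContDiff ℝ 2 f) (x₁ : Eu N) (A c D t₀ : ℝ) :
    SepReg (barrier f x₁ A c D t₀) := by
  constructor
  · intro t
    exact ((hf.sub (contDiff_const.mul (contDiff_normSq_sub x₁))).sub contDiff_const).sub
      contDiff_const
  · intro x
    unfold barrier
    fun_prop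

theorem heat_barrier {f : Eu N → ℝ} (hf : ContDiff ℝ 2 f) (x₁ : Eu N) (A c D t₀ : ℝ) (x : Eu N)
    (t : ℝ) : heat (barrier f x₁ A c D t₀) x t = - D - lap f x + 2 * N * A := by
  have h1 : HasDerivAt (barrier f x₁ A c D t₀ x) (0 - D * 1) t := by
    unfold barrier
    exact (hasDerivAt_const t _).sub (((hasDerivAt_id t).sub_const t₀).const_mul D)
  have h2 : ContDiff ℝ 2 (fun x : Eu N => A * ‖x - x₁‖ ^ 2) :=
    contDiff_const.mul (contDiff_normSq_sub x₁)
  unfold heat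
  rw [h1.deriv]
  unfold barrier
  rw [lap_sub ((hf.sub h2).sub contDiff_const) contDiff_const, lap_sub (hf.sub h2) contDiff_const,
    lap_sub hf h2, lap_const_mul _ (contDiff_normSq_sub x₁), lap_normSq_sub, lap_const, lap_const]
  ring

/-- Comparison with a barrier, where the forward hypothesis allows a second alternative. -/
theorem barrier_comparison {v : Eu N → ℝ → ℝ} (hv : SepReg v) {f : Eu N → ℝ}
    (hf : ContDiff ℝ 2 f) {x₁ : Eu N} {ρ a b A c D C₀ K L : ℝ} (hρ : 0 < ρ) (hab : a ≤ b)
    (hA : 0 ≤ A) (hc : 0 ≤ c) (hD : 0 ≤ D)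
    (hv0 : ∀ x ∈ closedBall x₁ ρ, ∀ t ∈ Icc a b, 0 ≤ v x t)
    (hvh : ∀ x ∈ closedBall x₁ ρ, ∀ t ∈ Icc a b, -C₀ ≤ heat v x t)
    (hfK : ∀ x ∈ closedBall x₁ ρ, f x ≤ K) (hfL : ∀ x ∈ closedBall x₁ ρ, - L ≤ lap f x)
    (hAK : K ≤ A * (ρ / 2) ^ 2) (hDC : C₀ + 2 * N * A + L ≤ D)
    (hinit : ∀ x ∈ closedBall x₁ ρ, f x - A * ‖x - x₁‖ ^ 2 - c ≤ v x a)
    (hfwd : ∀ t ∈ Ioo a b, ∀ x ∈ closedBall x₁ ρ, FD v x t ∨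
      ∃ ρ' > 0, ∀ y ∈ ball x ρ', ∀ s ∈ Icc t (t + ρ'), barrier f x₁ A c D a y s ≤ v y s) :
    f x₁ - c - D * (b - a) ≤ v x₁ b := by
  have hub : ∀ x, ∀ t, a ≤ t → barrier f x₁ A c D a x t ≤ f x - A * ‖x - x₁‖ ^ 2 := by
    intro x t ht
    have : 0 ≤ D * (t - a) := mul_nonneg hD (by linarith)
    unfold barrier; linarith
  have key := comparison hv (sepReg_barrier hf x₁ A c D a) (M := K) hρ hab
    (fun x hx => by have := hinit x hx; unfold barrier; simpa using this)
    (fun x hx hd t ht => by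
      refine (hub x t ht.1).trans ((?_ : _ ≤ (0 : ℝ)).trans (hv0 x hx t ht))
      have h1 : (ρ / 2) ^ 2 ≤ ‖x - x₁‖ ^ 2 := by
        rw [dist_eq_norm] at hd
        exact pow_le_pow_left₀ (by linarith) hd 2
      have := mul_le_mul_of_nonneg_left h1 hA
      linarith [hfK x hx])
    (fun x hx t ht => by
      rw [heat_barrier hf]
      have := hvh x hx t ⟨ht.1.le, ht.2.le⟩
      have := hfL x hx
      linarith)
    (fun x hx t ht => by
      have h1 := hub x t ht.1
      have h2 := hv0 x hx t ht
      have h3 : 0 ≤ A * ‖x - x₁‖ ^ 2 := by positivity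
      linarith [hfK x hx])
    (by
      intro t ht x hx
      rcases hfwd t ht x hx with ⟨ρ', hρ', C, hC⟩ | ⟨ρ', hρ', h⟩
      · refine ⟨ρ', hρ', |C|, fun y hy s hs => ?_⟩
        have h1 := hC y hy s hs
        have hs0 : 0 ≤ s - t := by linarith [hs.1]
        have h2 : C * (s - t) ≤ |C| * (s - t) := mul_le_mul_of_nonneg_right (le_abs_self C) hs0
        have h3 : 0 ≤ |C| * (s - t) := mul_nonneg (abs_nonneg C) hs0
        have h4 : barrier f x₁ A c D a y s ≤ barrier f x₁ A c D a y t := by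
          unfold barrier; nlinarith
        refine max_le ?_ ?_
        · have := le_max_left (barrier f x₁ A c D a y t - v y t) 0
          linarith
        · have := le_max_right (barrier f x₁ A c D a y t - v y t) 0
          linarith
      · refine ⟨ρ', hρ', 0, fun y hy s hs => ?_⟩
        rw [max_eq_right (by linarith [h y hy s hs])]
        have := le_max_right (barrier f x₁ A c D a y t - v y t) 0
        linarith)
  unfold barrier at key
  simpa using key

/-- The closed sets of uniform local control used in the category argument. -/
def ctrl (v : Eu N → ℝ → ℝ) (k : ℕ) : Set (Eu N × ℝ) :=
  {P | (∀ s s', |s - P.2| < 1 / (k + 1 : ℝ) → |s' - P.2| < 1 / (k + 1 : ℝ) →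
      |v P.1 s - v P.1 s'| ≤ (k + 1) * |s - s'|) ∧
    (∀ s, |s - P.2| < 1 / (k + 1 : ℝ) → v P.1 s ≤ k + 1) ∧
    ∀ y y', dist y P.1 < 1 / (k + 1 : ℝ) → dist y' P.1 < 1 / (k + 1 : ℝ) →
      |v y P.2 - v y' P.2| ≤ (k + 1) * dist y y'}

theorem exists_mem_ctrl {v : Eu N → ℝ → ℝ} (hv : SepReg v) (P : Eu N × ℝ) : ∃ k, P ∈ ctrl v k := by
  obtain ⟨K1, s1, hs1, hK1⟩ := (hv.time P.1).contDiffAt (x := P.2) |>.exists_lipschitzOnWith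
  obtain ⟨K2, s2, hs2, hK2⟩ := ((hv.space P.2).of_le (by norm_num : (1 : WithTop ℕ∞) ≤ 2)).contDiffAt
    (x := P.1) |>.exists_lipschitzOnWith
  obtain ⟨ε1, hε1, hb1⟩ := Metric.mem_nhds_iff.1 hs1
  obtain ⟨ε2, hε2, hb2⟩ := Metric.mem_nhds_iff.1 hs2
  obtain ⟨k, hk⟩ := exists_nat_gt (max (max (1 / ε1) (1 / ε2)) (max (max (K1 : ℝ) K2) (v P.1 P.2 + K1)))
  simp only [max_lt_iff] at hk
  obtain ⟨⟨h1, h2⟩, ⟨h3, h4⟩, h5⟩ := hk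
  have hk0 : (0 : ℝ) < k + 1 := by positivity
  have e1 : 1 / (k + 1 : ℝ) < ε1 := by
    rw [div_lt_comm₀ hk0 hε1]; linarith
  have e2 : 1 / (k + 1 : ℝ) < ε2 := by
    rw [div_lt_comm₀ hk0 hε2]; linarith
  refine ⟨k, fun s s' hs hs' => ?_, fun s hs => ?_, fun y y' hy hy' => ?_⟩
  · have := hK1.dist_le_mul s (hb1 (by rw [mem_ball, Real.dist_eq]; linarith)) s'
      (hb1 (by rw [mem_ball, Real.dist_eq]; linarith))
    rw [Real.dist_eq, Real.dist_eq] at this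
    exact this.trans (mul_le_mul_of_nonneg_right (by linarith) (abs_nonneg _))
  · have := hK1.dist_le_mul s (hb1 (by rw [mem_ball, Real.dist_eq]; linarith)) P.2
      (hb1 (mem_ball_self hε1))
    rw [Real.dist_eq, Real.dist_eq] at this
    have h6 : 1 / (k + 1 : ℝ) ≤ 1 := by
      rw [div_le_one hk0]; have : (0 : ℝ) ≤ k := k.cast_nonneg
      linarith
    have h7 : (K1 : ℝ) * |s - P.2| ≤ K1 * 1 := mul_le_mul_of_nonneg_left (by linarith) K1.2
    have := le_abs_self (v P.1 s - v P.1 P.2)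
    linarith
  · have := hK2.dist_le_mul y (hb2 (by rw [mem_ball]; linarith)) y'
      (hb2 (by rw [mem_ball]; linarith))
    rw [Real.dist_eq] at this
    exact this.trans (mul_le_mul_of_nonneg_right (by linarith) dist_nonneg)

theorem isClosed_ctrl {v : Eu N → ℝ → ℝ} (hv : SepReg v) (k : ℕ) : IsClosed (ctrl v k) := by
  have hx : ∀ s, Continuous fun P : Eu N × ℝ => v P.1 s := fun s =>
    (hv.space s).continuous.comp continuous_fst
  have ht : ∀ y, Continuous fun P : Eu N × ℝ => v y P.2 := fun y =>
    (hv.time y).continuous.comp continuous_snd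
  have himp' : ∀ (f : Eu N × ℝ → ℝ) (c : ℝ) (S : Set (Eu N × ℝ)), Continuous f → IsClosed S →
      IsClosed {P | f P < c → P ∈ S} := by
    intro f c S hf hS
    have : {P | f P < c → P ∈ S} = {P | c ≤ f P} ∪ S := by
      ext P; simp only [mem_ofPred_eq, mem_union, ← not_lt]; tauto
    rw [this]
    exact (isClosed_le continuous_const hf).union hS
  unfold ctrl
  simp only [ofPred_and, ofPred_forall]
  refine IsClosed.inter ?_ (IsClosed.inter ?_ ?_)
  · refine isClosed_iInter fun s => isClosed_iInter fun s' => ?_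
    exact himp' (fun P => |s - P.2|) _ {P | |s' - P.2| < 1 / (k + 1 : ℝ) →
      |v P.1 s - v P.1 s'| ≤ (k + 1) * |s - s'|} (by fun_prop)
      (himp' (fun P => |s' - P.2|) _ {P | |v P.1 s - v P.1 s'| ≤ (k + 1) * |s - s'|} (by fun_prop)
        (isClosed_le ((hx s).sub (hx s')).abs continuous_const))
  · refine isClosed_iInter fun s => ?_
    exact himp' (fun P => |s - P.2|) _ {P | v P.1 s ≤ k + 1} (by fun_prop)
      (isClosed_le (hx s) continuous_const)
  · refine isClosed_iInter fun y => isClosed_iInter fun y' => ?_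
    exact himp' (fun P => dist y P.1) _ {P | dist y' P.1 < 1 / (k + 1 : ℝ) →
      |v y P.2 - v y' P.2| ≤ (k + 1) * dist y y'} (by fun_prop)
      (himp' (fun P => dist y' P.1) _ {P | |v y P.2 - v y' P.2| ≤ (k + 1) * dist y y'}
        (by fun_prop) (isClosed_le ((ht y).sub (ht y')).abs continuous_const))

theorem gap_estimate {v : Eu N → ℝ → ℝ} (hv : SepReg v) {x₀ : Eu N} {R a b C₀ κ K σ : ℝ}
    (hR : 0 < R) (hab : a ≤ b) (hC₀ : 0 ≤ C₀) (hK : 0 ≤ K) (hσ : 0 < σ)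
    (hv0 : ∀ x ∈ closedBall x₀ R, ∀ t ∈ Icc a b, 0 ≤ v x t)
    (hvh : ∀ x ∈ closedBall x₀ R, ∀ t ∈ Icc a b, -C₀ ≤ heat v x t)
    (hFD : ∀ x ∈ closedBall x₀ R, ∀ t ∈ Ioo a b, FD v x t)
    (hLip : ∀ y ∈ closedBall x₀ R, ∀ y' ∈ closedBall x₀ R, |v y a - v y' a| ≤ κ * dist y y')
    (hvK : ∀ y ∈ closedBall x₀ R, v y a ≤ K) {x₁ : Eu N} (hx₁ : x₁ ∈ closedBall x₀ (R / 2)) :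
    v x₁ a - σ - (C₀ + 2 * N * (κ ^ 2 / (4 * σ) + K / (R / 4) ^ 2)) * (b - a) ≤ v x₁ b := by
  have hsub : closedBall x₁ (R / 2) ⊆ closedBall x₀ R := by
    refine closedBall_subset_closedBall' ?_
    have := mem_closedBall.1 hx₁; linarith
  have hx₁' : x₁ ∈ closedBall x₀ R := hsub (mem_closedBall_self (by linarith))
  have hA1 : 0 ≤ κ ^ 2 / (4 * σ) := by positivity
  have hA2 : 0 ≤ K / (R / 4) ^ 2 := by positivity
  set A := κ ^ 2 / (4 * σ) + K / (R / 4) ^ 2 with hA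
  refine barrier_comparison hv (f := fun _ => v x₁ a) contDiff_const (ρ := R / 2) (A := A)
    (C₀ := C₀) (K := K) (L := 0) (by linarith) hab (by linarith) hσ.le (by positivity)
    (fun x hx => hv0 x (hsub hx)) (fun x hx => hvh x (hsub hx)) (fun x _ => hvK x₁ hx₁')
    (fun x _ => by rw [lap_const]; simp) ?_ (by linarith) ?_
    (fun t ht x hx => Or.inl (hFD x (hsub hx) t ht))
  · have : R / 2 / 2 = R / 4 := by ring
    rw [this, hA, add_mul, div_mul_cancel₀ _ (by positivity)]
    have : 0 ≤ κ ^ 2 / (4 * σ) * (R / 4) ^ 2 := by positivity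
    linarith
  · intro x hx
    have h1 := hLip x₁ hx₁' x (hsub hx)
    have h2 := le_abs_self (v x₁ a - v x a)
    rw [dist_comm, dist_eq_norm] at h1
    set d := ‖x - x₁‖
    have h3 : κ * d ≤ σ + κ ^ 2 / (4 * σ) * d ^ 2 := by
      have : σ + κ ^ 2 / (4 * σ) * d ^ 2 - κ * d = (κ * d - 2 * σ) ^ 2 / (4 * σ) := by
        field_simp; ring
      have : 0 ≤ (κ * d - 2 * σ) ^ 2 / (4 * σ) := by positivity
      linarith
    have h4 : 0 ≤ K / (R / 4) ^ 2 * d ^ 2 := by positivity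
    rw [hA, add_mul]
    linarith

theorem forward_domination {v : Eu N → ℝ → ℝ} (hv : SepReg v) {U : Set (Eu N × ℝ)}
    (hU : IsOpen U) {C₀ : ℝ} (hC₀ : 0 ≤ C₀) (h0 : ∀ P ∈ U, 0 ≤ v P.1 P.2)
    (hh : ∀ P ∈ U, -C₀ ≤ heat v P.1 P.2) : ∀ P ∈ U, FD v P.1 P.2 := by
  by_contra hcon
  push Not at hcon
  set A : Set (Eu N × ℝ) := {P | P ∈ U ∧ ¬ FD v P.1 P.2} with hA
  have hAne : A.Nonempty := hcon
  obtain ⟨k, P, hPA, ε, hε, hport⟩ := exists_portion hAne (fun k => isClosed_ctrl hv k)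
    (fun P _ => exists_mem_ctrl hv P)
  obtain ⟨x₀, t₀⟩ := P
  obtain ⟨ε', hε', hUb⟩ := Metric.isOpen_iff.1 hU _ hPA.1
  set κ : ℝ := k + 1 with hκ
  have hκ0 : 0 < κ := by positivity
  set δ : ℝ := 1 / (k + 1 : ℝ) with hδ
  have hδ0 : 0 < δ := by positivity
  obtain ⟨R, hR, hRε, hRε', hRδ⟩ : ∃ R > 0, R < ε ∧ R < ε' ∧ 2 * R < δ := by
    refine ⟨min (min ε ε') δ / 4, by positivity, ?_, ?_, ?_⟩
    · have : min (min ε ε') δ ≤ ε := (min_le_left _ _).trans (min_le_left _ _)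
      linarith
    · have : min (min ε ε') δ ≤ ε' := (min_le_left _ _).trans (min_le_right _ _)
      linarith
    · have : min (min ε ε') δ ≤ δ := min_le_right _ _
      linarith
  have hδκ : κ * δ = 1 := by rw [hδ, hκ]; field_simp
  have hbox : ∀ x ∈ closedBall x₀ R, ∀ t ∈ Icc (t₀ - R) (t₀ + R), (x, t) ∈ U := by
    intro x hx t ht
    refine hUb (mem_ball.2 ?_)
    rw [Prod.dist_eq, max_lt_iff]
    refine ⟨lt_of_le_of_lt hx hRε', ?_⟩
    rw [Real.dist_eq, abs_lt]
    constructor <;> linarith [ht.1, ht.2]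
  have hF : ∀ x ∈ closedBall x₀ R, ∀ t ∈ Icc (t₀ - R) (t₀ + R), (x, t) ∈ closure A →
      (x, t) ∈ ctrl v k := by
    intro x hx t ht hc
    refine hport ⟨mem_ball.2 ?_, hc⟩
    rw [Prod.dist_eq, max_lt_iff]
    refine ⟨lt_of_le_of_lt hx hRε, ?_⟩
    rw [Real.dist_eq, abs_lt]
    constructor <;> linarith [ht.1, ht.2]
  have hFDn : ∀ x ∈ closedBall x₀ R, ∀ t ∈ Icc (t₀ - R) (t₀ + R), (x, t) ∉ closure A →
      FD v x t := by
    intro x hx t ht hc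
    by_contra hn
    exact hc (subset_closure ⟨hbox x hx t ht, hn⟩)
  set T : Set ℝ := Prod.snd '' ((closedBall x₀ R ×ˢ Icc (t₀ - R) (t₀ + R)) ∩ closure A) with hT
  have hTc : IsCompact T :=
    (((isCompact_closedBall x₀ R).prod isCompact_Icc).inter_right isClosed_closure).image
      continuous_snd
  have hTmem : ∀ x ∈ closedBall x₀ R, ∀ t ∈ Icc (t₀ - R) (t₀ + R), (x, t) ∈ closure A → t ∈ T :=
    fun x hx t ht hc => ⟨(x, t), ⟨⟨hx, ht⟩, hc⟩, rfl⟩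
  have hTI : ∀ t ∈ T, t ∈ Icc (t₀ - R) (t₀ + R) := by
    rintro t ⟨⟨x, s⟩, ⟨⟨_, hs⟩, _⟩, rfl⟩; exact hs
  have hTLip : ∀ t ∈ T, (∀ y ∈ closedBall x₀ R, ∀ y' ∈ closedBall x₀ R,
      |v y t - v y' t| ≤ κ * dist y y') ∧ ∀ y ∈ closedBall x₀ R, v y t ≤ κ + 1 := by
    rintro t ⟨⟨x, s⟩, ⟨⟨hx, hs⟩, hc⟩, rfl⟩
    have hm := hF x hx s hs hc
    have hd : ∀ y ∈ closedBall x₀ R, dist y x < δ := fun y hy => by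
      have := dist_triangle_right y x x₀
      have h1 := mem_closedBall.1 hy
      have h2 : dist x x₀ ≤ R := hx
      linarith
    refine ⟨fun y hy y' hy' => hm.2.2 y y' (hd y hy) (hd y' hy'), fun y hy => ?_⟩
    have h1 := hm.2.2 y x (hd y hy) (by rw [dist_self]; exact hδ0)
    have h2 := hm.2.1 s (by rw [sub_self, abs_zero]; exact hδ0)
    have h3 := le_abs_self (v y s - v x s)
    have h4 : κ * dist y x ≤ κ * δ := mul_le_mul_of_nonneg_left (hd y hy).le hκ0.le
    simp only at h1 h2 h3 ⊢
    linarith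
  have ht₀ : t₀ ∈ T := hTmem x₀ (mem_closedBall_self hR.le) t₀ ⟨by linarith, by linarith⟩
    (subset_closure hPA)
  have hgap : ∀ σ > 0, ∃ D ≥ 0, ∀ a ∈ T, ∀ b, a ≤ b → b ≤ t₀ + R → Ioo a b ∩ T = ∅ →
      ∀ x₁ ∈ closedBall x₀ (R / 2), v x₁ a - σ - D * (b - a) ≤ v x₁ b := by
    intro σ hσ
    refine ⟨C₀ + 2 * N * (κ ^ 2 / (4 * σ) + (κ + 1) / (R / 4) ^ 2), by positivity, ?_⟩
    intro a ha b hab hbR hem x₁ hx₁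
    have haI := hTI a ha
    have hI : ∀ t ∈ Icc a b, t ∈ Icc (t₀ - R) (t₀ + R) := fun t ht =>
      ⟨haI.1.trans ht.1, ht.2.trans hbR⟩
    refine gap_estimate hv hR hab hC₀ (by positivity) hσ
      (fun x hx t ht => h0 _ (hbox x hx t (hI t ht)))
      (fun x hx t ht => hh _ (hbox x hx t (hI t ht)))
      (fun x hx t ht => hFDn x hx t (hI t ⟨ht.1.le, ht.2.le⟩) fun hc => ?_)
      (hTLip a ha).1 (hTLip a ha).2 hx₁
    have : t ∈ Ioo a b ∩ T := ⟨ht, hTmem x hx t (hI t ⟨ht.1.le, ht.2.le⟩) hc⟩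
    rw [hem] at this; exact this
  have hball4 : closedBall x₀ (R / 4) ⊆ closedBall x₀ R := closedBall_subset_closedBall (by linarith)
  obtain ⟨L, hL⟩ := (isCompact_closedBall x₀ R).exists_bound_of_continuousOn
    (continuous_lap (hv.space t₀)).continuousOn
  have hL0 : 0 ≤ L := (norm_nonneg _).trans (hL x₀ (mem_closedBall_self hR.le))
  set B : ℝ := (κ + 1) / (R / 16) ^ 2 with hB
  have hB0 : 0 ≤ B := by positivity
  set C : ℝ := κ + C₀ + 2 * N * B + L with hC
  have hCκ : κ ≤ C := by
    have : 0 ≤ 2 * N * B := by positivity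
    linarith
  have hC0' : 0 ≤ C := by linarith
  refine hPA.2 ⟨R / 8, by positivity, C, fun x₁ hx₁ t ht => ?_⟩
  simp only at hx₁ ht ⊢
  refine le_of_forall_pos_sub_le fun e he => ?_
  have hsub : closedBall x₁ (R / 8) ⊆ closedBall x₀ (R / 4) := by
    refine closedBall_subset_closedBall' ?_
    have := mem_ball.1 hx₁; linarith
  have hIcc : ∀ s ∈ Icc t₀ t, s ∈ Icc (t₀ - R) (t₀ + R) := fun s hs =>
    ⟨by linarith [hs.1], by linarith [hs.2, ht.2]⟩
  have := barrier_comparison hv (f := fun x => v x t₀) (hv.space t₀) (x₁ := x₁) (ρ := R / 8)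
    (a := t₀) (b := t) (A := B) (c := e) (D := C) (C₀ := C₀) (K := κ + 1) (L := L) (by positivity)
    ht.1 hB0 he.le hC0' (fun x hx s hs => h0 _ (hbox x (hball4 (hsub hx)) s (hIcc s hs)))
    (fun x hx s hs => hh _ (hbox x (hball4 (hsub hx)) s (hIcc s hs)))
    (fun x hx => (hTLip t₀ ht₀).2 x (hball4 (hsub hx)))
    (fun x hx => by
      have := hL x (hball4 (hsub hx))
      rw [Real.norm_eq_abs, abs_le] at this
      exact this.1)
    (by
      have : R / 8 / 2 = R / 16 := by ring
      rw [this, hB, div_mul_cancel₀ _ (by positivity)])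
    (by linarith)
    (fun x _ => by
      have : 0 ≤ B * ‖x - x₁‖ ^ 2 := by positivity
      linarith)
    (by
      intro τ hτ x hx
      have hτI := hIcc τ ⟨hτ.1.le, hτ.2.le⟩
      by_cases hc : (x, τ) ∈ closure A
      · right
        have hm := hF x (hball4 (hsub hx)) τ hτI hc
        have hτT := hTmem x (hball4 (hsub hx)) τ hτI hc
        obtain ⟨D, hD0, hD⟩ := hgap (e / 4) (by positivity)
        set ρ' : ℝ := min (min (R / 8) (t - τ)) (min (e / (4 * (D + 1))) (e / (8 * κ))) with hρ'
        have hρ1 : ρ' ≤ R / 8 := (min_le_left _ _).trans (min_le_left _ _)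
        have hρ2 : ρ' ≤ t - τ := (min_le_left _ _).trans (min_le_right _ _)
        have hρ3 : ρ' * (4 * (D + 1)) ≤ e := by
          rw [← le_div_iff₀ (by positivity)]
          exact (min_le_right _ _).trans (min_le_left _ _)
        have hρ4 : ρ' * (8 * κ) ≤ e := by
          rw [← le_div_iff₀ (by positivity)]
          exact (min_le_right _ _).trans (min_le_right _ _)
        have hρ0 : 0 < ρ' := by
          have : 0 < t - τ := by linarith [hτ.2]
          positivity
        refine ⟨ρ', hρ0, fun y hy s hs => ?_⟩
        have hst : s ≤ t := by linarith [hs.2]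
        have hyx : dist y x < ρ' := hy
        have hyR : y ∈ closedBall x₀ (R / 2) := by
          have h1 : dist x x₀ ≤ R / 4 := hsub hx
          have := dist_triangle y x x₀
          exact mem_closedBall.2 (by linarith)
        have hyR' : y ∈ closedBall x₀ R := closedBall_subset_closedBall (by linarith) hyR
        obtain ⟨a, ⟨haT, haI⟩, hamax⟩ := (hTc.inter_right (isClosed_Icc (a := τ) (b := s))).exists_isGreatest
          ⟨τ, hτT, le_rfl, hs.1⟩
        have hg := hD a haT s haI.2 (by linarith [ht.2]) (by
          ext c
          simp only [mem_inter_iff, mem_Ioo, mem_empty_iff_false, iff_false, not_and]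
          intro hc1 hc2
          have := hamax ⟨hc2, by linarith [haI.1], hc1.2.le⟩
          linarith [hc1.1]) y hyR
        have h1 := (hTLip a haT).1 y hyR' x (hball4 (hsub hx))
        have h2 := (hTLip t₀ ht₀).1 y hyR' x (hball4 (hsub hx))
        have hδτ : ∀ c, t₀ ≤ c → c ≤ t → |c - τ| < δ := fun c hc1 hc2 => by
          rw [abs_lt]; constructor <;> linarith [hτ.1, hτ.2, ht.2]
        have h3 := hm.1 a t₀ (hδτ a (by linarith [haI.1, hτ.1]) (by linarith [haI.2]))
          (hδτ t₀ le_rfl ht.1)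
        simp only at h3
        rw [abs_of_nonneg (by linarith [haI.1, hτ.1] : 0 ≤ a - t₀)] at h3
        have h1' := (abs_le.1 h1).1
        have h2' := (abs_le.1 h2).2
        have h3' := (abs_le.1 h3).1
        have h4 : κ * dist y x ≤ κ * ρ' := mul_le_mul_of_nonneg_left hyx.le hκ0.le
        have h5 : D * (s - a) ≤ D * ρ' :=
          mul_le_mul_of_nonneg_left (by linarith [haI.1, hs.2]) hD0
        have h6 : κ * (a - t₀) ≤ C * (s - t₀) :=
          mul_le_mul hCκ (by linarith [haI.2]) (by linarith [haI.1, hτ.1]) hC0'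
        have h7 : 0 ≤ B * ‖y - x₁‖ ^ 2 := by positivity
        unfold barrier
        nlinarith
      · exact Or.inl (hFDn x (hball4 (hsub hx)) τ hτI hc))
  linarith

end Forward

section Weak

variable {N : ℕ}

/-- Weak form of a differential inequality `heat v ≤ H`. -/
theorem weak_upper {v : Eu N → ℝ → ℝ} (hv : SepReg v) {K : Set (Eu N)} (hK : IsCompact K)
    {a b M L P : ℝ} (hab : a ≤ b) {H : Eu N → ℝ → ℝ} (hH : ∀ t, Continuous fun x => H x t)
    (hFD : ∀ t ∈ Ioo a b, ∀ x ∈ K, FD (fun x t => - v x t) x t)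
    (hbd : ∀ x ∈ K, ∀ t ∈ Icc a b, |v x t| ≤ M)
    (hheat : ∀ x ∈ K, ∀ t ∈ Ioo a b, heat v x t ≤ H x t)
    {Ψ Ψt : Eu N → ℝ → ℝ} (hΨ : ∀ t ∈ Icc a b, ContDiff ℝ 2 fun x => Ψ x t)
    (hΨt : ∀ t ∈ Icc a b, Continuous fun x => Ψt x t)
    (hΨs : ∀ x ∉ K, ∀ t ∈ Icc a b, Ψ x t = 0)
    (hΨts : ∀ x ∉ K, ∀ t ∈ Icc a b, Ψt x t = 0)
    (hΨd : ∀ x, ∀ t ∈ Icc a b, HasDerivAt (Ψ x) (Ψt x t) t)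
    (hΨ0 : ∀ x, ∀ t ∈ Icc a b, 0 ≤ Ψ x t) (hΨP : ∀ x, ∀ t ∈ Icc a b, Ψ x t ≤ P)
    (hΨL : ∀ x, ∀ t ∈ Icc a b, |Ψt x t| ≤ L)
    {B B' : ℝ → ℝ} (hB : ContinuousOn B (Icc a b)) (hB' : ∀ t ∈ Ioo a b, HasDerivAt B (B' t) t)
    (hQB : ∀ t ∈ Ioo a b,
      ∫ x, ((Ψt x t + lap (fun y => Ψ y t) x) * v x t + Ψ x t * H x t) ≤ B' t) :
    (∫ x, Ψ x b * v x b) - ∫ x, Ψ x a * v x a ≤ B b - B a := by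
  rcases K.eq_empty_or_nonempty with rfl | hKne
  · refine integral_sub_le_of_forward (h := fun x t => Ψ x t * v x t) isCompact_empty (M := 0) hab
      (fun s hs => (hΨ s hs).continuous.mul (hv.space s).continuous)
      (fun x hx s hs => by simp [hΨs x hx s hs]) (fun x s hs => by simp [hΨs x (by simp) s hs])
      (fun x => ContinuousOn.mul (fun t ht => (hΨd x t ht).continuousAt.continuousWithinAt)
        (hv.time x).continuous.continuousOn) (by simp)
      (q := fun t x => 0) (Q := fun t x => 0) ?_ (by simp) (by simp) hB hB' ?_
    · intro t ht x
      have h1 := (hΨd x t ⟨ht.1.le, ht.2.le⟩).fun_mul (hv.hasDerivAt x t)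
      simpa [hΨs x (by simp) t ⟨ht.1.le, ht.2.le⟩, hΨts x (by simp) t ⟨ht.1.le, ht.2.le⟩] using h1
    · intro t ht
      have hI : t ∈ Icc a b := ⟨ht.1.le, ht.2.le⟩
      refine le_trans (le_of_eq ?_) (hQB t ht)
      congr 1; ext x
      have : lap (fun y => Ψ y t) x = 0 := by
        have : (fun y => Ψ y t) = fun _ => 0 := funext fun y => hΨs y (by simp) t hI
        rw [this, lap_const]
      rw [this, hΨs x (by simp) t hI, hΨts x (by simp) t hI]; ring
  obtain ⟨x₀, hx₀⟩ := hKne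
  have hM : 0 ≤ M := (abs_nonneg _).trans (hbd x₀ hx₀ a (left_mem_Icc.2 hab))
  have hL : 0 ≤ L := (abs_nonneg _).trans (hΨL x₀ a (left_mem_Icc.2 hab))
  have hP : 0 ≤ P := (hΨ0 x₀ a (left_mem_Icc.2 hab)).trans (hΨP x₀ a (left_mem_Icc.2 hab))
  have hcs : ∀ t ∈ Icc a b, HasCompactSupport fun x => Ψ x t := fun t ht =>
    HasCompactSupport.intro hK fun x hx => hΨs x hx t ht
  have hcst : ∀ t ∈ Icc a b, HasCompactSupport fun x => Ψt x t := fun t ht =>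
    HasCompactSupport.intro hK fun x hx => hΨts x hx t ht
  have hlip : ∀ y, ∀ t ∈ Icc a b, ∀ s ∈ Icc a b, t ≤ s → |Ψ y s - Ψ y t| ≤ L * (s - t) := by
    intro y t ht s hs hts
    have := (convex_Icc a b).norm_image_sub_le_of_norm_hasDerivWithin_le (f := Ψ y)
      (f' := Ψt y) (C := L) (fun r hr => (hΨd y r hr).hasDerivWithinAt)
      (fun r hr => hΨL y r hr) ht hs
    rwa [Real.norm_eq_abs, Real.norm_eq_abs, abs_of_nonneg (by linarith : 0 ≤ s - t)] at this
  refine integral_sub_le_of_forward (h := fun x t => Ψ x t * v x t) hK (M := P * M) hab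
    (fun s hs => (hΨ s hs).continuous.mul (hv.space s).continuous)
    (fun x hx s hs => by simp [hΨs x hx s hs])
    (fun x s hs => by
      by_cases hx : x ∈ K
      · rw [abs_mul, abs_of_nonneg (hΨ0 x s hs)]
        exact mul_le_mul (hΨP x s hs) (hbd x hx s hs) (abs_nonneg _) hP
      · simp only [hΨs x hx s hs, zero_mul, abs_zero]; positivity)
    (fun x => ContinuousOn.mul (fun t ht => (hΨd x t ht).continuousAt.continuousWithinAt)
        (hv.time x).continuous.continuousOn) ?_
    (q := fun t x => Ψt x t * v x t + Ψ x t * deriv (v x) t)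
    (Q := fun t x => Ψt x t * v x t + Ψ x t * H x t + Ψ x t * lap (fun y => v y t) x)
    (fun t ht x => (hΨd x t ⟨ht.1.le, ht.2.le⟩).mul (hv.hasDerivAt x t)) ?_ ?_ hB hB' ?_
  · intro t ht x hx
    obtain ⟨ρ, hρ, C, hC⟩ := hFD t ht x hx
    refine ⟨min ρ (b - t), lt_min hρ (by linarith [ht.2]), L * M + P * |C|, fun y hy s hs => ?_⟩
    have htI : t ∈ Icc a b := ⟨ht.1.le, ht.2.le⟩
    have hsI : s ∈ Icc a b := ⟨by linarith [ht.1, hs.1], by linarith [hs.2, min_le_right ρ (b - t)]⟩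
    have hst : 0 ≤ s - t := by linarith [hs.1]
    by_cases hyK : y ∈ K
    · have h1 := hC y (ball_subset_ball (min_le_left _ _) hy) s
        ⟨hs.1, by linarith [hs.2, min_le_left ρ (b - t)]⟩
      simp only at h1
      have h2 : C * (s - t) ≤ |C| * (s - t) := mul_le_mul_of_nonneg_right (le_abs_self C) hst
      have h3 : Ψ y s * v y s ≤ Ψ y s * (v y t + |C| * (s - t)) :=
        mul_le_mul_of_nonneg_left (by linarith) (hΨ0 y s hsI)
      have h4 : Ψ y s * (|C| * (s - t)) ≤ P * (|C| * (s - t)) :=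
        mul_le_mul_of_nonneg_right (hΨP y s hsI) (by positivity)
      have h5 : (Ψ y s - Ψ y t) * v y t ≤ L * (s - t) * M := by
        refine (le_abs_self _).trans ?_
        rw [abs_mul]
        exact mul_le_mul (hlip y t htI s hsI hs.1) (hbd y hyK t htI) (abs_nonneg _) (by positivity)
      nlinarith
    · simp only [hΨs y hyK s hsI, hΨs y hyK t htI, zero_mul, zero_add]
      positivity
  · intro t ht x
    have htI : t ∈ Icc a b := ⟨ht.1.le, ht.2.le⟩
    by_cases hx : x ∈ K
    · have h1 : deriv (v x) t ≤ H x t + lap (fun y => v y t) x := by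
        rw [deriv_eq_heat_add]; linarith [hheat x hx t ht]
      have := mul_le_mul_of_nonneg_left h1 (hΨ0 x t htI)
      linarith
    · simp [hΨs x hx t htI]
  · intro t ht
    have htI : t ∈ Icc a b := ⟨ht.1.le, ht.2.le⟩
    refine Integrable.add (Integrable.add ?_ ?_) ?_
    · exact ((hΨt t htI).mul (hv.space t).continuous).integrable_of_hasCompactSupport
        (hcst t htI).mul_right
    · exact ((hΨ t htI).continuous.mul (hH t)).integrable_of_hasCompactSupport
        (hcs t htI).mul_right
    · exact ((hΨ t htI).continuous.mul (continuous_lap (hv.space t))).integrable_of_hasCompactSupport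
        (hcs t htI).mul_right
  · intro t ht
    have htI : t ∈ Icc a b := ⟨ht.1.le, ht.2.le⟩
    have i1 : Integrable fun x => Ψt x t * v x t + Ψ x t * H x t := by
      refine Integrable.add ?_ ?_
      · exact ((hΨt t htI).mul (hv.space t).continuous).integrable_of_hasCompactSupport
          (hcst t htI).mul_right
      · exact ((hΨ t htI).continuous.mul (hH t)).integrable_of_hasCompactSupport
          (hcs t htI).mul_right
    refine le_trans (le_of_eq ?_) (hQB t ht)
    rw [integral_add i1, integral_mul_lap (hΨ t htI) (hcs t htI) (hv.space t), ← integral_add i1]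
    · congr 1; ext x; ring
    · exact ((continuous_lap (hΨ t htI)).mul (hv.space t).continuous).integrable_of_hasCompactSupport
        (hasCompactSupport_lap (hcs t htI)).mul_right
    · exact ((hΨ t htI).continuous.mul (continuous_lap (hv.space t))).integrable_of_hasCompactSupport
        (hcs t htI).mul_right

end Weak

section HeatKernel

variable {N : ℕ}

/-- The (unnormalised) heat kernel centred at `x₀`. -/
noncomputable def gk (x₀ : Eu N) (τ : ℝ) (y : Eu N) : ℝ :=
  τ ^ (-(N / 2 : ℝ)) * exp (-(‖y - x₀‖ ^ 2) / (4 * τ))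

theorem gk_pos (x₀ : Eu N) {τ : ℝ} (hτ : 0 < τ) (y : Eu N) : 0 < gk x₀ τ y :=
  mul_pos (rpow_pos_of_pos hτ _) (exp_pos _)

theorem contDiff_gk (x₀ : Eu N) (τ : ℝ) {n : WithTop ℕ∞} : ContDiff ℝ n (gk x₀ τ) := by
  have h := contDiff_normSq_sub x₀ (n := n)
  unfold gk
  exact contDiff_const.mul ((h.neg.div_const _).exp)

theorem pd_gk (x₀ : Eu N) (τ : ℝ) (i : Fin N) (y : Eu N) :
    pd i (gk x₀ τ) y = -(gk x₀ τ y * ((y i - x₀ i) / (2 * τ))) := by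
  have h : HasDerivAt (fun q : ℝ => τ ^ (-(N / 2 : ℝ)) * exp (-q / (4 * τ)))
      (τ ^ (-(N / 2 : ℝ)) * (exp (-(‖y - x₀‖ ^ 2) / (4 * τ)) * (-1 / (4 * τ)))) (‖y - x₀‖ ^ 2) :=
    (((hasDerivAt_id _).fun_neg.div_const _).exp).const_mul _
  have := pd_comp (diff_of_contDiff (contDiff_normSq_sub x₀ (n := 2)) (by norm_num) y) h i
  unfold gk
  rw [this, pd_normSq_sub]
  rcases eq_or_ne τ 0 with rfl | hτ
  · simp
  field_simp
  ring

theorem lap_gk (x₀ : Eu N) {τ : ℝ} (hτ : 0 < τ) (y : Eu N) :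
    lap (gk x₀ τ) y = gk x₀ τ y * (‖y - x₀‖ ^ 2 / (4 * τ ^ 2) - N / (2 * τ)) := by
  have h : ∀ q : ℝ, HasDerivAt (fun q : ℝ => τ ^ (-(N / 2 : ℝ)) * exp (-q / (4 * τ)))
      (τ ^ (-(N / 2 : ℝ)) * (exp (-q / (4 * τ)) * (-1 / (4 * τ)))) q := fun q =>
    (((hasDerivAt_id _).fun_neg.div_const _).exp).const_mul _
  have h' : ∀ q : ℝ, HasDerivAt
      (fun q : ℝ => τ ^ (-(N / 2 : ℝ)) * (exp (-q / (4 * τ)) * (-1 / (4 * τ))))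
      (τ ^ (-(N / 2 : ℝ)) * (exp (-q / (4 * τ)) * (-1 / (4 * τ)) * (-1 / (4 * τ)))) q := fun q =>
    ((((hasDerivAt_id _).fun_neg.div_const _).exp).mul_const _).const_mul _
  have key := lap_comp (f := fun y => ‖y - x₀‖ ^ 2)
    (φ := fun q : ℝ => τ ^ (-(N / 2 : ℝ)) * exp (-q / (4 * τ)))
    (φ' := fun q : ℝ => τ ^ (-(N / 2 : ℝ)) * (exp (-q / (4 * τ)) * (-1 / (4 * τ))))
    (φ'' := fun q : ℝ => τ ^ (-(N / 2 : ℝ)) * (exp (-q / (4 * τ)) * (-1 / (4 * τ)) * (-1 / (4 * τ))))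
    (contDiff_normSq_sub x₀ (n := 2)) (contDiff_gk x₀ τ (n := 2)) y
    (Eventually.of_forall fun z => h _) (h' _)
  have hs : ∑ i, (2 * (y i - x₀ i)) ^ 2 = 4 * ‖y - x₀‖ ^ 2 := by
    rw [EuclideanSpace.norm_sq_eq, Finset.mul_sum]
    refine Finset.sum_congr rfl fun i _ => ?_
    simp only [PiLp.sub_apply, Real.norm_eq_abs, sq_abs]; ring
  change lap (gk x₀ τ) y = _ at key
  simp only [pd_normSq_sub, lap_normSq_sub, hs] at key
  rw [key]
  unfold gk
  field_simp
  ring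

theorem hasDerivAt_gk (x₀ : Eu N) {τ : ℝ} (hτ : 0 < τ) (y : Eu N) :
    HasDerivAt (fun τ => gk x₀ τ y) (lap (gk x₀ τ) y) τ := by
  rw [lap_gk x₀ hτ]
  have h1 : HasDerivAt (fun τ : ℝ => τ ^ (-(N / 2 : ℝ))) (-(N / 2 : ℝ) * τ ^ (-(N / 2 : ℝ) - 1)) τ :=
    Real.hasDerivAt_rpow_const (Or.inl hτ.ne')
  have h2 : HasDerivAt (fun τ : ℝ => exp (-(‖y - x₀‖ ^ 2) / (4 * τ)))
      (exp (-(‖y - x₀‖ ^ 2) / (4 * τ)) * ((‖y - x₀‖ ^ 2) / (4 * τ ^ 2))) τ := by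
    have h3 : HasDerivAt (fun τ : ℝ => -(‖y - x₀‖ ^ 2) / (4 * τ)) ((‖y - x₀‖ ^ 2) / (4 * τ ^ 2)) τ := by
      have := (hasDerivAt_const τ (-(‖y - x₀‖ ^ 2))).fun_div ((hasDerivAt_id τ).const_mul 4)
        (by simpa using hτ.ne')
      refine this.congr_deriv ?_
      simp only [id]; field_simp; ring
    exact h3.exp
  refine (h1.fun_mul h2).congr_deriv ?_
  rw [rpow_sub_one hτ.ne']
  unfold gk
  field_simp
  ring

theorem integral_gk (x₀ : Eu N) {τ : ℝ} (hτ : 0 < τ) :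
    ∫ y, gk x₀ τ y = (4 * π) ^ (N / 2 : ℝ) := by
  unfold gk
  rw [integral_const_mul, integral_sub_right_eq_self (fun y : Eu N => exp (-‖y‖ ^ 2 / (4 * τ))) x₀]
  have h := GaussianFourier.integral_rexp_neg_mul_sq_norm (V := Eu N) (b := 1 / (4 * τ)) (by positivity)
  have h2 : (fun y : Eu N => exp (-‖y‖ ^ 2 / (4 * τ))) = fun y => exp (-(1 / (4 * τ)) * ‖y‖ ^ 2) := by
    ext y; congr 1; ring
  rw [h2, h, finrank_euclideanSpace_fin]
  have : π / (1 / (4 * τ)) = (4 * π) * τ := by field_simp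
  rw [this, mul_rpow (by positivity) hτ.le, mul_comm, mul_assoc, ← rpow_add hτ]
  simp

theorem integrable_gk (x₀ : Eu N) {τ : ℝ} (hτ : 0 < τ) : Integrable (gk x₀ τ) := by
  by_contra h
  have := integral_gk x₀ hτ
  rw [integral_undef h] at this
  have h2 : 0 < (4 * π) ^ (N / 2 : ℝ) := rpow_pos_of_pos (by positivity) _
  linarith

theorem gk_le (x₀ : Eu N) {τ : ℝ} (hτ : 0 < τ) {y : Eu N} (hy : y ≠ x₀) :
    gk x₀ τ y ≤ (N + 2).factorial * 2 ^ (N + 2) * τ / ‖y - x₀‖ ^ (N + 2) := by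
  have hn : 0 < ‖y - x₀‖ := norm_pos_iff.2 (sub_ne_zero.2 hy)
  set d := ‖y - x₀‖ with hd
  set c : ℝ := (N + 2).factorial * 2 ^ (N + 2) with hc
  have hc1 : 1 ≤ c := by
    have h1 : (1 : ℝ) ≤ (N + 2).factorial := by exact_mod_cast Nat.succ_le_of_lt (Nat.factorial_pos _)
    have h2 : (1 : ℝ) ≤ 2 ^ (N + 2) := one_le_pow₀ (by norm_num)
    nlinarith
  have hsq : gk x₀ τ y ^ 2 = τ⁻¹ ^ N * exp (-(d ^ 2 / (2 * τ))) := by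
    unfold gk
    rw [mul_pow, ← exp_nat_mul, ← rpow_natCast (τ ^ (-(N / 2 : ℝ))), ← rpow_mul hτ.le]
    congr 1
    · rw [inv_pow, ← rpow_natCast, ← rpow_neg hτ.le]; congr 1; push_cast; ring
    · congr 1; field_simp; push_cast; ring
  have hz : (0 : ℝ) ≤ d ^ 2 / (2 * τ) := by positivity
  have hexp := pow_div_factorial_le_exp (d ^ 2 / (2 * τ)) hz (N + 2)
  have hle : gk x₀ τ y ^ 2 ≤ c * (τ / d ^ (N + 2)) ^ 2 := by
    rw [hsq, exp_neg, ← div_eq_mul_inv, div_le_iff₀ (exp_pos _)]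
    have : c * (τ / d ^ (N + 2)) ^ 2 * ((d ^ 2 / (2 * τ)) ^ (N + 2) / (N + 2).factorial) = τ⁻¹ ^ N := by
      rw [hc, div_pow, div_pow, mul_pow, inv_pow]
      field_simp
      ring
    rw [← this]
    gcongr
  have h2 : c * (τ / d ^ (N + 2)) ^ 2 ≤ (c * τ / d ^ (N + 2)) ^ 2 := by
    have h0 : 0 ≤ (τ / d ^ (N + 2)) ^ 2 := by positivity
    have : (c * τ / d ^ (N + 2)) ^ 2 = c * (c * (τ / d ^ (N + 2)) ^ 2) := by ring
    rw [this]
    nlinarith [mul_nonneg (by linarith : (0:ℝ) ≤ c) h0]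
  exact (le_abs_self _).trans (abs_le_of_sq_le_sq (hle.trans h2) (by positivity))

theorem gk_le_rpow (x₀ : Eu N) {ε τ : ℝ} (hε : 0 < ε) (h : ε ≤ τ) (y : Eu N) :
    gk x₀ τ y ≤ ε ^ (-(N / 2 : ℝ)) := by
  have hτ : 0 < τ := hε.trans_le h
  unfold gk
  have h1 : τ ^ (-(N / 2 : ℝ)) ≤ ε ^ (-(N / 2 : ℝ)) :=
    rpow_le_rpow_of_nonpos hε h (by rw [neg_nonpos]; positivity)
  have h2 : exp (-(‖y - x₀‖ ^ 2) / (4 * τ)) ≤ 1 := by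
    rw [exp_le_one_iff]
    exact div_nonpos_of_nonpos_of_nonneg (neg_nonpos.2 (sq_nonneg _)) (by positivity)
  calc _ ≤ ε ^ (-(N / 2 : ℝ)) * 1 := mul_le_mul h1 h2 (exp_pos _).le (rpow_nonneg hε.le _)
    _ = _ := mul_one _

end HeatKernel

section UpperCore

variable {N : ℕ}

theorem FD.neg_of_sub {v : Eu N → ℝ → ℝ} {U x t} (h : FD (fun x t => U - v x t) x t) :
    FD (fun x t => - v x t) x t := by
  obtain ⟨ρ, hρ, C, hC⟩ := h
  exact ⟨ρ, hρ, C, fun y hy s hs => by have := hC y hy s hs; linarith⟩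

theorem SepReg.const_sub {v : Eu N → ℝ → ℝ} (hv : SepReg v) (U : ℝ) :
    SepReg fun x t => U - v x t :=
  ⟨fun t => contDiff_const.sub (hv.space t), fun x => contDiff_const.sub (hv.time x)⟩

theorem heat_const_sub {v : Eu N → ℝ → ℝ} (hv : SepReg v) (U : ℝ) (x t) :
    heat (fun x t => U - v x t) x t = - heat v x t := by
  unfold heat
  rw [lap_sub contDiff_const (hv.space t), lap_const]
  have : deriv (fun t => U - v x t) t = - deriv (v x) t := by simp
  rw [this]; ring

/-- Forward upper control of a bounded function with heat operator bounded above. -/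
theorem FD_neg {v : Eu N → ℝ → ℝ} (hv : SepReg v) {W : Set (Eu N × ℝ)}
    (hW : IsOpen W) {U C₀ : ℝ} (hC₀ : 0 ≤ C₀) (h0 : ∀ P ∈ W, v P.1 P.2 ≤ U)
    (hh : ∀ P ∈ W, heat v P.1 P.2 ≤ C₀) : ∀ P ∈ W, FD (fun x t => - v x t) P.1 P.2 := by
  intro P hP
  refine FD.neg_of_sub (U := U) (forward_domination (hv.const_sub U) hW hC₀
    (fun P hP => sub_nonneg.2 (h0 P hP)) (fun P hP => ?_) P hP)
  rw [heat_const_sub hv]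
  linarith [hh P hP]

theorem lap_eq_zero_of_locally_const {f : Eu N → ℝ} {s : Set (Eu N)} (hs : IsOpen s) {c : ℝ}
    (h : ∀ y ∈ s, f y = c) {x : Eu N} (hx : x ∈ s) : lap f x = 0 := by
  have : f =ᶠ[𝓝 x] fun _ => c := by
    filter_upwards [hs.mem_nhds hx] with y hy using h y hy
  rw [lap_congr this, lap_const]

theorem pd_eq_zero_of_locally_const {f : Eu N → ℝ} {s : Set (Eu N)} (hs : IsOpen s) {c : ℝ}
    (h : ∀ y ∈ s, f y = c) {x : Eu N} (hx : x ∈ s) (i : Fin N) : pd i f x = 0 := by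
  have : f =ᶠ[𝓝 x] fun _ => c := by
    filter_upwards [hs.mem_nhds hx] with y hy using h y hy
  rw [pd_congr this, pd_const]

theorem exists_bound_of_compactSupport {f : Eu N → ℝ} (hf : Continuous f) (hc : HasCompactSupport f) :
    ∃ C > 0, ∀ x, |f x| ≤ C := by
  obtain ⟨C, hC⟩ := hf.bounded_above_of_compact_support hc
  exact ⟨max C 1, by positivity, fun x => (hC x).trans (le_max_left _ _)⟩

/-- The commutator of a cutoff with the heat kernel is bounded. -/
theorem exists_commutator_bound {χ : Eu N → ℝ} (hχ : ContDiff ℝ 3 χ)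
    (hin : ∀ x ∈ closedBall (0 : Eu N) (1 / 4), χ x = 1) (hout : ∀ x ∉ ball (0 : Eu N) (1 / 2), χ x = 0)
    (hc : HasCompactSupport χ) :
    ∃ E > 0, ∀ τ, 0 < τ → τ ≤ 2 → ∀ y : Eu N,
      |lap χ y * gk 0 τ y + 2 * ∑ i, pd i χ y * pd i (gk 0 τ) y| ≤ E := by
  have hχ2 : ContDiff ℝ 2 χ := hχ.of_le (by norm_num)
  have hχ1 : ContDiff ℝ 1 χ := hχ.of_le (by norm_num)
  obtain ⟨L, hL0, hL⟩ := exists_bound_of_compactSupport (continuous_lap hχ2) (hasCompactSupport_lap hc)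
  have hD : ∃ D > 0, ∀ i x, |pd i χ x| ≤ D := by
    choose D hD0 hD using fun i => exists_bound_of_compactSupport (continuous_pd hχ1 i)
      (hasCompactSupport_pd hc i)
    refine ⟨1 + ∑ i, D i, by have := Finset.sum_nonneg fun i (_ : i ∈ Finset.univ) => (hD0 i).le
                             linarith, fun i x => (hD i x).trans ?_⟩
    have := Finset.single_le_sum (fun i _ => (hD0 i).le) (Finset.mem_univ i)
    linarith
  obtain ⟨D, hD0, hD⟩ := hD
  set c : ℝ := (N + 2).factorial * 2 ^ (N + 2) * 4 ^ (N + 2) with hcdef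
  have hc0 : 0 < c := by positivity
  refine ⟨L * (c * 2) + 2 * (N * (D * c)) + 1, by positivity, fun τ hτ hτ2 y => ?_⟩
  by_cases hy : 1 / 4 ≤ ‖y‖ ∧ ‖y‖ ≤ 1 / 2
  · have hy0 : y ≠ 0 := by rw [← norm_pos_iff]; linarith [hy.1]
    have hG : gk 0 τ y ≤ c * τ := by
      refine (gk_le 0 hτ hy0).trans ?_
      rw [sub_zero, div_le_iff₀ (by positivity), hcdef]
      have : (1 : ℝ) ≤ 4 ^ (N + 2) * ‖y‖ ^ (N + 2) := by
        rw [← mul_pow]; exact one_le_pow₀ (by linarith [hy.1])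
      have h0 : (0 : ℝ) ≤ (N + 2).factorial * 2 ^ (N + 2) * τ := by positivity
      nlinarith
    have hG0 := gk_pos 0 hτ y
    have hpd : ∀ i, |pd i (gk 0 τ) y| ≤ c := fun i => by
      rw [pd_gk, abs_neg, abs_mul, abs_of_pos hG0, abs_div, abs_of_pos (by positivity : 0 < 2 * τ)]
      have h1 : |y i - (0 : Eu N) i| ≤ 1 := by
        have := PiLp.norm_apply_le y i
        simp only [PiLp.zero_apply, sub_zero]
        rw [Real.norm_eq_abs] at this; linarith [hy.2]
      rw [mul_div_assoc', div_le_iff₀ (by positivity)]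
      calc gk 0 τ y * |y i - (0 : Eu N) i| ≤ c * τ * 1 := mul_le_mul hG h1 (abs_nonneg _) (by positivity)
        _ ≤ c * (2 * τ) := by nlinarith
    have h1 : |lap χ y * gk 0 τ y| ≤ L * (c * 2) := by
      rw [abs_mul, abs_of_pos hG0]
      exact mul_le_mul (hL y) (hG.trans (by nlinarith)) hG0.le hL0.le
    have h2 : |∑ i, pd i χ y * pd i (gk 0 τ) y| ≤ N * (D * c) := by
      refine (Finset.abs_sum_le_sum_abs _ _).trans ?_
      calc _ ≤ ∑ i : Fin N, D * c := Finset.sum_le_sum fun i _ => by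
            rw [abs_mul]; exact mul_le_mul (hD i y) (hpd i) (abs_nonneg _) hD0.le
        _ = _ := by simp
    refine (abs_add_le _ _).trans ?_
    rw [abs_mul (2 : ℝ), abs_two]
    linarith
  · have h0 : lap χ y = 0 ∧ ∀ i, pd i χ y = 0 := by
      rw [not_and_or, not_le, not_le] at hy
      rcases hy with hy | hy
      · have hm : y ∈ ball (0 : Eu N) (1 / 4) := by simpa using hy
        have hcst := fun z hz => hin z (ball_subset_closedBall hz)
        exact ⟨lap_eq_zero_of_locally_const isOpen_ball hcst hm,
          fun i => pd_eq_zero_of_locally_const isOpen_ball hcst hm i⟩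
      · have hm : y ∈ (closedBall (0 : Eu N) (1 / 2))ᶜ := by simpa using hy
        have hcst : ∀ z ∈ (closedBall (0 : Eu N) (1 / 2))ᶜ, χ z = 0 := fun z hz =>
          hout z fun h => hz (ball_subset_closedBall h)
        exact ⟨lap_eq_zero_of_locally_const isClosed_closedBall.isOpen_compl hcst hm,
          fun i => pd_eq_zero_of_locally_const isClosed_closedBall.isOpen_compl hcst hm i⟩
    simp only [h0.1, h0.2, zero_mul, Finset.sum_const_zero, mul_zero, add_zero, abs_zero]
    positivity

theorem gk_mass_lower (N : ℕ) : ∃ c > 0, ∀ (x₀ : Eu N) (ρ : ℝ), 0 < ρ →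
    c ≤ ∫ y in closedBall x₀ ρ, gk x₀ (ρ ^ 2) y := by
  refine ⟨exp (-(1 / 4)) * volume.real (closedBall (0 : Eu N) 1), ?_, fun x₀ ρ hρ => ?_⟩
  · refine mul_pos (exp_pos _) (ENNReal.toReal_pos (measure_closedBall_pos _ _ one_pos).ne'
      measure_closedBall_lt_top.ne)
  · have h1 : ∀ y ∈ closedBall x₀ ρ, (ρ ^ N)⁻¹ * exp (-(1 / 4)) ≤ gk x₀ (ρ ^ 2) y := by
      intro y hy
      unfold gk
      have h2 : (ρ ^ 2) ^ (-(N / 2 : ℝ)) = (ρ ^ N)⁻¹ := by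
        rw [← rpow_natCast ρ 2, ← rpow_mul hρ.le, ← rpow_natCast ρ N, ← rpow_neg hρ.le]
        congr 1; push_cast; ring
      rw [h2]
      refine mul_le_mul_of_nonneg_left (exp_le_exp.2 ?_) (by positivity)
      have h3 : ‖y - x₀‖ ≤ ρ := by simpa [dist_eq_norm] using hy
      rw [neg_div, neg_le_neg_iff, div_le_div_iff₀ (by positivity) (by norm_num)]
      nlinarith [norm_nonneg (y - x₀)]
    have h4 := setIntegral_mono_on (μ := volume)
      (integrableOn_const (μ := volume) (s := closedBall x₀ ρ) (C := (ρ ^ N)⁻¹ * exp (-(1 / 4)))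
        measure_closedBall_lt_top.ne) (integrable_gk x₀ (by positivity : 0 < ρ ^ 2)).integrableOn
      measurableSet_closedBall h1
    refine le_trans (le_of_eq ?_) h4
    rw [setIntegral_const, Measure.addHaar_real_closedBall _ _ hρ.le, finrank_euclideanSpace_fin,
      measureReal_def, measureReal_def, smul_eq_mul]
    have : volume (ball (0 : Eu N) 1) = volume (closedBall (0 : Eu N) 1) :=
      (Measure.addHaar_unitClosedBall_eq_addHaar_unitBall _).symm
    rw [this]
    field_simp

/-- Parabolic mean value inequality with a small multiple of the supremum. -/
theorem upper_core (N : ℕ) : ∃ C₀ > 0, ∀ θ, 0 < θ → θ ≤ 1 / 2 → ∃ C₁ > 0,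
    ∀ (v : Eu N → ℝ → ℝ) (U Λ : ℝ), SepReg v → 0 ≤ Λ →
    (∀ x ∈ ball (0 : Eu N) 1, ∀ t ∈ Ioo (-1 : ℝ) 1, 0 ≤ v x t ∧ v x t ≤ U ∧ heat v x t ≤ Λ * U) →
    v 0 0 ≤ C₀ * θ * (1 + Λ) * U + C₁ * ∫ x in closedBall (0 : Eu N) (1 / 2), v x (-θ) := by
  obtain ⟨χ, hχ, hχ0, hχ1, hin, hout, hc, -⟩ := exists_cutoff (0 : Eu N) (ρ := 1 / 2) (by norm_num)
  norm_num at hin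
  have hin' : ∀ x ∈ closedBall (0 : Eu N) (1 / 4), χ x = 1 := fun x hx => hin x (by simpa using hx)
  obtain ⟨E, hE0, hE⟩ := exists_commutator_bound hχ hin' hout hc
  obtain ⟨c, hc0, hcm⟩ := gk_mass_lower N
  have hχ2 : ContDiff ℝ 2 χ := hχ.of_le (by norm_num)
  set K : Set (Eu N) := closedBall 0 (1 / 2) with hKdef
  have hK : IsCompact K := isCompact_closedBall _ _
  have hKK : ∀ x ∉ K, χ x = 0 := fun x hx => hout x fun h => hx (ball_subset_closedBall h)
  have hKb : K ⊆ ball 0 1 := closedBall_subset_ball (by norm_num)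
  set V : ℝ := volume.real K with hV
  have hV0 : 0 ≤ V := measureReal_nonneg
  set m : ℝ := (4 * π) ^ (N / 2 : ℝ) with hm
  have hm0 : 0 < m := rpow_pos_of_pos (by positivity) _
  refine ⟨2 / c * (E * V + m), by positivity, fun θ hθ hθ2 => ?_⟩
  refine ⟨2 / c * θ ^ (-(N / 2 : ℝ)), by have := rpow_pos_of_pos hθ (-(N / 2 : ℝ)); positivity,
    fun v U Λ hv hΛ hvU => ?_⟩
  have hU : 0 ≤ U := by
    have := hvU 0 (by simp) 0 (by simp)
    linarith
  have hvθ : ∀ x ∈ K, 0 ≤ v x (-θ) := fun x hx =>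
    (hvU x (hKb hx) (-θ) ⟨by linarith, by linarith⟩).1
  have hIθ : 0 ≤ ∫ x in K, v x (-θ) := setIntegral_nonneg measurableSet_closedBall hvθ
  have hr0 := rpow_pos_of_pos hθ (-(N / 2 : ℝ))
  rcases (hvU 0 (by simp) 0 (by simp)).1.eq_or_lt with h00 | h00
  · rw [← h00]; positivity
  -- a radius on which `v` stays comparable to its centre value
  obtain ⟨ρ, hρ, hρ4, hρv⟩ : ∃ ρ > 0, ρ ≤ 1 / 4 ∧ ∀ x ∈ closedBall (0 : Eu N) ρ, v 0 0 / 2 ≤ v x 0 := by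
    have : ∀ᶠ x in 𝓝 (0 : Eu N), v 0 0 / 2 < v x 0 :=
      (hv.space 0).continuous.continuousAt.eventually_const_lt (by linarith)
    obtain ⟨ρ, hρ, h⟩ := Metric.eventually_nhds_iff_ball.1 this
    refine ⟨min (ρ / 2) (1 / 4), by positivity, min_le_right _ _, fun x hx => (h x ?_).le⟩
    refine mem_ball.2 ((mem_closedBall.1 hx).trans_lt ?_)
    have := min_le_left (ρ / 2) (1 / 4)
    linarith
  set ε := ρ ^ 2 with hε
  have hε0 : 0 < ε := by positivity
  have hε1 : ε ≤ 1 := by nlinarith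
  have hτ : ∀ t ∈ Icc (-θ) 0, ε ≤ ε - t ∧ ε - t ≤ 2 := fun t ht =>
    ⟨by linarith [ht.2], by linarith [ht.1]⟩
  have hτ0 : ∀ t ∈ Icc (-θ) 0, 0 < ε - t := fun t ht => hε0.trans_le (hτ t ht).1
  have htI : ∀ t ∈ Icc (-θ) 0, t ∈ Ioo (-1 : ℝ) 1 := fun t ht =>
    ⟨by linarith [ht.1], by linarith [ht.2]⟩
  have hεr : 0 < ε ^ (-(N / 2 : ℝ)) := rpow_pos_of_pos hε0 _
  have hlapχ : ∀ x ∉ K, ∀ f : Eu N → ℝ, ContDiff ℝ 2 f → lap (fun y => χ y * f y) x = 0 :=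
    fun x hx f hf => lap_eq_zero_of_locally_const hK.isClosed.isOpen_compl (c := 0)
      (fun y hy => by rw [hKK y hy, zero_mul]) hx
  have key := weak_upper hv hK (a := -θ) (b := 0) (M := U) (L := ε ^ (-(N / 2 : ℝ)) *
      (1 / ε ^ 2 + N / ε)) (P := ε ^ (-(N / 2 : ℝ)))
    (by linarith) (H := fun _ _ => Λ * U) (fun _ => continuous_const)
    (fun t ht x hx => FD_neg hv (W := ball 0 1 ×ˢ Ioo (-1) 1) (isOpen_ball.prod isOpen_Ioo)
      (U := U) (C₀ := Λ * U) (by positivity) (fun P hP => (hvU P.1 hP.1 P.2 hP.2).2.1)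
      (fun P hP => (hvU P.1 hP.1 P.2 hP.2).2.2) (x, t) ⟨hKb hx, htI t ⟨ht.1.le, ht.2.le⟩⟩)
    (fun x hx t ht => by
      have := hvU x (hKb hx) t (htI t ht)
      rw [abs_of_nonneg this.1]; exact this.2.1)
    (fun x hx t ht => (hvU x (hKb hx) t (htI t ⟨ht.1.le, ht.2.le⟩)).2.2)
    (Ψ := fun x t => χ x * gk 0 (ε - t) x) (Ψt := fun x t => χ x * -lap (gk 0 (ε - t)) x)
    (fun t _ => hχ2.mul (contDiff_gk 0 _))
    (fun t _ => hχ2.continuous.mul (continuous_lap (contDiff_gk 0 _)).neg)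
    (fun x hx t _ => by rw [hKK x hx, zero_mul]) (fun x hx t _ => by rw [hKK x hx, zero_mul])
    (fun x t ht => by
      have := (hasDerivAt_gk 0 (hτ0 t ht) x).comp t ((hasDerivAt_id t).const_sub ε)
      simpa using this.const_mul (χ x))
    (fun x t ht => mul_nonneg (hχ0 x) (gk_pos 0 (hτ0 t ht) x).le)
    (fun x t ht => by
      have h1 := gk_le_rpow 0 hε0 (hτ t ht).1 x
      have h2 := gk_pos 0 (hτ0 t ht) x
      nlinarith [hχ0 x, hχ1 x])
    (fun x t ht => by
      have h1 := gk_le_rpow 0 hε0 (hτ t ht).1 x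
      have h2 := gk_pos 0 (hτ0 t ht) x
      by_cases hx : x ∈ K
      · rw [lap_gk 0 (hτ0 t ht), abs_mul, abs_neg, abs_mul, abs_of_nonneg (hχ0 x), abs_of_pos h2]
        have hxn : ‖x‖ ≤ 1 := by
          have : ‖x‖ ≤ 1 / 2 := by simpa [hKdef] using hx
          linarith
        have h3 : |‖x - 0‖ ^ 2 / (4 * (ε - t) ^ 2) - N / (2 * (ε - t))| ≤ 1 / ε ^ 2 + N / ε := by
          refine (abs_sub _ _).trans ?_
          rw [abs_of_nonneg (by positivity), abs_of_nonneg (by have := hτ0 t ht; positivity)]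
          refine add_le_add ?_ ?_
          · rw [sub_zero]
            refine div_le_div₀ (by norm_num) (by nlinarith [norm_nonneg x]) (by positivity) ?_
            nlinarith [(hτ t ht).1]
          · refine div_le_div_of_nonneg_left (by positivity) hε0 ?_
            linarith [(hτ t ht).1]
        calc _ ≤ 1 * (ε ^ (-(N / 2 : ℝ)) * (1 / ε ^ 2 + N / ε)) :=
              mul_le_mul (hχ1 x) (mul_le_mul h1 h3 (abs_nonneg _) hεr.le) (by positivity) (by norm_num)
          _ = _ := one_mul _
      · rw [hKK x hx, zero_mul, abs_zero]; positivity)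
    (B := fun t => (E * V * U + m * (Λ * U)) * t) (B' := fun _ => E * V * U + m * (Λ * U))
    (by fun_prop) (fun t _ => by simpa using (hasDerivAt_id t).const_mul (E * V * U + m * (Λ * U)))
    (fun t ht => by
      have htc : t ∈ Icc (-θ) 0 := ⟨ht.1.le, ht.2.le⟩
      have hg : ContDiff ℝ 2 (gk (0 : Eu N) (ε - t)) := contDiff_gk 0 _
      have hb : Integrable (fun x => K.indicator (fun _ => E * U) x + gk 0 (ε - t) x * (Λ * U)) :=
        ((integrable_indicator_iff measurableSet_closedBall).2
          (integrableOn_const measure_closedBall_lt_top.ne)).add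
          ((integrable_gk 0 (hτ0 t htc)).mul_const _)
      have hval : ∫ x, (K.indicator (fun _ => E * U) x + gk 0 (ε - t) x * (Λ * U))
          = E * V * U + m * (Λ * U) := by
        rw [integral_add ((integrable_indicator_iff measurableSet_closedBall).2
          (integrableOn_const measure_closedBall_lt_top.ne))
          ((integrable_gk 0 (hτ0 t htc)).mul_const _), integral_indicator measurableSet_closedBall,
          setIntegral_const, integral_mul_const, integral_gk 0 (hτ0 t htc), smul_eq_mul]
        ring
      rw [← hval]
      refine integral_mono (Continuous.integrable_of_hasCompactSupport ?_ ?_) hb ?_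
      · exact (((hχ2.continuous.mul (continuous_lap hg).neg).add (continuous_lap (hχ2.mul hg))).mul
          (hv.space t).continuous).add ((hχ2.continuous.mul hg.continuous).mul continuous_const)
      · refine HasCompactSupport.intro hK fun x hx => ?_
        simp only [hlapχ x hx _ hg, hKK x hx]; ring
      intro x
      have hgp := gk_pos 0 (hτ0 t htc) x
      by_cases hx : x ∈ K
      · have hvx := hvU x (hKb hx) t (htI t htc)
        simp only [indicator_of_mem hx]
        have h1 := hE (ε - t) (hτ0 t htc) (hτ t htc).2 x
        rw [lap_mul hχ2 hg]
        have h2 : (lap χ x * gk 0 (ε - t) x + 2 * ∑ i, pd i χ x * pd i (gk 0 (ε - t)) x) * v x t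
            ≤ E * U := by
          refine (le_abs_self _).trans ?_
          rw [abs_mul, abs_of_nonneg hvx.1]
          exact mul_le_mul h1 hvx.2.1 hvx.1 hE0.le
        have h3 : χ x * gk 0 (ε - t) x * (Λ * U) ≤ gk 0 (ε - t) x * (Λ * U) := by
          refine mul_le_mul_of_nonneg_right ?_ (by positivity)
          nlinarith [hχ1 x]
        linarith
      · simp only [indicator_of_notMem hx, hlapχ x hx _ hg, hKK x hx]
        simp only [zero_mul, add_zero, zero_add]
        positivity)
  have hΨθ : ∫ x, χ x * gk 0 (ε - -θ) x * v x (-θ) ≤ θ ^ (-(N / 2 : ℝ)) * ∫ x in K, v x (-θ) := by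
    rw [← integral_const_mul, ← integral_indicator (s := K) measurableSet_closedBall]
    refine integral_mono (Continuous.integrable_of_hasCompactSupport ?_ ?_) ?_ fun x => ?_
    · exact (hχ2.continuous.mul (contDiff_gk 0 _ (n := 2)).continuous).mul (hv.space _).continuous
    · exact HasCompactSupport.intro hK fun x hx => by simp only [hKK x hx]; ring
    · refine (integrable_indicator_iff measurableSet_closedBall).2 ?_
      exact (continuous_const.mul (hv.space _).continuous).continuousOn.integrableOn_compact hK
    · by_cases hx : x ∈ K
      · simp only [indicator_of_mem hx]
        refine mul_le_mul_of_nonneg_right ?_ (hvθ x hx)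
        have h1 := gk_le_rpow 0 hθ (by linarith : θ ≤ ε - -θ) x
        have h2 := gk_pos 0 (by linarith : 0 < ε - -θ) x
        nlinarith [hχ0 x, hχ1 x]
      · simp only [indicator_of_notMem hx, hKK x hx, zero_mul, le_refl]
  have hΨ0 : v 0 0 / 2 * c ≤ ∫ x, χ x * gk 0 (ε - 0) x * v x 0 := by
    have hρK : closedBall (0 : Eu N) ρ ⊆ K := closedBall_subset_closedBall (by linarith)
    have h1 : v 0 0 / 2 * c ≤ ∫ x in closedBall (0 : Eu N) ρ, v 0 0 / 2 * gk 0 ε x := by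
      rw [integral_const_mul]
      exact mul_le_mul_of_nonneg_left (hcm 0 ρ hρ) (by linarith)
    refine h1.trans ?_
    rw [← integral_indicator measurableSet_closedBall, sub_zero]
    refine integral_mono ?_ (Continuous.integrable_of_hasCompactSupport ?_ ?_) fun x => ?_
    · exact (integrable_indicator_iff measurableSet_closedBall).2
        ((integrable_gk 0 hε0).const_mul _).integrableOn
    · exact (hχ2.continuous.mul (contDiff_gk 0 _ (n := 2)).continuous).mul (hv.space _).continuous
    · exact HasCompactSupport.intro hK fun x hx => by simp only [hKK x hx]; ring
    · have hg := gk_pos 0 hε0 x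
      by_cases hx : x ∈ closedBall (0 : Eu N) ρ
      · simp only [indicator_of_mem hx]
        rw [hin' x (closedBall_subset_closedBall hρ4 hx), one_mul, mul_comm]
        exact mul_le_mul_of_nonneg_left (hρv x hx) hg.le
      · simp only [indicator_of_notMem hx]
        by_cases hxK : x ∈ K
        · exact mul_nonneg (mul_nonneg (hχ0 x) hg.le) (hvU x (hKb hxK) 0 (by simp)).1
        · rw [hKK x hxK]; simp
  have hfin : v 0 0 / 2 * c ≤ (E * V * U + m * (Λ * U)) * θ
      + θ ^ (-(N / 2 : ℝ)) * ∫ x in K, v x (-θ) := by linarith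
  have hEm : (E * V * U + m * (Λ * U)) * θ ≤ (E * V + m) * θ * (1 + Λ) * U := by
    have h1 : 0 ≤ E * V * Λ * (θ * U) := by positivity
    have h2 : 0 ≤ m * (θ * U) := by positivity
    nlinarith
  calc v 0 0 = 2 / c * (v 0 0 / 2 * c) := by field_simp
    _ ≤ 2 / c * ((E * V + m) * θ * (1 + Λ) * U + θ ^ (-(N / 2 : ℝ)) * ∫ x in K, v x (-θ)) :=
        mul_le_mul_of_nonneg_left (by linarith) (by positivity)
    _ = _ := by ring

end UpperCore

section LowCore

/-- A convex truncation of the identity. -/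
noncomputable def trunc (δ g : ℝ) : ℝ := max (g - δ) 0 ^ 3 / g ^ 2

noncomputable def trunc' (δ g : ℝ) : ℝ :=
  3 * max (g - δ) 0 ^ 2 / g ^ 2 - 2 * max (g - δ) 0 ^ 3 / g ^ 3

noncomputable def trunc'' (δ g : ℝ) : ℝ := 6 * max (g - δ) 0 * (g - max (g - δ) 0) ^ 2 / g ^ 4

theorem hasDerivAt_trunc (δ : ℝ) {g : ℝ} (hg : 0 < g) : HasDerivAt (trunc δ) (trunc' δ g) g := by
  have h3 : HasDerivAt (fun g : ℝ => max (g - δ) 0 ^ 3) (3 * max (g - δ) 0 ^ 2) g := by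
    have := (hasDerivAt_max_pow 1 (g - δ)).comp g ((hasDerivAt_id g).sub_const δ)
    norm_num at this
    exact this
  refine (h3.fun_div (hasDerivAt_pow 2 g) (by positivity)).congr_deriv ?_
  unfold trunc'
  field_simp
  norm_num
  ring

theorem hasDerivAt_trunc' (δ : ℝ) {g : ℝ} (hg : 0 < g) : HasDerivAt (trunc' δ) (trunc'' δ g) g := by
  have h3 : HasDerivAt (fun g : ℝ => max (g - δ) 0 ^ 3) (3 * max (g - δ) 0 ^ 2) g := by
    have := (hasDerivAt_max_pow 1 (g - δ)).comp g ((hasDerivAt_id g).sub_const δ)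
    norm_num at this
    exact this
  have h2 : HasDerivAt (fun g : ℝ => max (g - δ) 0 ^ 2) (2 * max (g - δ) 0) g := by
    have := (hasDerivAt_max_pow 0 (g - δ)).comp g ((hasDerivAt_id g).sub_const δ)
    norm_num at this
    exact this
  refine (((h2.const_mul 3).fun_div (hasDerivAt_pow 2 g) (by positivity)).fun_sub
    ((h3.const_mul 2).fun_div (hasDerivAt_pow 3 g) (by positivity))).congr_deriv ?_
  unfold trunc''
  field_simp
  norm_num
  ring

theorem trunc_bounds {δ g : ℝ} (hδ : 0 ≤ δ) (hg : 0 < g) :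
    0 ≤ trunc δ g ∧ trunc δ g ≤ g ∧ 0 ≤ trunc' δ g ∧ trunc' δ g ≤ 3 ∧ 0 ≤ trunc'' δ g := by
  have ha0 : 0 ≤ max (g - δ) 0 := le_max_right _ _
  have hag : max (g - δ) 0 ≤ g := max_le (by linarith) hg.le
  unfold trunc trunc' trunc''
  set a := max (g - δ) 0
  have e : 3 * a ^ 2 / g ^ 2 - 2 * a ^ 3 / g ^ 3 = a ^ 2 * (3 * g - 2 * a) / g ^ 3 := by field_simp
  refine ⟨by positivity, ?_, ?_, ?_, by positivity⟩
  · rw [div_le_iff₀ (by positivity)]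
    have := pow_le_pow_left₀ ha0 hag 3
    linarith
  · rw [e]
    exact div_nonneg (mul_nonneg (sq_nonneg _) (by linarith)) (by positivity)
  · rw [e, div_le_iff₀ (by positivity)]
    have h2 := pow_le_pow_left₀ ha0 hag 2
    have : a ^ 2 * (3 * g - 2 * a) ≤ g ^ 2 * (3 * g) :=
      mul_le_mul h2 (by linarith) (by linarith) (by positivity)
    linarith

theorem trunc_lower {δ g : ℝ} (hδ : 0 < δ) (hg : 2 * δ ≤ g) : g / 8 ≤ trunc δ g := by
  have h1 : g / 2 ≤ max (g - δ) 0 := le_max_of_le_left (by linarith)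
  have h2 : 0 < g := by linarith
  unfold trunc
  rw [le_div_iff₀ (by positivity)]
  have := pow_le_pow_left₀ (by positivity) h1 3
  linarith

theorem trunc_eq_zero {δ g : ℝ} (hg : g ≤ δ) : trunc δ g = 0 ∧ trunc' δ g = 0 := by
  simp [trunc, trunc', max_eq_right (sub_nonpos.2 hg)]

theorem contDiff_max_cube : ContDiff ℝ 2 (fun y : ℝ => max y 0 ^ 3) := by
  have h : ∀ y : ℝ, HasDerivAt (fun y : ℝ => max y 0 ^ 3) (3 * max y 0 ^ 2) y := fun y => by
    have := hasDerivAt_max_pow 1 y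
    norm_num at this
    exact this
  rw [show (2 : WithTop ℕ∞) = 1 + 1 by norm_num, contDiff_succ_iff_deriv]
  refine ⟨fun y => (h y).differentiableAt, by simp, ?_⟩
  rw [show deriv (fun y : ℝ => max y 0 ^ 3) = fun y => 3 * max y 0 ^ 2 from funext fun y => (h y).deriv]
  exact contDiff_const.mul contDiff_max_sq

variable {N : ℕ}

theorem contDiff_trunc_comp (δ : ℝ) {f : Eu N → ℝ} (hf : ContDiff ℝ 2 f) (h0 : ∀ x, 0 < f x) :
    ContDiff ℝ 2 fun x => trunc δ (f x) := by
  unfold trunc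
  exact (contDiff_max_cube.comp (hf.sub contDiff_const)).div (hf.pow 2)
    fun x => (pow_pos (h0 x) 2).ne'

/-- The bounded supersolution `s / (1 + κ s)`. -/
theorem sepReg_bounded {s : Eu N → ℝ → ℝ} (hs : SepReg s) (h0 : ∀ x t, 0 ≤ s x t) {κ : ℝ}
    (hκ : 0 < κ) : SepReg fun x t => s x t / (1 + κ * s x t) := by
  have hne : ∀ x t, 1 + κ * s x t ≠ 0 := fun x t => by have := h0 x t; positivity
  exact ⟨fun t => (hs.space t).div (contDiff_const.add (contDiff_const.mul (hs.space t)))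
    fun x => hne x t, fun x => (hs.time x).div (contDiff_const.add (contDiff_const.mul (hs.time x)))
    fun t => hne x t⟩

theorem heat_bounded_nonneg {s : Eu N → ℝ → ℝ} (hs : SepReg s) (h0 : ∀ x t, 0 ≤ s x t)
    (hh : ∀ x t, 0 ≤ heat s x t) {κ : ℝ} (hκ : 0 < κ) (x : Eu N) (t : ℝ) :
    0 ≤ heat (fun x t => s x t / (1 + κ * s x t)) x t := by
  have hd : ∀ y : ℝ, 0 ≤ y → HasDerivAt (fun y => y / (1 + κ * y)) (1 / (1 + κ * y) ^ 2) y := by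
    intro y hy
    refine ((hasDerivAt_id y).fun_div (((hasDerivAt_id y).const_mul κ).const_add 1)
      (by simp only [id]; positivity)).congr_deriv ?_
    simp only [id]; ring
  have hd2 : ∀ y : ℝ, 0 ≤ y → HasDerivAt (fun y => 1 / (1 + κ * y) ^ 2)
      (-(2 * κ) / (1 + κ * y) ^ 3) y := by
    intro y hy
    refine ((hasDerivAt_const y (1:ℝ)).fun_div ((((hasDerivAt_id y).const_mul κ).const_add 1).fun_pow 2)
      (by simp only [id]; positivity)).congr_deriv ?_
    simp only [id]; field_simp; norm_num; ring
  have hl := lap_comp (f := fun x => s x t) (φ := fun y => y / (1 + κ * y))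
    (φ' := fun y => 1 / (1 + κ * y) ^ 2) (φ'' := fun y => -(2 * κ) / (1 + κ * y) ^ 3) (hs.space t)
    ((sepReg_bounded hs h0 hκ).space t) x (Eventually.of_forall fun z => hd _ (h0 z t)) (hd2 _ (h0 x t))
  have ht : deriv (fun t => s x t / (1 + κ * s x t)) t = 1 / (1 + κ * s x t) ^ 2 * deriv (s x) t :=
    ((hd _ (h0 x t)).comp t (hs.hasDerivAt x t)).deriv
  unfold heat
  rw [ht, hl]
  have h1 := hh x t
  unfold heat at h1
  have h2 : 0 ≤ ∑ i, pd i (fun x => s x t) x ^ 2 := Finset.sum_nonneg fun i _ => sq_nonneg _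
  have h3 : 0 < 1 + κ * s x t := by have := h0 x t; positivity
  have h4 : 0 ≤ 1 / (1 + κ * s x t) ^ 2 * (deriv (s x) t - lap (fun y => s y t) x) :=
    mul_nonneg (by positivity) h1
  have h5 : 0 ≤ 2 * κ / (1 + κ * s x t) ^ 3 * ∑ i, pd i (fun x => s x t) x ^ 2 :=
    mul_nonneg (by positivity) h2
  rw [neg_div]
  linarith

theorem SepReg.neg {v : Eu N → ℝ → ℝ} (hv : SepReg v) : SepReg fun x t => - v x t :=
  ⟨fun t => (hv.space t).neg, fun x => (hv.time x).neg⟩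

theorem heat_neg {v : Eu N → ℝ → ℝ} (hv : SepReg v) (x t) :
    heat (fun x t => - v x t) x t = - heat v x t := by
  have := heat_const_sub hv 0 x t
  simpa using this

/-- Lower bound for bounded supersolutions of the heat equation. -/
theorem low_core_bounded (N : ℕ) : ∃ C > 0, ∀ (v : Eu N → ℝ → ℝ) (M : ℝ), SepReg v →
    (∀ x t, 0 ≤ v x t) → (∀ x t, v x t ≤ M) → (∀ x t, 0 ≤ heat v x t) →
    ∀ (x₀ : Eu N) (t T : ℝ), ‖x₀‖ ≤ 2 → 1 ≤ T - t → T - t ≤ 8 →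
    ∫ x in closedBall (0 : Eu N) 2, v x t ≤ C * v x₀ T := by
  set m : ℝ := (4 * π) ^ (N / 2 : ℝ) with hm
  have hm0 : 0 < m := rpow_pos_of_pos (by positivity) _
  set g₀ : ℝ := 9 ^ (-(N / 2 : ℝ)) * exp (-4) with hg₀
  have hg₀0 : 0 < g₀ := mul_pos (rpow_pos_of_pos (by norm_num) _) (exp_pos _)
  set δ := g₀ / 2 with hδ
  have hδ0 : 0 < δ := by positivity
  set c₁ : ℝ := (N + 2).factorial * 2 ^ (N + 2) with hc₁
  have hc₁0 : 0 < c₁ := by positivity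
  set R : ℝ := 1 + 9 * c₁ / δ with hR
  have hR1 : 1 ≤ R := by rw [hR]; have : 0 ≤ 9 * c₁ / δ := by positivity
                         linarith
  refine ⟨8 / g₀ * m, by positivity, fun v M hv hv0 hvM hvh x₀ t T hx₀ htT htT8 => ?_⟩
  have hM : 0 ≤ M := (hv0 0 0).trans (hvM 0 0)
  set K : Set (Eu N) := closedBall x₀ R with hK
  have hKc : IsCompact K := isCompact_closedBall _ _
  have hout : ∀ x ∉ K, ∀ τ, 0 < τ → τ ≤ 9 → gk x₀ τ x ≤ δ := by
    intro x hx τ hτ hτ9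
    have hx' : R < ‖x - x₀‖ := by simpa [hK, dist_eq_norm] using hx
    have hne : x ≠ x₀ := by rintro rfl; simp at hx'; linarith
    refine (gk_le x₀ hτ hne).trans ?_
    rw [div_le_iff₀ (pow_pos (by linarith) _)]
    have h1 : R ≤ ‖x - x₀‖ ^ (N + 2) :=
      hx'.le.trans (le_self_pow₀ (by linarith) (by omega))
    have h2 : δ * R ≤ δ * ‖x - x₀‖ ^ (N + 2) := mul_le_mul_of_nonneg_left h1 hδ0.le
    have h3 : δ * R = δ + 9 * c₁ := by rw [hR]; field_simp
    nlinarith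
  refine le_of_forall_pos_le_add fun η hη => ?_
  set η' := η / (8 / g₀ * m) with hη'
  have hη'0 : 0 < η' := by positivity
  obtain ⟨ρ, hρ, hρv⟩ : ∃ ρ > 0, ∀ x ∈ ball x₀ ρ, v x T < v x₀ T + η' := by
    have : ∀ᶠ x in 𝓝 x₀, v x T < v x₀ T + η' :=
      (hv.space T).continuous.continuousAt.eventually_lt_const (by linarith)
    exact Metric.eventually_nhds_iff_ball.1 this
  set ε := min 1 (δ * ρ ^ (N + 2) / c₁) with hε
  have hε0 : 0 < ε := by rw [hε]; positivity
  have hε1 : ε ≤ 1 := min_le_left _ _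
  have hτ : ∀ r ∈ Icc t T, ε ≤ T - r + ε ∧ T - r + ε ≤ 9 := fun r hr =>
    ⟨by linarith [hr.2], by linarith [hr.1]⟩
  have hτ0 : ∀ r ∈ Icc t T, 0 < T - r + ε := fun r hr => hε0.trans_le (hτ r hr).1
  have hεr : 0 < ε ^ (-(N / 2 : ℝ)) := rpow_pos_of_pos hε0 _
  have hgC : ∀ τ, ContDiff ℝ 2 (gk x₀ τ) := fun τ => contDiff_gk x₀ τ
  have hΨC : ∀ τ, 0 < τ → ContDiff ℝ 2 fun x => trunc δ (gk x₀ τ x) := fun τ hτ =>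
    contDiff_trunc_comp δ (hgC τ) fun x => gk_pos x₀ hτ x
  have htr' : ∀ τ, 0 < τ → Continuous fun x => trunc' δ (gk x₀ τ x) := fun τ hτ =>
    continuous_iff_continuousAt.2 fun x =>
      ((hasDerivAt_trunc' δ (gk_pos x₀ hτ x)).continuousAt).comp
        (f := gk x₀ τ) (hgC τ).continuous.continuousAt
  have key := weak_upper hv.neg hKc (a := t) (b := T) (M := M)
    (L := 3 * (ε ^ (-(N / 2 : ℝ)) * (R ^ 2 / ε ^ 2 + N / ε))) (P := ε ^ (-(N / 2 : ℝ)))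
    (by linarith) (H := fun _ _ => 0) (fun _ => continuous_const)
    (fun r _ x _ => by
      have := forward_domination hv (U := univ) isOpen_univ le_rfl (fun P _ => hv0 P.1 P.2)
        (fun P _ => by simpa using hvh P.1 P.2) (x, r) (mem_univ _)
      simpa using this)
    (fun x _ r _ => by rw [abs_neg, abs_of_nonneg (hv0 x r)]; exact hvM x r)
    (fun x _ r _ => by rw [heat_neg hv]; linarith [hvh x r])
    (Ψ := fun x r => trunc δ (gk x₀ (T - r + ε) x))
    (Ψt := fun x r => trunc' δ (gk x₀ (T - r + ε) x) * -lap (gk x₀ (T - r + ε)) x)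
    (fun r hr => hΨC _ (hτ0 r hr))
    (fun r hr => (htr' _ (hτ0 r hr)).mul (continuous_lap (hgC _)).neg)
    (fun x hx r hr => (trunc_eq_zero (hout x hx _ (hτ0 r hr) (hτ r hr).2)).1)
    (fun x hx r hr => by rw [(trunc_eq_zero (hout x hx _ (hτ0 r hr) (hτ r hr).2)).2, zero_mul])
    (fun x r hr => by
      have h1 : HasDerivAt (fun r => gk x₀ (T - r + ε) x) (-lap (gk x₀ (T - r + ε)) x) r := by
        have := HasDerivAt.comp (h₂ := fun τ => gk x₀ τ x) (h := fun r => T - r + ε) r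
          (hasDerivAt_gk x₀ (hτ0 r hr) x) (((hasDerivAt_id r).const_sub T).add_const ε)
        rw [mul_neg_one] at this
        exact this
      exact (hasDerivAt_trunc δ (gk_pos x₀ (hτ0 r hr) x)).comp r h1)
    (fun x r hr => (trunc_bounds hδ0.le (gk_pos x₀ (hτ0 r hr) x)).1)
    (fun x r hr => (trunc_bounds hδ0.le (gk_pos x₀ (hτ0 r hr) x)).2.1.trans
      (gk_le_rpow x₀ hε0 (hτ r hr).1 x))
    (fun x r hr => by
      have h1 := gk_le_rpow x₀ hε0 (hτ r hr).1 x
      have h2 := gk_pos x₀ (hτ0 r hr) x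
      have htb := trunc_bounds hδ0.le h2
      by_cases hx : x ∈ K
      · rw [lap_gk x₀ (hτ0 r hr), abs_mul, abs_neg, abs_mul, abs_of_nonneg htb.2.2.1, abs_of_pos h2]
        have hxn : ‖x - x₀‖ ≤ R := by simpa [hK, dist_eq_norm] using hx
        have h3 : |‖x - x₀‖ ^ 2 / (4 * (T - r + ε) ^ 2) - N / (2 * (T - r + ε))|
            ≤ R ^ 2 / ε ^ 2 + N / ε := by
          refine (abs_sub _ _).trans ?_
          rw [abs_of_nonneg (by positivity), abs_of_nonneg (by have := hτ0 r hr; positivity)]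
          refine add_le_add ?_ ?_
          · refine div_le_div₀ (by positivity) (by gcongr) (by positivity) ?_
            nlinarith [(hτ r hr).1]
          · refine div_le_div_of_nonneg_left (by positivity) hε0 ?_
            linarith [(hτ r hr).1]
        exact mul_le_mul htb.2.2.2.1 (mul_le_mul h1 h3 (abs_nonneg _) hεr.le) (by positivity)
          (by norm_num)
      · rw [(trunc_eq_zero (hout x hx _ (hτ0 r hr) (hτ r hr).2)).2, zero_mul, abs_zero]; positivity)
    (B := fun _ => 0) (B' := fun _ => 0) continuousOn_const (fun t _ => hasDerivAt_const _ _)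
    (fun r hr => by
      have hrc : r ∈ Icc t T := ⟨hr.1.le, hr.2.le⟩
      refine integral_nonpos fun x => ?_
      have h2 := gk_pos x₀ (hτ0 r hrc) x
      have htb := trunc_bounds hδ0.le h2
      have hl := lap_comp (f := gk x₀ (T - r + ε)) (φ := trunc δ) (φ' := trunc' δ) (φ'' := trunc'' δ)
        (hgC _) (hΨC _ (hτ0 r hrc)) x
        (Eventually.of_forall fun z => hasDerivAt_trunc δ (gk_pos x₀ (hτ0 r hrc) z))
        (hasDerivAt_trunc' δ h2)
      have h3 : 0 ≤ ∑ i, pd i (gk x₀ (T - r + ε)) x ^ 2 := Finset.sum_nonneg fun i _ => sq_nonneg _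
      have h4 : 0 ≤ trunc'' δ (gk x₀ (T - r + ε) x) * ∑ i, pd i (gk x₀ (T - r + ε)) x ^ 2 :=
        mul_nonneg htb.2.2.2.2 h3
      simp only [hl, mul_zero, add_zero, Pi.zero_apply]
      have h5 := hv0 x r
      nlinarith)
  have htI : t ∈ Icc t T := ⟨le_rfl, by linarith⟩
  have hTI : T ∈ Icc t T := ⟨by linarith, le_rfl⟩
  have hint : ∀ r ∈ Icc t T, Integrable fun x => trunc δ (gk x₀ (T - r + ε) x) * v x r := by
    intro r hr
    refine Continuous.integrable_of_hasCompactSupport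
      ((hΨC _ (hτ0 r hr)).continuous.mul (hv.space r).continuous)
      (HasCompactSupport.intro hKc fun x hx => ?_)
    rw [(trunc_eq_zero (hout x hx _ (hτ0 r hr) (hτ r hr).2)).1, zero_mul]
  have hT : ∫ x, trunc δ (gk x₀ (T - T + ε) x) * v x T ≤ m * (v x₀ T + η') := by
    rw [hm, ← integral_gk x₀ (hτ0 T hTI), ← integral_mul_const]
    refine integral_mono (hint T hTI) ((integrable_gk x₀ (hτ0 T hTI)).mul_const _) fun x => ?_
    have h2 := gk_pos x₀ (hτ0 T hTI) x
    have htb := trunc_bounds hδ0.le h2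
    by_cases hx : x ∈ ball x₀ ρ
    · exact mul_le_mul htb.2.1 (hρv x hx).le (hv0 x T) h2.le
    · have hx' : ρ ≤ ‖x - x₀‖ := by simpa [dist_eq_norm] using hx
      have hne : x ≠ x₀ := by rintro rfl; simp at hx'; linarith
      have : gk x₀ (T - T + ε) x ≤ δ := by
        refine (gk_le x₀ (hτ0 T hTI) hne).trans ?_
        rw [div_le_iff₀ (pow_pos (by linarith) _), sub_self, zero_add]
        have h3 : ε ≤ δ * ρ ^ (N + 2) / c₁ := min_le_right _ _
        have h4 : c₁ * ε ≤ δ * ρ ^ (N + 2) := by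
          rw [le_div_iff₀ hc₁0] at h3; linarith
        refine h4.trans ?_
        gcongr
      simp only [(trunc_eq_zero this).1, zero_mul]
      have := hv0 x₀ T
      positivity
  have ht : g₀ / 8 * ∫ x in closedBall (0 : Eu N) 2, v x t
      ≤ ∫ x, trunc δ (gk x₀ (T - t + ε) x) * v x t := by
    rw [← integral_const_mul, ← integral_indicator measurableSet_closedBall]
    refine integral_mono ?_ (hint t htI) fun x => ?_
    · refine (integrable_indicator_iff measurableSet_closedBall).2 ?_
      exact (continuous_const.mul (hv.space _).continuous).continuousOn.integrableOn_compact
        (isCompact_closedBall _ _)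
    · have h2 := gk_pos x₀ (hτ0 t htI) x
      by_cases hx : x ∈ closedBall (0 : Eu N) 2
      · simp only [indicator_of_mem hx]
        refine mul_le_mul_of_nonneg_right ?_ (hv0 x t)
        have h1 : g₀ ≤ gk x₀ (T - t + ε) x := by
          have hxx : ‖x - x₀‖ ≤ 4 := by
            have := norm_sub_le x x₀
            have h5 : ‖x‖ ≤ 2 := by simpa using hx
            linarith
          unfold gk
          refine mul_le_mul (rpow_le_rpow_of_nonpos (hτ0 t htI) (hτ t htI).2
            (by rw [neg_nonpos]; positivity)) (exp_le_exp.2 ?_) (exp_pos _).le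
            (rpow_nonneg (hτ0 t htI).le _)
          rw [neg_div, neg_le_neg_iff, div_le_iff₀ (by have := hτ0 t htI; positivity)]
          nlinarith [norm_nonneg (x - x₀)]
        have := trunc_lower hδ0 (g := gk x₀ (T - t + ε) x) (by rw [hδ]; linarith)
        linarith
      · simp only [indicator_of_notMem hx]
        exact mul_nonneg (trunc_bounds hδ0.le h2).1 (hv0 x t)
  have hneg : ∀ r, ∫ x, trunc δ (gk x₀ (T - r + ε) x) * -v x r
      = -∫ x, trunc δ (gk x₀ (T - r + ε) x) * v x r := fun r => by
    rw [← integral_neg]; congr 1; ext x; ring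
  rw [hneg, hneg] at key
  have h1 : g₀ / 8 * ∫ x in closedBall (0 : Eu N) 2, v x t ≤ m * (v x₀ T + η') := by linarith
  calc ∫ x in closedBall (0 : Eu N) 2, v x t
      = 8 / g₀ * (g₀ / 8 * ∫ x in closedBall (0 : Eu N) 2, v x t) := by field_simp
    _ ≤ 8 / g₀ * (m * (v x₀ T + η')) := mul_le_mul_of_nonneg_left h1 (by positivity)
    _ = 8 / g₀ * m * v x₀ T + η := by rw [hη']; field_simp

theorem low_core (N : ℕ) : ∃ C > 0, ∀ s : Eu N → ℝ → ℝ, SepReg s →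
    (∀ x t, 0 ≤ s x t) → (∀ x t, 0 ≤ heat s x t) →
    ∀ (x₀ : Eu N) (t T : ℝ), ‖x₀‖ ≤ 2 → 1 ≤ T - t → T - t ≤ 8 →
    ∫ x in closedBall (0 : Eu N) 2, s x t ≤ C * s x₀ T := by
  obtain ⟨C, hC, h⟩ := low_core_bounded N
  refine ⟨C, hC, fun s hs h0 hh x₀ t T hx₀ h1 h8 => ?_⟩
  obtain ⟨S, hS⟩ := (isCompact_closedBall (0 : Eu N) 2).exists_bound_of_continuousOn
    (hs.space t).continuous.continuousOn
  have hS' : ∀ x ∈ closedBall (0 : Eu N) 2, s x t ≤ max S 0 := fun x hx =>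
    (le_abs_self _).trans ((hS x hx).trans (le_max_left _ _))
  set S' := max S 0
  have hS0 : 0 ≤ S' := le_max_right _ _
  have key : ∀ κ > 0, ∫ x in closedBall (0 : Eu N) 2, s x t ≤ (1 + κ * S') * (C * s x₀ T) := by
    intro κ hκ
    have hpos : ∀ x t, 0 < 1 + κ * s x t := fun x t => by have := h0 x t; positivity
    have hb := h (fun x t => s x t / (1 + κ * s x t)) (1 / κ) (sepReg_bounded hs h0 hκ)
      (fun x t => div_nonneg (h0 x t) (hpos x t).le)
      (fun x t => by rw [div_le_div_iff₀ (hpos x t) hκ]; linarith)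
      (heat_bounded_nonneg hs h0 hh hκ) x₀ t T hx₀ h1 h8
    have h2 : s x₀ T / (1 + κ * s x₀ T) ≤ s x₀ T :=
      div_le_self (h0 _ _) (by have := h0 x₀ T; nlinarith)
    have h3 : ∫ x in closedBall (0 : Eu N) 2, s x t
        ≤ ∫ x in closedBall (0 : Eu N) 2, (1 + κ * S') * (s x t / (1 + κ * s x t)) := by
      refine setIntegral_mono_on
        ((hs.space t).continuous.continuousOn.integrableOn_compact (isCompact_closedBall _ _))
        ((continuous_const.mul ((sepReg_bounded hs h0 hκ).space t).continuous).continuousOn.integrableOn_compact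
          (isCompact_closedBall _ _)) measurableSet_closedBall fun x hx => ?_
      rw [mul_div_assoc', le_div_iff₀ (hpos x t), mul_comm]
      refine mul_le_mul_of_nonneg_right ?_ (h0 x t)
      have := hS' x hx
      nlinarith
    rw [integral_const_mul] at h3
    refine h3.trans (mul_le_mul_of_nonneg_left (hb.trans ?_) (by positivity))
    exact mul_le_mul_of_nonneg_left h2 hC.le
  have hl : Tendsto (fun κ : ℝ => (1 + κ * S') * (C * s x₀ T)) (𝓝[>] 0) (𝓝 ((1 + 0 * S') * (C * s x₀ T))) := by
    refine Tendsto.mono_left ?_ nhdsWithin_le_nhds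
    exact Continuous.tendsto (by fun_prop) 0
  have := ge_of_tendsto hl (by filter_upwards [self_mem_nhdsWithin] with κ hκ using key κ hκ)
  simpa using this

end LowCore

open scoped ContDiff

section Directional

variable {E : Type*} [NormedAddCommGroup E] [NormedSpace ℝ E]

/-- Directional derivative of `f` along `v`. -/
noncomputable def dd (v : E) (f : E → ℝ) (z : E) : ℝ := fderiv ℝ f z v

theorem contDiff_dd {f : E → ℝ} (hf : ContDiff ℝ ∞ f) (v : E) : ContDiff ℝ ∞ (dd v f) :=
  (hf.fderiv_right (m := ∞) (by norm_cast)).clm_apply contDiff_const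

theorem diff_smooth {f : E → ℝ} (hf : ContDiff ℝ ∞ f) (z : E) : DifferentiableAt ℝ f z :=
  hf.differentiable (by simp) z

theorem dd_mul {f g : E → ℝ} (hf : ContDiff ℝ ∞ f) (hg : ContDiff ℝ ∞ g) (v z : E) :
    dd v (fun z => f z * g z) z = dd v f z * g z + f z * dd v g z := by
  simp only [dd]
  rw [fderiv_fun_mul (diff_smooth hf z) (diff_smooth hg z)]
  simp; ring

theorem dd_add {f g : E → ℝ} (hf : ContDiff ℝ ∞ f) (hg : ContDiff ℝ ∞ g) (v z : E) :
    dd v (fun z => f z + g z) z = dd v f z + dd v g z := by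
  simp only [dd]
  rw [fderiv_fun_add (diff_smooth hf z) (diff_smooth hg z)]
  simp

theorem dd_sub {f g : E → ℝ} (hf : ContDiff ℝ ∞ f) (hg : ContDiff ℝ ∞ g) (v z : E) :
    dd v (fun z => f z - g z) z = dd v f z - dd v g z := by
  simp only [dd]
  rw [fderiv_fun_sub (diff_smooth hf z) (diff_smooth hg z)]
  simp

theorem dd_const_mul {f : E → ℝ} (hf : ContDiff ℝ ∞ f) (c : ℝ) (v z : E) :
    dd v (fun z => c * f z) z = c * dd v f z := by
  simp only [dd]
  rw [fderiv_const_mul (diff_smooth hf z)]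
  simp

theorem dd_sum {ι : Type*} (s : Finset ι) {f : ι → E → ℝ} (hf : ∀ i ∈ s, ContDiff ℝ ∞ (f i))
    (v z : E) : dd v (fun z => ∑ i ∈ s, f i z) z = ∑ i ∈ s, dd v (f i) z := by
  simp only [dd]
  rw [fderiv_fun_sum fun i hi => diff_smooth (hf i hi) z]
  simp

theorem dd_comp {f : E → ℝ} (hf : ContDiff ℝ ∞ f) {h : ℝ → ℝ} {h' : ℝ} (v z : E)
    (hh : HasDerivAt h h' (f z)) : dd v (fun z => h (f z)) z = h' * dd v f z := by
  have := (hh.comp_hasFDerivAt z (diff_smooth hf z).hasFDerivAt).fderiv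
  simp only [dd]
  have e : (fun z => h (f z)) = h ∘ f := rfl
  rw [e, this]
  simp

theorem dd_rpow {f : E → ℝ} (hf : ContDiff ℝ ∞ f) (s : ℝ) (v z : E) (h0 : f z ≠ 0) :
    dd v (fun z => f z ^ s) z = s * f z ^ (s - 1) * dd v f z :=
  dd_comp hf (h := fun y => y ^ s) v z (Real.hasDerivAt_rpow_const (Or.inl h0))

theorem dd_inv {f : E → ℝ} (hf : ContDiff ℝ ∞ f) (v z : E) (h0 : f z ≠ 0) :
    dd v (fun z => (f z)⁻¹) z = -(f z ^ 2)⁻¹ * dd v f z :=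
  dd_comp hf (h := fun y => y⁻¹) v z (hasDerivAt_inv h0)

theorem dd_comm {f : E → ℝ} (hf : ContDiff ℝ ∞ f) (v u z : E) :
    dd v (dd u f) z = dd u (dd v f) z := by
  have hs : IsSymmSndFDerivAt ℝ f z :=
    hf.contDiffAt.isSymmSndFDerivAt (by
      simp only [minSmoothness_of_isRCLikeNormedField]
      exact WithTop.coe_le_coe.2 (le_top : (2 : ℕ∞) ≤ ⊤))
  have key : ∀ a b : E, dd a (dd b f) z = fderiv ℝ (fderiv ℝ f) z a b := by
    intro a b
    have hd : DifferentiableAt ℝ (fderiv ℝ f) z :=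
      (hf.fderiv_right (m := 1) (by norm_cast)).differentiable (by norm_num) z
    have e : dd b f = fun z => fderiv ℝ f z b := rfl
    rw [dd, e, fderiv_clm_apply hd (by fun_prop)]
    simp
  rw [key, key]
  exact hs v u

theorem dd_eq_zero_of_notMem_tsupport {f : E → ℝ} {z : E} (hz : z ∉ tsupport f) (v : E) :
    dd v f z = 0 := by
  have : fderiv ℝ f z = 0 := by
    by_contra h
    exact hz (support_fderiv_subset ℝ h)
  simp [dd, this]

theorem dd_dd_eq_zero_of_notMem_tsupport {f : E → ℝ} {z : E} (hz : z ∉ tsupport f) (u v : E) :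
    dd u (dd v f) z = 0 := by
  refine dd_eq_zero_of_notMem_tsupport (fun h => hz ?_) u
  refine closure_minimal ?_ (isClosed_tsupport f) h
  intro y hy
  by_contra h'
  exact hy (dd_eq_zero_of_notMem_tsupport h' v)

/-- Laplacian along the frame `e`. -/
noncomputable def La {N : ℕ} (e : Fin N → E) (f : E → ℝ) (z : E) : ℝ :=
  ∑ j, dd (e j) (dd (e j) f) z

/-- Inner product of gradients along the frame `e`. -/
noncomputable def gi {N : ℕ} (e : Fin N → E) (f g : E → ℝ) (z : E) : ℝ :=
  ∑ j, dd (e j) f z * dd (e j) g z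

theorem contDiff_La {N : ℕ} (e : Fin N → E) {f : E → ℝ} (hf : ContDiff ℝ ∞ f) :
    ContDiff ℝ ∞ (La e f) :=
  ContDiff.sum fun _ _ => contDiff_dd (contDiff_dd hf _) _

theorem contDiff_gi {N : ℕ} (e : Fin N → E) {f g : E → ℝ} (hf : ContDiff ℝ ∞ f)
    (hg : ContDiff ℝ ∞ g) : ContDiff ℝ ∞ (gi e f g) :=
  ContDiff.sum fun _ _ => (contDiff_dd hf _).mul (contDiff_dd hg _)

variable [MeasurableSpace E] [BorelSpace E] [FiniteDimensional ℝ E] {μ : Measure E}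
  [μ.IsAddHaarMeasure]

theorem integral_dd_eq_zero {f : E → ℝ} (hf : ContDiff ℝ ∞ f) (hc : HasCompactSupport f)
    (v : E) : ∫ z, dd v f z ∂μ = 0 := by
  have h1 : Integrable (dd v f) μ :=
    (contDiff_dd hf v).continuous.integrable_of_hasCompactSupport
      (HasCompactSupport.intro hc fun z hz => dd_eq_zero_of_notMem_tsupport hz v)
  have h2 : Integrable f μ := hf.continuous.integrable_of_hasCompactSupport hc
  have h := integral_mul_fderiv_eq_neg_fderiv_mul_of_integrable (𝕜 := ℝ) (μ := μ)
    (f := fun _ => 1) (g := f) (v := v) (by simp)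
    (by simp only [one_mul]; exact h1) (by simp only [one_mul]; exact h2)
    (fun x _ => by fun_prop) (fun x _ => diff_smooth hf x)
  simpa [dd] using h

theorem integral_div_eq_zero {ι : Type*} (s : Finset ι) {Y : ι → E → ℝ} (e : ι → E)
    (hY : ∀ i, ContDiff ℝ ∞ (Y i)) (hc : ∀ i, HasCompactSupport (Y i)) :
    ∫ z, ∑ i ∈ s, dd (e i) (Y i) z ∂μ = 0 := by
  rw [integral_finsetSum]
  · exact Finset.sum_eq_zero fun i _ => integral_dd_eq_zero (hY i) (hc i) _
  · intro i _
    exact (contDiff_dd (hY i) _).continuous.integrable_of_hasCompactSupport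
      (HasCompactSupport.intro (hc i) fun z hz => dd_eq_zero_of_notMem_tsupport hz _)

/-- `φ · F` plus derivative terms of `φ`: everything supported in `tsupport φ` is integrable. -/
theorem integrable_of_tsupport {φ f : E → ℝ} (hc : HasCompactSupport φ) (hf : Continuous f)
    (h : ∀ z ∉ tsupport φ, f z = 0) : Integrable f μ :=
  hf.integrable_of_hasCompactSupport (HasCompactSupport.intro hc h)

theorem integral_flux {N : ℕ} (e : Fin N → E) {φ f w : E → ℝ} (hφ : ContDiff ℝ ∞ φ)
    (hc : HasCompactSupport φ) (hf : ContDiff ℝ ∞ f) (hw : ContDiff ℝ ∞ w) :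
    ∫ z, (f z * gi e φ w z + φ z * gi e f w z + φ z * f z * La e w z) ∂μ = 0 := by
  rw [← integral_div_eq_zero (μ := μ) Finset.univ (Y := fun j z => φ z * (f z * dd (e j) w z)) e
    (fun j => hφ.mul (hf.mul (contDiff_dd hw _))) (fun j => hc.mul_right)]
  congr 1
  ext z
  simp only [gi, La, Finset.mul_sum, ← Finset.sum_add_distrib]
  refine Finset.sum_congr rfl fun j _ => ?_
  rw [dd_mul hφ (hf.mul (contDiff_dd hw _)), dd_mul hf (contDiff_dd hw _)]
  ring

theorem integral_hess {N : ℕ} (e : Fin N → E) {φ w : E → ℝ} (hφ : ContDiff ℝ ∞ φ)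
    (hc : HasCompactSupport φ) (hw : ContDiff ℝ ∞ w) :
    ∫ z, (φ z * (La e w z ^ 2 - ∑ j, ∑ k, dd (e j) (dd (e k) w) z ^ 2) + La e w z * gi e φ w z
      + 1 / 2 * La e φ z * gi e w w z) ∂μ = 0 := by
  have hp := fun j => contDiff_dd hw (e j)
  have hL := contDiff_La e hw
  have hG := contDiff_gi e hw hw
  have hS : ∀ j, ContDiff ℝ ∞ fun z => ∑ k, dd (e j) (dd (e k) w) z * dd (e k) w z := fun j =>
    ContDiff.sum fun k _ => (contDiff_dd (hp k) _).mul (hp k)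
  have hT : ∀ j, ContDiff ℝ ∞ fun z => (La e w z * dd (e j) w z
        - ∑ k, dd (e j) (dd (e k) w) z * dd (e k) w z) := fun j => (hL.mul (hp j)).sub (hS j)
  have hY1 : ∀ j, ContDiff ℝ ∞ fun z => φ z * (La e w z * dd (e j) w z
        - ∑ k, dd (e j) (dd (e k) w) z * dd (e k) w z) := fun j => hφ.mul (hT j)
  have hY2 : ∀ j, ContDiff ℝ ∞ fun z => dd (e j) φ z * (1 / 2 * gi e w w z) := fun j =>
    (contDiff_dd hφ _).mul (contDiff_const.mul hG)
  have hY : ∀ j, ContDiff ℝ ∞ fun z => φ z * (La e w z * dd (e j) w z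
        - ∑ k, dd (e j) (dd (e k) w) z * dd (e k) w z) + dd (e j) φ z * (1 / 2 * gi e w w z) :=
    fun j => (hY1 j).add (hY2 j)
  rw [← integral_div_eq_zero (μ := μ) Finset.univ (Y := fun j z =>
      φ z * (La e w z * dd (e j) w z - ∑ k, dd (e j) (dd (e k) w) z * dd (e k) w z)
        + dd (e j) φ z * (1 / 2 * gi e w w z)) e hY
    (fun j => HasCompactSupport.intro hc fun z hz => by
      rw [image_eq_zero_of_notMem_tsupport hz, dd_eq_zero_of_notMem_tsupport hz]; ring)]
  congr 1
  ext z
  have dG : ∀ j, dd (e j) (gi e w w) z = 2 * ∑ k, dd (e j) (dd (e k) w) z * dd (e k) w z := by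
    intro j
    unfold gi
    rw [dd_sum _ fun k _ => (hp k).mul (hp k), Finset.mul_sum]
    refine Finset.sum_congr rfl fun k _ => ?_
    rw [dd_mul (hp k) (hp k)]; ring
  have dS : ∀ j, dd (e j) (fun z => ∑ k, dd (e j) (dd (e k) w) z * dd (e k) w z) z
      = ∑ k, (dd (e j) (dd (e j) (dd (e k) w)) z * dd (e k) w z
          + dd (e j) (dd (e k) w) z ^ 2) := by
    intro j
    rw [dd_sum _ fun k _ => (contDiff_dd (hp k) _).mul (hp k)]
    refine Finset.sum_congr rfl fun k _ => ?_
    rw [dd_mul (contDiff_dd (hp k) _) (hp k)]; ring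
  have dL : ∀ k, dd (e k) (La e w) z = ∑ j, dd (e j) (dd (e j) (dd (e k) w)) z := by
    intro k
    unfold La
    rw [dd_sum _ fun j _ => contDiff_dd (hp j) _]
    refine Finset.sum_congr rfl fun j _ => ?_
    rw [dd_comm (hp j)]
    congr 1
    ext y
    exact dd_comm hw _ _ _
  have hj : ∀ j, dd (e j) (fun z => φ z * (La e w z * dd (e j) w z
        - ∑ k, dd (e j) (dd (e k) w) z * dd (e k) w z) + dd (e j) φ z * (1 / 2 * gi e w w z)) z
      = La e w z * (dd (e j) φ z * dd (e j) w z) + φ z * (dd (e j) (La e w) z * dd (e j) w z)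
        + φ z * La e w z * dd (e j) (dd (e j) w) z
        - φ z * ∑ k, dd (e j) (dd (e j) (dd (e k) w)) z * dd (e k) w z
        - φ z * ∑ k, dd (e j) (dd (e k) w) z ^ 2
        + 1 / 2 * gi e w w z * dd (e j) (dd (e j) φ) z := by
    intro j
    rw [dd_add (hY1 j) (hY2 j), dd_mul hφ (hT j), dd_sub (hL.mul (hp j)) (hS j),
      dd_mul hL (hp j), dS, dd_mul (contDiff_dd hφ _) (contDiff_const.mul hG), dd_const_mul hG, dG,
      Finset.sum_add_distrib]
    ring
  have h3 : ∑ j, dd (e j) (La e w) z * dd (e j) w z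
      = ∑ j, ∑ k, dd (e j) (dd (e j) (dd (e k) w)) z * dd (e k) w z := by
    rw [Finset.sum_comm]
    refine Finset.sum_congr rfl fun k _ => ?_
    rw [dL, Finset.sum_mul]
  simp_rw [hj]
  simp only [Finset.sum_add_distrib, Finset.sum_sub_distrib, ← Finset.mul_sum, h3]
  have e1 : ∑ j, dd (e j) φ z * dd (e j) w z = gi e φ w z := rfl
  have e2 : ∑ j, dd (e j) (dd (e j) w) z = La e w z := rfl
  have e3 : ∑ j, dd (e j) (dd (e j) φ) z = La e φ z := rfl
  rw [e1, e2, e3]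
  ring

theorem integral_grad {N : ℕ} (e : Fin N → E) {φ w : E → ℝ} (hφ : ContDiff ℝ ∞ φ)
    (hc : HasCompactSupport φ) (hw : ContDiff ℝ ∞ w) (h0 : ∀ z, 0 < w z) :
    ∫ z, (gi e φ w z * (gi e w w z / w z) + φ z * (La e w z * (gi e w w z / w z)
      + 2 * (∑ j, ∑ k, dd (e j) (dd (e k) w) z * dd (e k) w z * dd (e j) w z) / w z
      - (gi e w w z / w z) ^ 2)) ∂μ = 0 := by
  have hp := fun j => contDiff_dd hw (e j)
  have hG := contDiff_gi e hw hw
  have hi : ContDiff ℝ ∞ fun z => (w z)⁻¹ := hw.inv fun z => (h0 z).ne'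
  rw [← integral_flux (μ := μ) e hφ hc (f := fun z => gi e w w z * (w z)⁻¹) (hG.mul hi) hw]
  congr 1
  ext z
  have dG : ∀ j, dd (e j) (gi e w w) z = 2 * ∑ k, dd (e j) (dd (e k) w) z * dd (e k) w z := by
    intro j
    unfold gi
    rw [dd_sum _ fun k _ => (hp k).mul (hp k), Finset.mul_sum]
    refine Finset.sum_congr rfl fun k _ => ?_
    rw [dd_mul (hp k) (hp k)]; ring
  have e1 : gi e (fun z => gi e w w z * (w z)⁻¹) w z
      = 2 * (∑ j, ∑ k, dd (e j) (dd (e k) w) z * dd (e k) w z * dd (e j) w z) / w z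
      - (gi e w w z / w z) ^ 2 := by
    have : ∀ j, dd (e j) (fun z => gi e w w z * (w z)⁻¹) z * dd (e j) w z
        = 2 * (w z)⁻¹ * (∑ k, dd (e j) (dd (e k) w) z * dd (e k) w z * dd (e j) w z)
          - gi e w w z * (w z ^ 2)⁻¹ * (dd (e j) w z * dd (e j) w z) := by
      intro j
      rw [dd_mul hG hi, dG, dd_inv hw _ _ (h0 z).ne', ← Finset.sum_mul]
      ring
    rw [gi]
    simp_rw [this]
    rw [Finset.sum_sub_distrib, ← Finset.mul_sum, ← Finset.mul_sum]
    have e1 : ∑ j, dd (e j) w z * dd (e j) w z = gi e w w z := rfl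
    rw [e1]
    have := (h0 z).ne'
    field_simp
  rw [e1]
  have := (h0 z).ne'
  field_simp
  ring

theorem integral_time {N : ℕ} (e : Fin N → E) (d : E) {φ w : E → ℝ} (hφ : ContDiff ℝ ∞ φ)
    (hc : HasCompactSupport φ) (hw : ContDiff ℝ ∞ w) :
    ∫ z, (dd d w z * gi e φ w z + φ z * dd d w z * La e w z
      - 1 / 2 * dd d φ z * gi e w w z) ∂μ = 0 := by
  have hp := fun j => contDiff_dd hw (e j)
  have hG := contDiff_gi e hw hw
  have hτ := contDiff_dd hw d
  have h1 := integral_flux (μ := μ) e hφ hc hτ hw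
  have h2 := integral_dd_eq_zero (μ := μ) (f := fun z => φ z * (1 / 2 * gi e w w z))
    (hφ.mul (contDiff_const.mul hG)) hc.mul_right d
  have key : ∀ z, dd d w z * gi e φ w z + φ z * dd d w z * La e w z
      - 1 / 2 * dd d φ z * gi e w w z
      = (dd d w z * gi e φ w z + φ z * gi e (dd d w) w z + φ z * dd d w z * La e w z)
        - dd d (fun z => φ z * (1 / 2 * gi e w w z)) z := by
    intro z
    have e1 : dd d (gi e w w) z = 2 * gi e (dd d w) w z := by
      unfold gi
      rw [dd_sum _ fun k _ => (hp k).mul (hp k), Finset.mul_sum]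
      refine Finset.sum_congr rfl fun k _ => ?_
      rw [dd_mul (hp k) (hp k), dd_comm hw d]; ring
    rw [dd_mul hφ (contDiff_const.mul hG), dd_const_mul hG, e1]
    ring
  simp_rw [key]
  rw [integral_sub, h1, h2, sub_zero]
  · refine integrable_of_tsupport hc ?_ ?_
    · exact (((hτ.mul (contDiff_gi e hφ hw)).add (hφ.mul (contDiff_gi e hτ hw))).add
        ((hφ.mul hτ).mul (contDiff_La e hw))).continuous
    · intro z hz
      simp [gi, image_eq_zero_of_notMem_tsupport hz, dd_eq_zero_of_notMem_tsupport hz]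
  · refine integrable_of_tsupport (φ := fun z => φ z * (1 / 2 * gi e w w z)) hc.mul_right
      (contDiff_dd (hφ.mul (contDiff_const.mul hG)) d).continuous
      fun z hz => dd_eq_zero_of_notMem_tsupport hz d

end Directional

theorem trace_sq_le {N : ℕ} (H : Fin N → Fin N → ℝ) (p : Fin N → ℝ) (c : ℝ) :
    (∑ j, H j j - c * ∑ j, p j * p j) ^ 2 ≤ N * (∑ j, ∑ k, H j k ^ 2
      - 2 * c * (∑ j, ∑ k, H j k * p k * p j) + c ^ 2 * (∑ j, p j * p j) ^ 2) := by
  have h1 : ∑ j, ∑ k, H j k ^ 2 - 2 * c * (∑ j, ∑ k, H j k * p k * p j)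
      + c ^ 2 * (∑ j, p j * p j) ^ 2 = ∑ j, ∑ k, (H j k - c * (p j * p k)) ^ 2 := by
    rw [sq (∑ j, p j * p j), Finset.sum_mul_sum]
    simp only [Finset.mul_sum, ← Finset.sum_sub_distrib, ← Finset.sum_add_distrib]
    refine Finset.sum_congr rfl fun j _ => Finset.sum_congr rfl fun k _ => ?_
    ring
  have h2 : ∑ j, H j j - c * ∑ j, p j * p j = ∑ j, (H j j - c * (p j * p j)) := by
    rw [Finset.mul_sum, Finset.sum_sub_distrib]
  rw [h1, h2]
  refine (sq_sum_le_card_mul_sum_sq).trans ?_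
  simp only [Finset.card_univ, Fintype.card_fin]
  refine mul_le_mul_of_nonneg_left ?_ (Nat.cast_nonneg _)
  refine Finset.sum_le_sum fun j _ => ?_
  exact Finset.single_le_sum (f := fun k => (H j k - c * (p j * p k)) ^ 2)
    (fun k _ => sq_nonneg _) (Finset.mem_univ j)

section Bernstein

variable {E : Type*} [NormedAddCommGroup E] [NormedSpace ℝ E] [MeasurableSpace E] [BorelSpace E]
  [FiniteDimensional ℝ E] {μ : Measure E} [μ.IsAddHaarMeasure]

theorem bernstein_integral {N : ℕ} (hN : 1 ≤ N) (e : Fin N → E) {φ w : E → ℝ} (hφ : ContDiff ℝ ∞ φ)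
    (hc : HasCompactSupport φ) (hφ0 : ∀ z, 0 ≤ φ z) (hw : ContDiff ℝ ∞ w) (h0 : ∀ z, 0 < w z)
    (σ : ℝ) :
    0 ≤ ∫ z, (φ z * ((1 - 1 / N) * La e w z ^ 2
        + σ * ((N + 2) / N) * (La e w z * (gi e w w z / w z))
        - (σ - σ ^ 2 * (1 - 1 / N)) * (gi e w w z / w z) ^ 2) + La e w z * gi e φ w z
      + 1 / 2 * La e φ z * gi e w w z + σ * (gi e φ w z * (gi e w w z / w z))) ∂μ := by
  have hp := fun j => contDiff_dd hw (e j)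
  have hG := contDiff_gi e hw hw
  have hh := contDiff_gi e hφ hw
  have hL := contDiff_La e hw
  have hLφ := contDiff_La e hφ
  have hH := fun j k => contDiff_dd (hp k) (e j)
  have hQ : ContDiff ℝ ∞ fun z => gi e w w z / w z := hG.div hw fun z => (h0 z).ne'
  have hS1 : ContDiff ℝ ∞ fun z => ∑ j, ∑ k, dd (e j) (dd (e k) w) z ^ 2 :=
    ContDiff.sum fun j _ => ContDiff.sum fun k _ => (hH j k).pow 2
  have hS2 : ContDiff ℝ ∞ fun z =>
      ∑ j, ∑ k, dd (e j) (dd (e k) w) z * dd (e k) w z * dd (e j) w z :=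
    ContDiff.sum fun j _ => ContDiff.sum fun k _ => ((hH j k).mul (hp k)).mul (hp j)
  have hzφ : ∀ z ∉ tsupport φ, gi e φ w z = 0 := fun z hz => by
    simp [gi, dd_eq_zero_of_notMem_tsupport hz]
  have hzL : ∀ z ∉ tsupport φ, La e φ z = 0 := fun z hz => by
    simp [La, dd_dd_eq_zero_of_notMem_tsupport hz]
  have i1 := integral_hess (μ := μ) e hφ hc hw
  have i2 := integral_grad (μ := μ) e hφ hc hw h0
  have int1 : Integrable (fun z => φ z * (La e w z ^ 2 - ∑ j, ∑ k, dd (e j) (dd (e k) w) z ^ 2)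
      + La e w z * gi e φ w z + 1 / 2 * La e φ z * gi e w w z) μ := by
    refine integrable_of_tsupport hc ?_ fun z hz => ?_
    · exact (((hφ.mul ((hL.pow 2).sub hS1)).add (hL.mul hh)).add
        ((contDiff_const.mul hLφ).mul hG)).continuous
    · rw [image_eq_zero_of_notMem_tsupport hz, hzφ z hz, hzL z hz]; ring
  have int2 : Integrable (fun z => gi e φ w z * (gi e w w z / w z)
      + φ z * (La e w z * (gi e w w z / w z)
      + 2 * (∑ j, ∑ k, dd (e j) (dd (e k) w) z * dd (e k) w z * dd (e j) w z) / w z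
      - (gi e w w z / w z) ^ 2)) μ := by
    refine integrable_of_tsupport hc ?_ fun z hz => ?_
    · exact ((hh.mul hQ).add (hφ.mul (((hL.mul hQ).add ((contDiff_const.mul hS2).div hw
        fun z => (h0 z).ne')).sub (hQ.pow 2)))).continuous
    · rw [image_eq_zero_of_notMem_tsupport hz, hzφ z hz]; ring
  have hsum : ∫ z, ((φ z * (La e w z ^ 2 - ∑ j, ∑ k, dd (e j) (dd (e k) w) z ^ 2)
      + La e w z * gi e φ w z + 1 / 2 * La e φ z * gi e w w z)
      + σ * (gi e φ w z * (gi e w w z / w z)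
      + φ z * (La e w z * (gi e w w z / w z)
      + 2 * (∑ j, ∑ k, dd (e j) (dd (e k) w) z * dd (e k) w z * dd (e j) w z) / w z
      - (gi e w w z / w z) ^ 2))) ∂μ = 0 := by
    rw [integral_add int1 (int2.const_mul σ), integral_const_mul, i1, i2]; simp
  rw [← hsum]
  refine integral_mono (int1.add (int2.const_mul σ)) ?_ ?_
  · refine integrable_of_tsupport hc ?_ fun z hz => ?_
    · exact ((((hφ.mul (((contDiff_const.mul (hL.pow 2)).add (contDiff_const.mul
        (hL.mul hQ))).sub (contDiff_const.mul (hQ.pow 2))))).add (hL.mul hh)).add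
        ((contDiff_const.mul hLφ).mul hG)).add (contDiff_const.mul (hh.mul hQ)) |>.continuous
    · rw [image_eq_zero_of_notMem_tsupport hz, hzφ z hz, hzL z hz]; ring
  · intro z
    simp only []
    have ht := trace_sq_le (fun j k => dd (e j) (dd (e k) w) z) (fun j => dd (e j) w z) (σ / w z)
    have e1 : ∑ j, dd (e j) w z * dd (e j) w z = gi e w w z := rfl
    have e2 : ∑ j, dd (e j) (dd (e j) w) z = La e w z := rfl
    simp only [e1, e2] at ht
    have hw0 := h0 z
    set S1 := ∑ j, ∑ k, dd (e j) (dd (e k) w) z ^ 2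
    set S2 := ∑ j, ∑ k, dd (e j) (dd (e k) w) z * dd (e k) w z * dd (e j) w z
    have hN' : (0 : ℝ) < N := by exact_mod_cast hN
    set G := gi e w w z / w z with hGd
    have r1 : σ / w z * gi e w w z = σ * G := by rw [hGd]; ring
    have r2 : (σ / w z) ^ 2 * gi e w w z ^ 2 = σ ^ 2 * G ^ 2 := by rw [hGd]; ring
    have r3 : 2 * (σ / w z) * S2 = σ * (2 * S2 / w z) := by ring
    rw [r1, r2, r3] at ht
    have ht' : (La e w z - σ * G) ^ 2 / N ≤ S1 - σ * (2 * S2 / w z) + σ ^ 2 * G ^ 2 := by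
      rw [div_le_iff₀ hN']; linarith
    have := mul_le_mul_of_nonneg_left ht' (hφ0 z)
    have e3 : φ z * ((1 - 1 / N) * La e w z ^ 2
        + σ * ((N + 2) / N) * (La e w z * G)
        - (σ - σ ^ 2 * (1 - 1 / N)) * G ^ 2) = φ z * (La e w z ^ 2 + σ * La e w z * G - σ * G ^ 2
          + σ ^ 2 * G ^ 2) - φ z * ((La e w z - σ * G) ^ 2 / N) := by
      field_simp; ring
    rw [e3]
    nlinarith [this]

end Bernstein

theorem exists_sigma {N : ℕ} (hN : 1 ≤ N) {p : ℝ} (hp : 1 < p)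
    (hpB : N = 1 ∨ (2 ≤ N ∧ p < ((N : ℝ) * (N + 2)) / ((N : ℝ) - 1) ^ 2)) :
    ∃ σ : ℝ, 0 < σ ∧ 0 < σ - σ ^ 2 * (1 - 1 / N) ∧ (1 - 1 / N) * p < σ * (((N : ℝ) + 2) / N) := by
  rcases hpB with h | ⟨h, hlt⟩
  · subst h
    exact ⟨1, by norm_num, by norm_num, by norm_num⟩
  · have hN2 : (2 : ℝ) ≤ N := by exact_mod_cast h
    have h1 : (0 : ℝ) < N - 1 := by linarith
    have h3 : p * (N - 1) / (N + 2) < N / (N - 1) := by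
      rw [lt_div_iff₀ (by positivity)] at hlt
      rw [div_lt_div_iff₀ (by linarith) h1]
      nlinarith
    obtain ⟨σ, hσ1, hσ2⟩ := exists_between h3
    have hσ : 0 < σ := lt_trans (by positivity) hσ1
    refine ⟨σ, hσ, ?_, ?_⟩
    · have : σ * ((N - 1) / N) < 1 := by
        rw [lt_div_iff₀ h1] at hσ2
        rw [mul_div_assoc', div_lt_one (by linarith)]; exact hσ2
      have e : (1 - 1 / (N : ℝ)) = (N - 1) / N := by field_simp
      rw [e]; nlinarith
    · rw [div_lt_iff₀ (by linarith)] at hσ1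
      have e : (1 - 1 / (N : ℝ)) = (N - 1) / N := by field_simp
      rw [e, mul_div_assoc', div_mul_eq_mul_div, div_lt_div_iff_of_pos_right (by linarith)]
      linarith

/-- Coefficients of the quadratic form controlled by the combination of identities. -/
theorem exists_coeffs {A b α p : ℝ} (hA : 0 ≤ A) (hα : 0 < α) (hp : 0 < p) (hb : A * p < b) :
    ∃ κ₁ κ₂ κ₃ c C : ℝ, 0 ≤ κ₁ ∧ 0 < c ∧ 0 < C ∧ ∀ f τ ε G : ℝ, 0 ≤ f → 0 ≤ G →
      A * (τ - f - ε) ^ 2 + b * ((τ - f - ε) * G) - α * G ^ 2 + κ₁ * (f * (τ - f - ε))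
        + κ₂ * (τ * (τ - f - ε)) + κ₃ * (f * τ) + κ₁ * (p * (f * G))
      ≤ -c * (f ^ 2 + τ ^ 2 + G ^ 2) + C * ε ^ 2 := by
  obtain ⟨κ₄, hκ₄, h4⟩ : ∃ κ₄ : ℝ, 0 < κ₄ ∧ (A + κ₄) * p ≤ b :=
    ⟨(b - A * p) / p, div_pos (by linarith) hp, by field_simp; linarith⟩
  obtain ⟨κ₅, hκ₅, h5⟩ : ∃ κ₅ : ℝ, 0 < κ₅ ∧ b ^ 2 ≤ κ₅ * α :=
    ⟨b ^ 2 / α + 1, by positivity, by field_simp; nlinarith⟩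
  have hb0 : 0 < b := lt_of_le_of_lt (by positivity) hb
  set c := min (κ₄ / 2) (min (κ₅ / 4) (α / 4)) with hcd
  have c1 : c ≤ κ₄ / 2 := min_le_left _ _
  have c2 : c ≤ κ₅ / 4 := (min_le_right _ _).trans (min_le_left _ _)
  have c3 : c ≤ α / 4 := (min_le_right _ _).trans (min_le_right _ _)
  refine ⟨A + κ₄, -κ₅ - A, -(κ₄ + κ₅), c,
    A + (A - κ₄) ^ 2 / (2 * κ₄) + (κ₅ - A) ^ 2 / κ₅ + b ^ 2 / α, by linarith,
    lt_min (by linarith) (lt_min (by linarith) (by linarith)), by positivity,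
    fun f τ ε G hf hG => ?_⟩
  have e0 : A * (τ - f - ε) ^ 2 + b * ((τ - f - ε) * G) - α * G ^ 2
      + (A + κ₄) * (f * (τ - f - ε)) + (-κ₅ - A) * (τ * (τ - f - ε)) + -(κ₄ + κ₅) * (f * τ)
      + (A + κ₄) * (p * (f * G))
      = -κ₄ * f ^ 2 - κ₅ * τ ^ 2 + A * ε ^ 2 + (A - κ₄) * (f * ε) + (κ₅ - A) * (τ * ε)
        + b * (τ * G) - (b - (A + κ₄) * p) * (f * G) - b * (ε * G) - α * G ^ 2 := by ring
  rw [e0]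
  have y1 : (A - κ₄) * (f * ε) ≤ κ₄ / 2 * f ^ 2 + (A - κ₄) ^ 2 / (2 * κ₄) * ε ^ 2 := by
    have : κ₄ / 2 * f ^ 2 + (A - κ₄) ^ 2 / (2 * κ₄) * ε ^ 2 - (A - κ₄) * (f * ε)
        = (κ₄ * f - (A - κ₄) * ε) ^ 2 / (2 * κ₄) := by field_simp; ring
    have h : 0 ≤ (κ₄ * f - (A - κ₄) * ε) ^ 2 / (2 * κ₄) := by positivity
    linarith
  have y2 : (κ₅ - A) * (τ * ε) ≤ κ₅ / 4 * τ ^ 2 + (κ₅ - A) ^ 2 / κ₅ * ε ^ 2 := by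
    have : κ₅ / 4 * τ ^ 2 + (κ₅ - A) ^ 2 / κ₅ * ε ^ 2 - (κ₅ - A) * (τ * ε)
        = (κ₅ / 2 * τ - (κ₅ - A) * ε) ^ 2 / κ₅ := by field_simp; ring
    have h : 0 ≤ (κ₅ / 2 * τ - (κ₅ - A) * ε) ^ 2 / κ₅ := by positivity
    linarith
  have y3 : b * (τ * G) ≤ κ₅ / 2 * τ ^ 2 + α / 2 * G ^ 2 := by
    have h1 : κ₅ / 2 * τ ^ 2 + b ^ 2 / (2 * κ₅) * G ^ 2 - b * (τ * G)
        = (κ₅ * τ - b * G) ^ 2 / (2 * κ₅) := by field_simp; ring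
    have h : 0 ≤ (κ₅ * τ - b * G) ^ 2 / (2 * κ₅) := by positivity
    have h2 : b ^ 2 / (2 * κ₅) ≤ α / 2 := by
      rw [div_le_div_iff₀ (by positivity) (by norm_num)]; nlinarith
    nlinarith [mul_le_mul_of_nonneg_right h2 (sq_nonneg G)]
  have y4 : -(b * (ε * G)) ≤ α / 4 * G ^ 2 + b ^ 2 / α * ε ^ 2 := by
    have : α / 4 * G ^ 2 + b ^ 2 / α * ε ^ 2 + (b * (ε * G))
        = (α / 2 * G + b * ε) ^ 2 / α := by field_simp; ring
    have h : 0 ≤ (α / 2 * G + b * ε) ^ 2 / α := by positivity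
    linarith
  have y5 : 0 ≤ (b - (A + κ₄) * p) * (f * G) := mul_nonneg (by linarith) (mul_nonneg hf hG)
  nlinarith [mul_le_mul_of_nonneg_right c1 (sq_nonneg f),
    mul_le_mul_of_nonneg_right c2 (sq_nonneg τ), mul_le_mul_of_nonneg_right c3 (sq_nonneg G)]

/-- The nonlinearity of the system. -/
noncomputable def reac {m : ℕ} (β : Fin m → Fin m → ℝ) (r : ℝ) (y : Fin m → ℝ) (i : Fin m) : ℝ :=
  ∑ j, β i j * y i ^ r * y j ^ (r + 1)

theorem sq_comb_le (x y σ f τ ε G : ℝ) :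
    (x * τ + y * f - ε + σ * G) ^ 2
      ≤ 4 * (1 + x ^ 2 + y ^ 2 + σ ^ 2) * (f ^ 2 + τ ^ 2 + G ^ 2 + ε ^ 2) := by
  have h3 : (x * τ + y * f - ε + σ * G) ^ 2
      ≤ 4 * ((x * τ) ^ 2 + (y * f) ^ 2 + ε ^ 2 + (σ * G) ^ 2) := by
    nlinarith [sq_nonneg (x * τ - y * f), sq_nonneg (x * τ + ε),
      sq_nonneg (x * τ - σ * G), sq_nonneg (y * f + ε),
      sq_nonneg (y * f - σ * G), sq_nonneg (ε + σ * G)]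
  refine h3.trans ?_
  have e : 4 * (1 + x ^ 2 + y ^ 2 + σ ^ 2) * (f ^ 2 + τ ^ 2 + G ^ 2 + ε ^ 2)
      - 4 * ((x * τ) ^ 2 + (y * f) ^ 2 + ε ^ 2 + (σ * G) ^ 2)
      = 4 * (f ^ 2 + τ ^ 2 + G ^ 2 + x ^ 2 * f ^ 2 + x ^ 2 * G ^ 2 + x ^ 2 * ε ^ 2 + y ^ 2 * τ ^ 2
        + y ^ 2 * G ^ 2 + y ^ 2 * ε ^ 2 + σ ^ 2 * f ^ 2 + σ ^ 2 * τ ^ 2 + σ ^ 2 * ε ^ 2) := by ring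
  have : 0 ≤ 4 * (f ^ 2 + τ ^ 2 + G ^ 2 + x ^ 2 * f ^ 2 + x ^ 2 * G ^ 2 + x ^ 2 * ε ^ 2
        + y ^ 2 * τ ^ 2
        + y ^ 2 * G ^ 2 + y ^ 2 * ε ^ 2 + σ ^ 2 * f ^ 2 + σ ^ 2 * τ ^ 2 + σ ^ 2 * ε ^ 2) := by
    positivity
  linarith

theorem lower_order {c σ κ₁ κ₂ K : ℝ} (hc : 0 < c) (hK : 0 ≤ K) : ∃ C > 0,
    ∀ s s₁ s₂ f τ ε G w h ℓ θ : ℝ, 0 ≤ s → 0 ≤ s₂ → s₁ ^ 2 = s * s₂ → 0 ≤ G → 0 ≤ w →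
      h ^ 2 ≤ K * s ^ 2 * (s₁ ^ 2 * (G * w)) → |ℓ| ≤ K * s₁ ^ 2 → |θ| ≤ K * s₁ ^ 2 →
      (τ - f - ε) * h + 1 / 2 * ℓ * (G * w) + σ * (h * G) + κ₁ * (f * h)
        + κ₂ * (τ * h - 1 / 2 * θ * (G * w))
      ≤ c / 2 * s ^ 2 * (f ^ 2 + τ ^ 2 + G ^ 2) + C * (s ^ 2 * ε ^ 2 + (s₂ * w) ^ 2) := by
  set B := 4 * (1 + (1 + κ₂) ^ 2 + (κ₁ - 1) ^ 2 + σ ^ 2) with hB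
  have hB0 : 0 < B := by positivity
  set δ := c / (4 * B) with hδ
  have hδ0 : 0 < δ := by positivity
  have hδB : δ * B = c / 4 := by rw [hδ]; field_simp
  set D := K / (4 * δ) + K / 2 + |κ₂| * K / 2 with hD
  have hD0 : 0 ≤ D := by positivity
  refine ⟨c / 4 + D ^ 2 / c, by positivity, ?_⟩
  intro s s₁ s₂ f τ ε G w h ℓ θ hs hs2 hss hG hw hh hℓ hθ
  set L := (1 + κ₂) * τ + (κ₁ - 1) * f - ε + σ * G with hL
  have hR0 : 0 ≤ (s * G) * (s₂ * w) := by positivity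
  have hR : s₁ ^ 2 * (G * w) = (s * G) * (s₂ * w) := by rw [hss]; ring
  have e0 : (τ - f - ε) * h + 1 / 2 * ℓ * (G * w) + σ * (h * G) + κ₁ * (f * h)
        + κ₂ * (τ * h - 1 / 2 * θ * (G * w))
      = h * L + (1 / 2 * ℓ * (G * w) - κ₂ / 2 * (θ * (G * w))) := by rw [hL]; ring
  have h1 : h * L ≤ δ * (s ^ 2 * L ^ 2) + K / (4 * δ) * ((s * G) * (s₂ * w)) := by
    rw [hR] at hh
    rcases hs.eq_or_lt with h0 | h0
    · have : h = 0 := by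
        rw [← h0] at hh
        have : h ^ 2 ≤ 0 := by simpa using hh
        exact pow_eq_zero_iff (two_ne_zero) |>.1 (le_antisymm this (sq_nonneg _))
      rw [this, ← h0]; simp
    · have hy : h * L ≤ δ * (s ^ 2 * L ^ 2) + h ^ 2 / (4 * δ * s ^ 2) := by
        have : δ * (s ^ 2 * L ^ 2) + h ^ 2 / (4 * δ * s ^ 2) - h * L
            = (2 * δ * s ^ 2 * L - h) ^ 2 / (4 * δ * s ^ 2) := by field_simp; ring
        have h' : 0 ≤ (2 * δ * s ^ 2 * L - h) ^ 2 / (4 * δ * s ^ 2) := by positivity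
        linarith
      have : h ^ 2 / (4 * δ * s ^ 2) ≤ K / (4 * δ) * ((s * G) * (s₂ * w)) := by
        rw [div_le_iff₀ (by positivity)]
        have e : K / (4 * δ) * (s * G * (s₂ * w)) * (4 * δ * s ^ 2)
          = K * s ^ 2 * (s * G * (s₂ * w)) := by field_simp
        linarith
      linarith
  have h2 : L ^ 2 ≤ B * (f ^ 2 + τ ^ 2 + G ^ 2 + ε ^ 2) := sq_comb_le _ _ _ _ _ _ _
  have h2' : δ * (s ^ 2 * L ^ 2) ≤ c / 4 * (s ^ 2 * (f ^ 2 + τ ^ 2 + G ^ 2 + ε ^ 2)) := by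
    have := mul_le_mul_of_nonneg_left h2 (by positivity : 0 ≤ δ * s ^ 2)
    have e : δ * s ^ 2 * (B * (f ^ 2 + τ ^ 2 + G ^ 2 + ε ^ 2))
      = (δ * B) * (s ^ 2 * (f ^ 2 + τ ^ 2 + G ^ 2 + ε ^ 2)) := by ring
    rw [e, hδB] at this
    linarith
  have hGw : 0 ≤ G * w := by positivity
  have h4 : 1 / 2 * ℓ * (G * w) ≤ K / 2 * ((s * G) * (s₂ * w)) := by
    have := mul_le_mul_of_nonneg_right ((le_abs_self ℓ).trans hℓ) hGw
    rw [mul_assoc K, hR] at this; linarith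
  have h5 : -(κ₂ / 2 * (θ * (G * w))) ≤ |κ₂| * K / 2 * ((s * G) * (s₂ * w)) := by
    have h6 : -(κ₂ * θ) ≤ |κ₂| * (K * s₁ ^ 2) := by
      refine (neg_le_abs _).trans ?_
      rw [abs_mul]; exact mul_le_mul_of_nonneg_left hθ (abs_nonneg _)
    have := mul_le_mul_of_nonneg_right h6 hGw
    have e : |κ₂| * (K * s₁ ^ 2) * (G * w) = |κ₂| * K * (s₁ ^ 2 * (G * w)) := by ring
    rw [e, hR] at this; linarith
  have h7 : D * ((s * G) * (s₂ * w)) ≤ c / 4 * (s ^ 2 * G ^ 2) + D ^ 2 / c * (s₂ * w) ^ 2 := by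
    have : c / 4 * (s ^ 2 * G ^ 2) + D ^ 2 / c * (s₂ * w) ^ 2 - D * ((s * G) * (s₂ * w))
        = (c * (s * G) - 2 * D * (s₂ * w)) ^ 2 / (4 * c) := by field_simp; ring
    have h' : 0 ≤ (c * (s * G) - 2 * D * (s₂ * w)) ^ 2 / (4 * c) := by positivity
    linarith
  have h8 : D * ((s * G) * (s₂ * w)) = K / (4 * δ) * ((s * G) * (s₂ * w))
      + K / 2 * ((s * G) * (s₂ * w)) + |κ₂| * K / 2 * ((s * G) * (s₂ * w)) := by rw [hD]; ring
  rw [e0]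
  have p1 : 0 ≤ D ^ 2 / c * (s ^ 2 * ε ^ 2) := by positivity
  have p2 : 0 ≤ c / 4 * (s₂ * w) ^ 2 := by positivity
  have p3 : 0 ≤ c / 4 * (s ^ 2 * f ^ 2) := by positivity
  have p4 : 0 ≤ c / 4 * (s ^ 2 * τ ^ 2) := by positivity
  have e1 : c / 2 * s ^ 2 * (f ^ 2 + τ ^ 2 + G ^ 2)
      + (c / 4 + D ^ 2 / c) * (s ^ 2 * ε ^ 2 + (s₂ * w) ^ 2)
      = c / 4 * (s ^ 2 * (f ^ 2 + τ ^ 2 + G ^ 2 + ε ^ 2)) + c / 4 * (s ^ 2 * G ^ 2)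
        + D ^ 2 / c * (s₂ * w) ^ 2 + D ^ 2 / c * (s ^ 2 * ε ^ 2) + c / 4 * (s₂ * w) ^ 2
        + c / 4 * (s ^ 2 * f ^ 2) + c / 4 * (s ^ 2 * τ ^ 2) := by ring
  rw [e1]
  linarith

theorem exists_young {p : ℝ} (hp : 1 < p) {δ : ℝ} (hδ : 0 < δ) :
    ∃ C > 0, ∀ y : ℝ, 0 ≤ y → y ^ 2 ≤ δ * y ^ (2 * p) + C := by
  set Y := (1 / δ) ^ (1 / (2 * p - 2)) with hY
  have hY0 : 0 < Y := Real.rpow_pos_of_pos (by positivity) _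
  refine ⟨Y ^ 2, by positivity, fun y hy => ?_⟩
  rcases le_total y Y with h | h
  · have := pow_le_pow_left₀ hy h 2
    have h2 : 0 ≤ δ * y ^ (2 * p) := mul_nonneg hδ.le (Real.rpow_nonneg hy _)
    linarith
  · have hy0 : 0 < y := lt_of_lt_of_le hY0 h
    have h1 : 1 / δ ≤ y ^ (2 * p - 2) := by
      have := Real.rpow_le_rpow hY0.le h (by linarith : 0 ≤ 2 * p - 2)
      rwa [hY, ← Real.rpow_mul (by positivity), one_div_mul_cancel (by linarith),
        Real.rpow_one] at this
    have h2 : y ^ (2 * p) = y ^ 2 * y ^ (2 * p - 2) := by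
      rw [← Real.rpow_natCast, ← Real.rpow_add hy0]; congr 1; push_cast; ring
    rw [h2]
    have h3 : 1 ≤ δ * y ^ (2 * p - 2) := by
      rw [div_le_iff₀ hδ] at h1; linarith
    nlinarith [sq_nonneg y, sq_nonneg Y]

section System

variable {m : ℕ} {β : Fin m → Fin m → ℝ} {r : ℝ}

theorem reac_nonneg (hβ : ∀ i j, 0 ≤ β i j) {y : Fin m → ℝ} (hy : ∀ i, 0 ≤ y i) (i : Fin m) :
    0 ≤ reac β r y i :=
  Finset.sum_nonneg fun j _ => mul_nonneg (mul_nonneg (hβ i j) (Real.rpow_nonneg (hy i) _))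
    (Real.rpow_nonneg (hy j) _)

theorem le_reac (hr : 0 < r) (hβ : ∀ i j, 0 ≤ β i j) {y : Fin m → ℝ} (hy : ∀ i, 0 ≤ y i)
    (i : Fin m) : β i i * y i ^ (2 * r + 1) ≤ reac β r y i := by
  have h := Finset.single_le_sum (f := fun j => β i j * y i ^ r * y j ^ (r + 1))
    (fun j _ => mul_nonneg (mul_nonneg (hβ i j) (Real.rpow_nonneg (hy i) _))
    (Real.rpow_nonneg (hy j) _)) (Finset.mem_univ i)
  refine le_trans (le_of_eq ?_) h
  rw [mul_assoc, ← Real.rpow_add' (hy i) (by linarith)]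
  congr 2; ring

/-- The potential of the nonlinearity. -/
noncomputable def pot (β : Fin m → Fin m → ℝ) (r : ℝ) (y : Fin m → ℝ) : ℝ :=
  1 / (2 * (r + 1)) * ∑ i, ∑ j, β i j * (y i ^ (r + 1) * y j ^ (r + 1))

theorem exists_pot_le (hr : 0 < r) (hβ : ∀ i j, 0 ≤ β i j) : ∃ C > 0, ∀ y : Fin m → ℝ,
    (∀ i, 0 ≤ y i) → 0 ≤ pot β r y ∧ pot β r y ≤ C * ∑ i, y i ^ (2 * r + 1) * y i := by
  set b := 1 + ∑ i, ∑ j, β i j with hb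
  have hb1 : ∀ i j, β i j ≤ b := fun i j => by
    have h1 := Finset.single_le_sum (f := fun j => β i j) (fun j _ => hβ i j) (Finset.mem_univ j)
    have h2 := Finset.single_le_sum (f := fun i => ∑ j, β i j)
      (fun i _ => Finset.sum_nonneg fun j _ => hβ i j) (Finset.mem_univ i)
    linarith
  have hb0 : 0 < b := by
    have : 0 ≤ ∑ i, ∑ j, β i j := Finset.sum_nonneg fun i _ => Finset.sum_nonneg fun j _ => hβ i j
    linarith
  refine ⟨1 / (2 * (r + 1)) * (b * (m + 1)), by positivity, fun y hy => ⟨?_, ?_⟩⟩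
  · refine mul_nonneg (by positivity) (Finset.sum_nonneg fun i _ => Finset.sum_nonneg fun j _ => ?_)
    exact mul_nonneg (hβ i j) (mul_nonneg (Real.rpow_nonneg (hy i) _) (Real.rpow_nonneg (hy j) _))
  · have hsq : ∀ i, (y i ^ (r + 1)) ^ 2 = y i ^ (2 * r + 1) * y i := by
      intro i
      rw [← Real.rpow_natCast, ← Real.rpow_mul (hy i), ← Real.rpow_add_one' (hy i) (by linarith)]
      congr 1; push_cast; ring
    unfold pot
    rw [mul_assoc]
    refine mul_le_mul_of_nonneg_left ?_ (by positivity)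
    have h1 : ∀ i j, β i j * (y i ^ (r + 1) * y j ^ (r + 1))
        ≤ b * (1 / 2 * (y i ^ (2 * r + 1) * y i) + 1 / 2 * (y j ^ (2 * r + 1) * y j)) := by
      intro i j
      have ha := Real.rpow_nonneg (hy i) (r + 1)
      have hc := Real.rpow_nonneg (hy j) (r + 1)
      refine mul_le_mul (hb1 i j) ?_ (mul_nonneg ha hc) hb0.le
      rw [← hsq, ← hsq]
      nlinarith [sq_nonneg (y i ^ (r + 1) - y j ^ (r + 1))]
    refine (Finset.sum_le_sum fun i _ => Finset.sum_le_sum fun j _ => h1 i j).trans ?_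
    have hS : 0 ≤ ∑ i, y i ^ (2 * r + 1) * y i :=
      Finset.sum_nonneg fun i _ => mul_nonneg (Real.rpow_nonneg (hy i) _) (hy i)
    obtain ⟨q, hq⟩ : ∃ q : Fin m → ℝ, ∀ i, y i ^ (2 * r + 1) * y i = q i := ⟨_, fun i => rfl⟩
    simp only [hq] at hS ⊢
    simp only [← Finset.mul_sum, Finset.sum_add_distrib, Finset.sum_const, Finset.card_univ,
      Fintype.card_fin, nsmul_eq_mul]
    nlinarith

variable {E : Type*} [NormedAddCommGroup E] [NormedSpace ℝ E]

theorem contDiff_rpow {w : E → ℝ} (hw : ContDiff ℝ ∞ w) (h0 : ∀ z, 0 < w z) (s : ℝ) :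
    ContDiff ℝ ∞ fun z => w z ^ s :=
  hw.rpow_const_of_ne fun z => (h0 z).ne'

theorem contDiff_reac {w : Fin m → E → ℝ} (hw : ∀ i, ContDiff ℝ ∞ (w i)) (h0 : ∀ i z, 0 < w i z)
    (i : Fin m) : ContDiff ℝ ∞ fun z => reac β r (fun k => w k z) i :=
  ContDiff.sum fun j _ => (contDiff_const.mul (contDiff_rpow (hw i) (h0 i) _)).mul
    (contDiff_rpow (hw j) (h0 j) _)

theorem contDiff_pot {w : Fin m → E → ℝ} (hw : ∀ i, ContDiff ℝ ∞ (w i)) (h0 : ∀ i z, 0 < w i z) :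
    ContDiff ℝ ∞ fun z => pot β r (fun k => w k z) :=
  contDiff_const.mul (ContDiff.sum fun i _ => ContDiff.sum fun j _ =>
    contDiff_const.mul ((contDiff_rpow (hw i) (h0 i) _).mul (contDiff_rpow (hw j) (h0 j) _)))

theorem dd_reac {w : Fin m → E → ℝ} (hw : ∀ i, ContDiff ℝ ∞ (w i)) (h0 : ∀ i z, 0 < w i z)
    (i : Fin m) (v z : E) : dd v (fun z => reac β r (fun k => w k z) i) z
      = ∑ j, β i j * (w i z ^ r * w j z ^ r)
        * (r * (w j z / w i z) * dd v (w i) z + (r + 1) * dd v (w j) z) := by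
  unfold reac
  rw [dd_sum _ fun j _ => (contDiff_const.mul (contDiff_rpow (hw i) (h0 i) _)).mul
    (contDiff_rpow (hw j) (h0 j) _)]
  refine Finset.sum_congr rfl fun j _ => ?_
  rw [dd_mul (contDiff_const.mul (contDiff_rpow (hw i) (h0 i) _)) (contDiff_rpow (hw j) (h0 j) _),
    dd_const_mul (contDiff_rpow (hw i) (h0 i) _), dd_rpow (hw i) _ _ _ (h0 i z).ne',
    dd_rpow (hw j) _ _ _ (h0 j z).ne', Real.rpow_sub_one (h0 i z).ne', add_sub_cancel_right,
    Real.rpow_add_one (h0 j z).ne']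
  ring

theorem dd_pot (hr : 0 < r) (hsym : ∀ i j, β i j = β j i) {w : Fin m → E → ℝ}
    (hw : ∀ i, ContDiff ℝ ∞ (w i)) (h0 : ∀ i z, 0 < w i z) (v z : E) :
    dd v (fun z => pot β r (fun k => w k z)) z
      = ∑ i, reac β r (fun k => w k z) i * dd v (w i) z := by
  have hP := fun i => contDiff_rpow (hw i) (h0 i) (r + 1)
  have h1 : dd v (fun z => pot β r (fun k => w k z)) z = 1 / (2 * (r + 1)) * ∑ i, ∑ j, β i j *
      ((r + 1) * (w i z ^ r * dd v (w i) z * w j z ^ (r + 1))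
        + (r + 1) * (w j z ^ r * dd v (w j) z * w i z ^ (r + 1))) := by
    unfold pot
    rw [dd_const_mul (ContDiff.sum fun i _ => ContDiff.sum fun j _ =>
      contDiff_const.mul ((hP i).mul (hP j))), dd_sum _ fun i _ => ContDiff.sum fun j _ =>
      contDiff_const.mul ((hP i).mul (hP j))]
    congr 1
    refine Finset.sum_congr rfl fun i _ => ?_
    rw [dd_sum _ fun j _ => contDiff_const.mul ((hP i).mul (hP j))]
    refine Finset.sum_congr rfl fun j _ => ?_
    rw [dd_const_mul ((hP i).mul (hP j)), dd_mul (hP i) (hP j), dd_rpow (hw i) _ _ _ (h0 i z).ne',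
      dd_rpow (hw j) _ _ _ (h0 j z).ne', add_sub_cancel_right]
    ring
  have h2 : ∑ i, ∑ j, β i j * ((r + 1) * (w j z ^ r * dd v (w j) z * w i z ^ (r + 1)))
      = ∑ i, ∑ j, β i j * ((r + 1) * (w i z ^ r * dd v (w i) z * w j z ^ (r + 1))) := by
    rw [Finset.sum_comm]
    refine Finset.sum_congr rfl fun i _ => Finset.sum_congr rfl fun j _ => ?_
    rw [hsym]
  have h3 : ∀ i j, β i j *
      ((r + 1) * (w i z ^ r * dd v (w i) z * w j z ^ (r + 1))
        + (r + 1) * (w j z ^ r * dd v (w j) z * w i z ^ (r + 1)))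
      = β i j * ((r + 1) * (w i z ^ r * dd v (w i) z * w j z ^ (r + 1)))
        + β i j * ((r + 1) * (w j z ^ r * dd v (w j) z * w i z ^ (r + 1))) := fun i j => by ring
  rw [h1]
  simp only [h3, Finset.sum_add_distrib]
  rw [h2]
  unfold reac
  simp only [Finset.sum_mul]
  rw [← two_mul, ← mul_assoc, Finset.mul_sum]
  refine Finset.sum_congr rfl fun i _ => ?_
  rw [Finset.mul_sum]
  refine Finset.sum_congr rfl fun j _ => ?_
  have : r + 1 ≠ 0 := by linarith
  field_simp

theorem sum_gi_reac_le (hr : 0 < r) (hsym : ∀ i j, β i j = β j i) (hβ : ∀ i j, 0 ≤ β i j)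
    {N : ℕ} (e : Fin N → E) {w : Fin m → E → ℝ}
    (hw : ∀ i, ContDiff ℝ ∞ (w i)) (h0 : ∀ i z, 0 < w i z) (z : E) :
    ∑ i, gi e (fun z => reac β r (fun k => w k z) i) (w i) z
      ≤ ∑ i, (2 * r + 1) * (reac β r (fun k => w k z) i * (gi e (w i) (w i) z / w i z)) := by
  have h1 : ∑ i, gi e (fun z => reac β r (fun k => w k z) i) (w i) z
      = ∑ k, ∑ i, ∑ j, β i j * (w i z ^ r * w j z ^ r) * (r * (w j z / w i z) * dd (e k) (w i) z
        + (r + 1) * dd (e k) (w j) z) * dd (e k) (w i) z := by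
    simp only [gi, dd_reac hw h0, Finset.sum_mul]
    rw [Finset.sum_comm]
  have h2 : ∑ i, (2 * r + 1) * (reac β r (fun k => w k z) i * (gi e (w i) (w i) z / w i z))
      = ∑ k, ∑ i, ∑ j, β i j * (w i z ^ r * w j z ^ r) * ((2 * r + 1) * (w j z / w i z)
          * dd (e k) (w i) z ^ 2) := by
    rw [Finset.sum_comm]
    refine Finset.sum_congr rfl fun i _ => ?_
    rw [gi, reac, Finset.sum_div, Finset.sum_mul_sum, Finset.mul_sum]
    simp only [Finset.mul_sum]
    rw [Finset.sum_comm]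
    refine Finset.sum_congr rfl fun k _ => Finset.sum_congr rfl fun j _ => ?_
    rw [Real.rpow_add_one (h0 j z).ne']
    ring
  rw [h1, h2]
  refine Finset.sum_le_sum fun k _ => ?_
  set A : Fin m → Fin m → ℝ := fun i j => β i j * (w i z ^ r * w j z ^ r) with hA
  have hA0 : ∀ i j, 0 ≤ A i j := fun i j => mul_nonneg (hβ i j)
    (mul_nonneg (Real.rpow_nonneg (h0 i z).le _) (Real.rpow_nonneg (h0 j z).le _))
  have hAs : ∀ i j, A i j = A j i := fun i j => by simp only [hA]; rw [hsym]; ring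
  set p : Fin m → ℝ := fun i => dd (e k) (w i) z
  set y : Fin m → ℝ := fun i => w i z
  have hy : ∀ i, 0 < y i := fun i => h0 i z
  change ∑ i, ∑ j, A i j * (r * (y j / y i) * p i + (r + 1) * p j) * p i
    ≤ ∑ i, ∑ j, A i j * ((2 * r + 1) * (y j / y i) * p i ^ 2)
  rw [← sub_nonneg]
  have h3 : ∑ i, ∑ j, A i j * ((2 * r + 1) * (y j / y i) * p i ^ 2)
      - ∑ i, ∑ j, A i j * (r * (y j / y i) * p i + (r + 1) * p j) * p i
      = (r + 1) * ∑ i, ∑ j, A i j * (y j / y i * p i ^ 2 - p i * p j) := by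
    simp only [Finset.mul_sum, ← Finset.sum_sub_distrib]
    refine Finset.sum_congr rfl fun i _ => Finset.sum_congr rfl fun j _ => ?_
    ring
  have h4 : 2 * ∑ i, ∑ j, A i j * (y j / y i * p i ^ 2 - p i * p j)
      = ∑ i, ∑ j, A i j * (y j / y i * p i ^ 2 + y i / y j * p j ^ 2 - 2 * (p i * p j)) := by
    have h5 : ∑ i, ∑ j, A i j * (y j / y i * p i ^ 2 - p i * p j)
      = ∑ i, ∑ j, A j i * (y i / y j * p j ^ 2 - p j * p i) := Finset.sum_comm
    rw [two_mul]
    nth_rewrite 2 [h5]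
    simp only [← Finset.sum_add_distrib]
    refine Finset.sum_congr rfl fun i _ => Finset.sum_congr rfl fun j _ => ?_
    rw [hAs j i]; ring
  rw [h3]
  refine mul_nonneg (by linarith) ?_
  have h5 : 0 ≤ ∑ i, ∑ j, A i j * (y j / y i * p i ^ 2 + y i / y j * p j ^ 2 - 2 * (p i * p j)) := by
    refine Finset.sum_nonneg fun i _ => Finset.sum_nonneg fun j _ => mul_nonneg (hA0 i j) ?_
    have hi := hy i
    have hj := hy j
    have : y j / y i * p i ^ 2 + y i / y j * p j ^ 2 - 2 * (p i * p j)
        = (y j * p i - y i * p j) ^ 2 / (y i * y j) := by field_simp; ring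
    rw [this]; positivity
  linarith

end System

section System

variable {m : ℕ} {β : Fin m → Fin m → ℝ} {r : ℝ}
variable {E : Type*} [NormedAddCommGroup E] [NormedSpace ℝ E]

theorem dd_pow {f : E → ℝ} (hf : ContDiff ℝ ∞ f) (n : ℕ) (v z : E) :
    dd v (fun z => f z ^ n) z = n * f z ^ (n - 1) * dd v f z :=
  dd_comp hf (h := fun y => y ^ n) v z (hasDerivAt_pow n (f z))

theorem exists_dd_bound {f : E → ℝ} (hf : ContDiff ℝ ∞ f) (hc : HasCompactSupport f) (v : E) :
    ∃ C, 0 ≤ C ∧ ∀ z, |dd v f z| ≤ C := by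
  obtain ⟨C, hC⟩ := (contDiff_dd hf v).continuous.bounded_above_of_compact_support
    (HasCompactSupport.intro hc fun z hz => dd_eq_zero_of_notMem_tsupport hz v)
  exact ⟨C, (norm_nonneg _).trans (hC 0), fun z => hC z⟩

theorem exists_dd_dd_bound {f : E → ℝ} (hf : ContDiff ℝ ∞ f) (hc : HasCompactSupport f) (u v : E) :
    ∃ C, 0 ≤ C ∧ ∀ z, |dd u (dd v f) z| ≤ C := by
  obtain ⟨C, hC⟩ := (contDiff_dd (contDiff_dd hf v) u).continuous.bounded_above_of_compact_support
    (HasCompactSupport.intro hc fun z hz => dd_dd_eq_zero_of_notMem_tsupport hz u v)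
  exact ⟨C, (norm_nonneg _).trans (hC 0), fun z => hC z⟩

theorem exists_cutoff_bounds {N : ℕ} (e : Fin N → E) (d : E) {η : E → ℝ} (hη : ContDiff ℝ ∞ η)
    (hc : HasCompactSupport η) (h0 : ∀ z, 0 ≤ η z) (h1 : ∀ z, η z ≤ 1) (n : ℕ) :
    ∃ K, 0 ≤ K ∧ (∀ (w : E → ℝ) z, gi e (fun z => η z ^ (2 * n + 4)) w z ^ 2
        ≤ K * (η z ^ (n + 2)) ^ 2 * ((η z ^ (n + 1)) ^ 2 * gi e w w z)) ∧
      (∀ z, |La e (fun z => η z ^ (2 * n + 4)) z| ≤ K * (η z ^ (n + 1)) ^ 2) ∧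
      (∀ z, |dd d (fun z => η z ^ (2 * n + 4)) z| ≤ K * (η z ^ (n + 1)) ^ 2) := by
  obtain ⟨A, hA0, hA⟩ := exists_dd_bound hη hc d
  choose B hB0 hB using fun j => exists_dd_bound hη hc (e j)
  choose D hD0 hD using fun j => exists_dd_dd_bound hη hc (e j) (e j)
  have hpow : ∀ z, η z ^ (2 * n + 3) ≤ (η z ^ (n + 1)) ^ 2 := fun z => by
    rw [← pow_mul]; exact pow_le_pow_of_le_one (h0 z) (h1 z) (by omega)
  set M : ℝ := 2 * n + 4 with hM
  have hMc : ((2 * n + 4 : ℕ) : ℝ) = M := by rw [hM]; push_cast; ring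
  set K1 := M ^ 2 * ∑ j, B j ^ 2 with hK1
  set K2 := ∑ j, (M * (M - 1) * B j ^ 2 + M * D j) with hK2
  set K3 := M * A with hK3
  have hM1 : 0 ≤ M - 1 := by rw [hM]; have : (0 : ℝ) ≤ n := Nat.cast_nonneg n; linarith
  have hM0 : 0 ≤ M := by linarith
  have k1 : 0 ≤ K1 := by positivity
  have k2 : 0 ≤ K2 := Finset.sum_nonneg fun j _ => by
    have := hD0 j
    positivity
  have k3 : 0 ≤ K3 := by positivity
  have hd : ∀ v z, dd v (fun z => η z ^ (2 * n + 4)) z = M * η z ^ (2 * n + 3) * dd v η z := by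
    intro v z
    rw [dd_pow hη, hMc]; rfl
  refine ⟨K1 + K2 + K3, by positivity, fun w z => ?_, fun z => ?_, fun z => ?_⟩
  · have e1 : gi e (fun z => η z ^ (2 * n + 4)) w z = M * η z ^ (2 * n + 3) * gi e η w z := by
      simp only [gi, hd, Finset.mul_sum]
      exact Finset.sum_congr rfl fun j _ => by ring
    have e2 : gi e η w z ^ 2 ≤ (∑ j, B j ^ 2) * gi e w w z := by
      have h3 := Finset.sum_mul_sq_le_sq_mul_sq Finset.univ (fun j => dd (e j) η z)
        (fun j => dd (e j) w z)
      have h4 : ∑ j, dd (e j) w z ^ 2 = gi e w w z := by simp only [gi, sq]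
      have h5 : 0 ≤ gi e w w z := by rw [← h4]; positivity
      have h6 : ∑ j, dd (e j) η z ^ 2 ≤ ∑ j, B j ^ 2 := Finset.sum_le_sum fun j _ => by
        rw [← sq_abs]; exact pow_le_pow_left₀ (abs_nonneg _) (hB j z) 2
      rw [h4] at h3
      exact h3.trans (mul_le_mul_of_nonneg_right h6 h5)
    have h5 : 0 ≤ gi e w w z := by
      have h4 : ∑ j, dd (e j) w z ^ 2 = gi e w w z := by simp only [gi, sq]
      rw [← h4]; positivity
    have h7 : (η z ^ (2 * n + 3)) ^ 2 = (η z ^ (n + 2)) ^ 2 * (η z ^ (n + 1)) ^ 2 := by ring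
    rw [e1, mul_pow, mul_pow, h7]
    have h8 := mul_le_mul_of_nonneg_left e2
      (by positivity : 0 ≤ M ^ 2 * ((η z ^ (n + 2)) ^ 2 * (η z ^ (n + 1)) ^ 2))
    have h9 : 0 ≤ (K2 + K3) * ((η z ^ (n + 2)) ^ 2 * ((η z ^ (n + 1)) ^ 2 * gi e w w z)) := by
      positivity
    refine h8.trans ?_
    rw [← sub_nonneg]
    refine h9.trans (le_of_eq ?_)
    rw [hK1]; ring
  · have e1 : ∀ j, dd (e j) (dd (e j) fun z => η z ^ (2 * n + 4)) z
        = M * (M - 1) * η z ^ (2 * n + 2) * dd (e j) η z ^ 2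
          + M * η z ^ (2 * n + 3) * dd (e j) (dd (e j) η) z := by
      intro j
      have : (dd (e j) fun z => η z ^ (2 * n + 4)) = fun z => M * (η z ^ (2 * n + 3) * dd (e j) η z) := by
        ext y; rw [hd]; ring
      rw [this, dd_const_mul ((hη.pow _).mul (contDiff_dd hη _)), dd_mul (hη.pow _) (contDiff_dd hη _),
        dd_pow hη]
      have : ((2 * n + 3 : ℕ) : ℝ) = M - 1 := by rw [hM]; push_cast; ring
      rw [this]
      have : 2 * n + 3 - 1 = 2 * n + 2 := by omega
      rw [this]; ring
    have e2 : ∀ j, |dd (e j) (dd (e j) fun z => η z ^ (2 * n + 4)) z|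
        ≤ (M * (M - 1) * B j ^ 2 + M * D j) * (η z ^ (n + 1)) ^ 2 := by
      intro j
      rw [e1]
      have a1 : dd (e j) η z ^ 2 ≤ B j ^ 2 := by
        rw [← sq_abs]; exact pow_le_pow_left₀ (abs_nonneg _) (hB j z) 2
      have a2 : η z ^ (2 * n + 2) = (η z ^ (n + 1)) ^ 2 := by ring
      have a3 : 0 ≤ η z ^ (2 * n + 3) := pow_nonneg (h0 z) _
      refine (abs_add_le _ _).trans ?_
      rw [abs_of_nonneg (mul_nonneg (mul_nonneg (mul_nonneg hM0 hM1) (pow_nonneg (h0 z) _))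
        (sq_nonneg _)), abs_mul, abs_of_nonneg (mul_nonneg hM0 a3),
        add_mul (M * (M - 1) * B j ^ 2), a2]
      apply add_le_add
      · have := mul_le_mul_of_nonneg_left a1
          (by positivity : 0 ≤ M * (M - 1) * (η z ^ (n + 1)) ^ 2)
        linarith
      · rw [mul_assoc, mul_assoc]
        refine mul_le_mul_of_nonneg_left ?_ hM0
        rw [mul_comm (D j)]
        exact mul_le_mul (hpow z) (hD j z) (abs_nonneg _) (by positivity)
    unfold La
    have h3 := Finset.sum_le_sum fun j (_ : j ∈ Finset.univ) => e2 j
    rw [← Finset.sum_mul, ← hK2] at h3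
    refine (Finset.abs_sum_le_sum_abs _ _).trans (h3.trans ?_)
    exact mul_le_mul_of_nonneg_right (by linarith) (by positivity)
  · rw [hd, abs_mul, abs_of_nonneg (mul_nonneg hM0 (pow_nonneg (h0 z) _)), mul_assoc]
    have := mul_le_mul_of_nonneg_left (mul_le_mul (hpow z) (hA z) (abs_nonneg _) (by positivity)) hM0
    refine this.trans ?_
    have : 0 ≤ (K1 + K2) * (η z ^ (n + 1)) ^ 2 := by positivity
    rw [hK3]
    linarith

/-- The pointwise inequality behind the integral estimate. -/
theorem exists_pointwise {p c C₁ C₂ D b₀ : ℝ} (hp : 1 < p) (hc : 0 < c) (hb₀ : 0 < b₀)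
    (hC₂ : 0 ≤ C₂) :
    ∃ c' > 0, ∃ C' > 0, ∀ (n : ℕ) (η f τ ε G w : ℝ), 0 ≤ η → η ≤ 1 → 1 ≤ n → (n : ℝ) + 2 ≤ n * p →
      0 ≤ w → b₀ * w ^ p ≤ f →
      -c / 2 * (η ^ (n + 2)) ^ 2 * (f ^ 2 + τ ^ 2 + G ^ 2) + C₁ * ((η ^ (n + 2)) ^ 2 * ε ^ 2)
        + C₂ * (η ^ n * w) ^ 2 + D * ((η ^ (n + 1)) ^ 2 * (w ^ p * w))
      ≤ -c' * (η ^ (2 * n + 4) * w ^ (2 * p)) + C₁ * (η ^ (2 * n + 4) * ε ^ 2) + C' := by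
  set δ := c * b₀ ^ 2 / 8 with hδ
  have hδ0 : 0 < δ := by positivity
  set C₃ := C₂ + D ^ 2 / δ + 1 with hC3
  have hC30 : 0 < C₃ := by positivity
  obtain ⟨Y, hY0, hY⟩ := exists_young hp (δ := δ / C₃) (by positivity)
  refine ⟨δ, hδ0, C₃ * Y, by positivity, ?_⟩
  intro n η f τ ε G w h0 h1 hn hnp hw hf
  have hwp : 0 ≤ w ^ p := Real.rpow_nonneg hw _
  have hw2 : w ^ (2 * p) = (w ^ p) ^ 2 := by
    rw [← Real.rpow_natCast, ← Real.rpow_mul hw]; congr 1; push_cast; ring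
  have e1 : η ^ (2 * n + 4) = (η ^ (n + 2)) ^ 2 := by ring
  have hf2 : b₀ ^ 2 * (w ^ p) ^ 2 ≤ f ^ 2 := by
    rw [← mul_pow]; exact pow_le_pow_left₀ (by positivity) hf 2
  have h2 : D * ((η ^ (n + 1)) ^ 2 * (w ^ p * w))
      ≤ δ * ((η ^ (n + 2)) ^ 2 * (w ^ p) ^ 2) + D ^ 2 / δ * (η ^ n * w) ^ 2 := by
    have e2 : D * ((η ^ (n + 1)) ^ 2 * (w ^ p * w))
      = D * ((η ^ (n + 2) * w ^ p) * (η ^ n * w)) := by ring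
    rw [e2]
    have : δ * ((η ^ (n + 2)) ^ 2 * (w ^ p) ^ 2) + D ^ 2 / δ * (η ^ n * w) ^ 2
        - D * ((η ^ (n + 2) * w ^ p) * (η ^ n * w))
        = (δ * (η ^ (n + 2) * w ^ p) - D * (η ^ n * w) / 2) ^ 2 / δ
          + 3 / 4 * (D ^ 2 / δ * (η ^ n * w) ^ 2) := by field_simp; ring
    have h' : 0 ≤ (δ * (η ^ (n + 2) * w ^ p) - D * (η ^ n * w) / 2) ^ 2 / δ
          + 3 / 4 * (D ^ 2 / δ * (η ^ n * w) ^ 2) := by positivity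
    linarith
  have h3 : C₃ * (η ^ n * w) ^ 2 ≤ δ * ((η ^ (n + 2)) ^ 2 * (w ^ p) ^ 2) + C₃ * Y := by
    have := mul_le_mul_of_nonneg_left (hY (η ^ n * w) (by positivity)) hC30.le
    have e3 : C₃ * (δ / C₃ * (η ^ n * w) ^ (2 * p) + Y) = δ * (η ^ n * w) ^ (2 * p) + C₃ * Y := by
      field_simp
    rw [e3] at this
    have h4 : (η ^ n * w) ^ (2 * p) ≤ (η ^ (n + 2)) ^ 2 * (w ^ p) ^ 2 := by
      rw [Real.mul_rpow (by positivity) hw, ← hw2, ← pow_mul]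
      refine mul_le_mul_of_nonneg_right ?_ (Real.rpow_nonneg hw _)
      rw [← Real.rpow_natCast η n, ← Real.rpow_mul h0, ← Real.rpow_natCast]
      rcases h0.eq_or_lt with h | h
      · rw [← h, Real.zero_rpow, Real.zero_rpow]
        · have : (0 : ℝ) < ((n + 2) * 2 : ℕ) := by positivity
          exact this.ne'
        · have : (0 : ℝ) < n := by exact_mod_cast hn
          positivity
      · refine Real.rpow_le_rpow_of_exponent_ge h h1 ?_
        push_cast; linarith
    have := mul_le_mul_of_nonneg_left h4 hδ0.le
    linarith
  have h5 : c / 2 * ((η ^ (n + 2)) ^ 2 * (b₀ ^ 2 * (w ^ p) ^ 2))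
      ≤ c / 2 * ((η ^ (n + 2)) ^ 2 * (f ^ 2 + τ ^ 2 + G ^ 2)) := by
    refine mul_le_mul_of_nonneg_left (mul_le_mul_of_nonneg_left ?_ (by positivity)) (by positivity)
    linarith [sq_nonneg τ, sq_nonneg G]
  have h6 : c / 2 * ((η ^ (n + 2)) ^ 2 * (b₀ ^ 2 * (w ^ p) ^ 2))
    = 4 * (δ * ((η ^ (n + 2)) ^ 2 * (w ^ p) ^ 2)) := by rw [hδ]; ring
  have h7 : C₃ * (η ^ n * w) ^ 2 = C₂ * (η ^ n * w) ^ 2 + D ^ 2 / δ * (η ^ n * w) ^ 2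
    + (η ^ n * w) ^ 2 := by rw [hC3]; ring
  have h8 : 0 ≤ (η ^ n * w) ^ 2 := sq_nonneg _
  have h9 : 0 ≤ δ * ((η ^ (n + 2)) ^ 2 * (w ^ p) ^ 2) := by positivity
  rw [e1, hw2]
  linarith

variable [MeasurableSpace E] [BorelSpace E]
  [FiniteDimensional ℝ E] {μ : Measure E} [μ.IsAddHaarMeasure]

theorem system_estimate {N : ℕ} (hN : 1 ≤ N) (hr : 0 < r) (hsym : ∀ i j, β i j = β j i)
    (hβ : ∀ i j, 0 ≤ β i j) (hdiag : ∀ i, 0 < β i i)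
    (hpB : N = 1 ∨ (2 ≤ N ∧ 2 * r + 1 < ((N : ℝ) * (N + 2)) / ((N : ℝ) - 1) ^ 2))
    (e : Fin N → E) (d : E) {η : E → ℝ} (hη : ContDiff ℝ ∞ η)
    (hcs : HasCompactSupport η) (h0 : ∀ z, 0 ≤ η z) (h1 : ∀ z, η z ≤ 1) :
    ∃ n : ℕ, ∃ C > 0, ∀ w : Fin m → E → ℝ, (∀ i, ContDiff ℝ ∞ (w i)) → (∀ i z, 0 < w i z) →
      ∫ z, η z ^ (2 * n + 4) * ∑ i, w i z ^ (2 * (2 * r + 1)) ∂μ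
        ≤ C + C * ∫ z, η z ^ (2 * n + 4) * ∑ i, (dd d (w i) z - La e (w i) z
          - reac β r (fun k => w k z) i) ^ 2 ∂μ := by
  set p := 2 * r + 1 with hp
  have hp1 : 1 < p := by linarith
  obtain ⟨σ, hσ, hα, hAp⟩ := exists_sigma hN hp1 hpB
  have hA : 0 ≤ 1 - 1 / (N : ℝ) := by
    have : (1 : ℝ) ≤ N := by exact_mod_cast hN
    rw [sub_nonneg, div_le_one (by linarith)]; exact this
  obtain ⟨κ₁, κ₂, κ₃, c, C₁, hκ₁, hc, hC₁, hquad⟩ := exists_coeffs hA hα (by linarith : 0 < p) hAp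
  obtain ⟨n, hn1, hnp⟩ : ∃ n : ℕ, 1 ≤ n ∧ (n : ℝ) + 2 ≤ n * p := by
    obtain ⟨n, hn⟩ := exists_nat_ge (2 / (p - 1))
    rw [div_le_iff₀ (by linarith)] at hn
    refine ⟨n + 1, by omega, ?_⟩
    push_cast; nlinarith
  obtain ⟨K, hK, hK1, hK2, hK3⟩ := exists_cutoff_bounds e d hη hcs h0 h1 n
  obtain ⟨C₂, hC₂, hlow⟩ := lower_order (σ := σ) (κ₁ := κ₁) (κ₂ := κ₂) hc hK
  obtain ⟨CF, hCF, hF⟩ := exists_pot_le (m := m) hr hβ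
  obtain ⟨b₀, hb₀, hbb⟩ : ∃ b₀ : ℝ, 0 < b₀ ∧ ∀ i, b₀ ≤ β i i := by
    rcases isEmpty_or_nonempty (Fin m) with h | h
    · exact ⟨1, one_pos, fun i => h.elim i⟩
    · obtain ⟨i, hi⟩ := Finite.exists_min fun i => β i i
      exact ⟨β i i, hdiag i, hi⟩
  obtain ⟨c', hc', C', hC', hpt⟩ := exists_pointwise (p := p) (c := c) (C₁ := C₁ + C₂) (C₂ := C₂)
    (D := |κ₃| * K * CF) hp1 hc hb₀ hC₂.le
  set V := μ.real (tsupport η) with hV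
  have hV0 : 0 ≤ V := measureReal_nonneg
  refine ⟨n, (C' * m * V + C₁ + C₂) / c', by positivity, fun w hw hw0 => ?_⟩
  set φ : E → ℝ := fun z => η z ^ (2 * n + 4) with hφd
  have hφ : ContDiff ℝ ∞ φ := hη.pow _
  have hcφ : HasCompactSupport φ := HasCompactSupport.intro hcs fun z hz => by
    simp [hφd, image_eq_zero_of_notMem_tsupport hz]
  have hφ0 : ∀ z, 0 ≤ φ z := fun z => pow_nonneg (h0 z) _
  set f : Fin m → E → ℝ := fun i z => reac β r (fun k => w k z) i with hfd
  have hf : ∀ i, ContDiff ℝ ∞ (f i) := fun i => contDiff_reac hw hw0 i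
  set F : E → ℝ := fun z => pot β r (fun k => w k z) with hFd
  have hFs : ContDiff ℝ ∞ F := contDiff_pot hw hw0
  have hzφ : ∀ (w : E → ℝ), ∀ z ∉ tsupport φ, gi e φ w z = 0 := fun w z hz => by
    simp [gi, dd_eq_zero_of_notMem_tsupport hz]
  have hzL : ∀ z ∉ tsupport φ, La e φ z = 0 := fun z hz => by
    simp [La, dd_dd_eq_zero_of_notMem_tsupport hz]
  have hG : ∀ i, ContDiff ℝ ∞ (gi e (w i) (w i)) := fun i => contDiff_gi e (hw i) (hw i)
  have hQ : ∀ i, ContDiff ℝ ∞ fun z => gi e (w i) (w i) z / w i z := fun i =>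
    (hG i).div (hw i) fun z => (hw0 i z).ne'
  have hh : ∀ i, ContDiff ℝ ∞ (gi e φ (w i)) := fun i => contDiff_gi e hφ (hw i)
  have hL : ∀ i, ContDiff ℝ ∞ (La e (w i)) := fun i => contDiff_La e (hw i)
  have hLφ := contDiff_La e hφ
  have hτ : ∀ i, ContDiff ℝ ∞ (dd d (w i)) := fun i => contDiff_dd (hw i) d
  set B : Fin m → E → ℝ := fun i z => φ z * ((1 - 1 / N) * La e (w i) z ^ 2
        + σ * ((N + 2) / N) * (La e (w i) z * (gi e (w i) (w i) z / w i z))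
        - (σ - σ ^ 2 * (1 - 1 / N)) * (gi e (w i) (w i) z / w i z) ^ 2)
        + La e (w i) z * gi e φ (w i) z
      + 1 / 2 * La e φ z * gi e (w i) (w i) z
      + σ * (gi e φ (w i) z * (gi e (w i) (w i) z / w i z)) with hB
  set P : Fin m → E → ℝ := fun i z => f i z * gi e φ (w i) z + φ z * gi e (f i) (w i) z
      + φ z * f i z * La e (w i) z with hP
  set T : Fin m → E → ℝ := fun i z => dd d (w i) z * gi e φ (w i) z
      + φ z * dd d (w i) z * La e (w i) z - 1 / 2 * dd d φ z * gi e (w i) (w i) z with hT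
  set Q : E → ℝ := fun z => dd d (fun z => φ z * F z) z with hQd
  have iB : ∀ i, Integrable (B i) μ := fun i => by
    refine integrable_of_tsupport hcφ ?_ fun z hz => ?_
    · exact ((((hφ.mul (((contDiff_const.mul ((hL i).pow 2)).add (contDiff_const.mul
        ((hL i).mul (hQ i)))).sub (contDiff_const.mul ((hQ i).pow 2))))).add ((hL i).mul (hh i))).add
        ((contDiff_const.mul hLφ).mul (hG i))).add (contDiff_const.mul ((hh i).mul (hQ i)))
        |>.continuous
    · simp only [hB]
      rw [image_eq_zero_of_notMem_tsupport hz, hzφ _ z hz, hzL z hz]; ring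
  have iP : ∀ i, Integrable (P i) μ := fun i => by
    refine integrable_of_tsupport hcφ ?_ fun z hz => ?_
    · exact ((((hf i).mul (hh i)).add (hφ.mul (contDiff_gi e (hf i) (hw i)))).add
        ((hφ.mul (hf i)).mul (hL i))).continuous
    · simp only [hP]
      rw [image_eq_zero_of_notMem_tsupport hz, hzφ _ z hz]; ring
  have iT : ∀ i, Integrable (T i) μ := fun i => by
    refine integrable_of_tsupport hcφ ?_ fun z hz => ?_
    · exact ((((hτ i).mul (hh i)).add ((hφ.mul (hτ i)).mul (hL i))).sub
        ((contDiff_const.mul (contDiff_dd hφ d)).mul (hG i))).continuous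
    · simp only [hT]
      rw [image_eq_zero_of_notMem_tsupport hz, hzφ _ z hz, dd_eq_zero_of_notMem_tsupport hz]; ring
  have iQ : Integrable Q μ := integrable_of_tsupport (φ := fun z => φ z * F z) hcφ.mul_right
      (contDiff_dd (hφ.mul hFs) d).continuous fun z hz => dd_eq_zero_of_notMem_tsupport hz d
  have iall : ∀ i, Integrable (fun z => B i z + κ₁ * P i z + κ₂ * T i z) μ := fun i =>
    ((iB i).add ((iP i).const_mul _)).add ((iT i).const_mul _)
  have iS : Integrable (fun z => ∑ i, (B i z + κ₁ * P i z + κ₂ * T i z)) μ :=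
    integrable_finsetSum _ fun i _ => iall i
  have hpos : 0 ≤ ∫ z, (∑ i, (B i z + κ₁ * P i z + κ₂ * T i z) + κ₃ * Q z) ∂μ := by
    rw [integral_add iS (iQ.const_mul _), integral_finsetSum _ fun i _ => iall i,
      integral_const_mul, integral_dd_eq_zero (hφ.mul hFs) hcφ.mul_right d, mul_zero, add_zero]
    refine Finset.sum_nonneg fun i _ => ?_
    rw [integral_add (f := fun z => B i z + κ₁ * P i z) ((iB i).add ((iP i).const_mul _))
        ((iT i).const_mul _),
      integral_add (iB i) ((iP i).const_mul _), integral_const_mul, integral_const_mul,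
      integral_flux e hφ hcφ (hf i) (hw i), integral_time e d hφ hcφ (hw i), mul_zero, mul_zero,
      add_zero, add_zero]
    exact bernstein_integral hN e hφ hcφ hφ0 (hw i) (hw0 i) σ
  set W : E → ℝ := fun z => φ z * ∑ i, w i z ^ (2 * p) with hWd
  set ER : E → ℝ := fun z => φ z * ∑ i, (dd d (w i) z - La e (w i) z - f i z) ^ 2 with hER
  have iW : Integrable W μ := by
    refine integrable_of_tsupport hcφ ?_ fun z hz => ?_
    · exact (hφ.mul (ContDiff.sum fun i _ => contDiff_rpow (hw i) (hw0 i) _)).continuous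
    · simp only [hWd]
      rw [image_eq_zero_of_notMem_tsupport hz, zero_mul]
  have iER : Integrable ER μ := by
    refine integrable_of_tsupport hcφ ?_ fun z hz => ?_
    · exact (hφ.mul (ContDiff.sum fun i _ =>
        ((((hτ i).sub (hL i)).sub (hf i)).pow 2))).continuous
    · simp only [hER]
      rw [image_eq_zero_of_notMem_tsupport hz, zero_mul]
  have hcomp : IsCompact (tsupport η) := hcs
  have iI : Integrable ((tsupport η).indicator fun _ => C' * m) μ :=
    (integrable_indicator_iff (isClosed_tsupport η).measurableSet).2
      (integrableOn_const hcomp.measure_lt_top.ne)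
  have hkey : ∀ z, ∑ i, (B i z + κ₁ * P i z + κ₂ * T i z) + κ₃ * Q z
      ≤ -c' * W z + (C₁ + C₂) * ER z + (tsupport η).indicator (fun _ => C' * m) z := by
    intro z
    by_cases hz : z ∈ tsupport η
    · have hQz : Q z = dd d φ z * F z + φ z * ∑ i, f i z * dd d (w i) z := by
        simp only [hQd]
        rw [dd_mul hφ hFs, dd_pot hr hsym hw hw0]
      have hgrad := mul_le_mul_of_nonneg_left (sum_gi_reac_le hr hsym hβ e hw hw0 z)
        (mul_nonneg hκ₁ (hφ0 z))
      have hpotz := hF (fun k => w k z) fun i => (hw0 i z).le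
      have hφs : φ z = (η z ^ (n + 2)) ^ 2 := by simp only [hφd]; ring
      have h4 : κ₃ * (dd d φ z * F z)
          ≤ ∑ i, |κ₃| * K * CF * ((η z ^ (n + 1)) ^ 2 * (w i z ^ p * w i z)) := by
        have h5 : κ₃ * dd d φ z ≤ |κ₃| * (K * (η z ^ (n + 1)) ^ 2) := by
          refine (le_abs_self _).trans ?_
          rw [abs_mul]; exact mul_le_mul_of_nonneg_left (hK3 z) (abs_nonneg _)
        rw [← mul_assoc]
        refine (mul_le_mul h5 hpotz.2 hpotz.1 (by positivity)).trans (le_of_eq ?_)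
        rw [← Finset.mul_sum, ← Finset.mul_sum]; ring
      have hi : ∀ i, (B i z + κ₁ * P i z + κ₂ * T i z) + κ₃ * (φ z * (f i z * dd d (w i) z))
          - κ₁ * φ z * gi e (f i) (w i) z
          + κ₁ * φ z * (p * (f i z * (gi e (w i) (w i) z / w i z)))
          + |κ₃| * K * CF * ((η z ^ (n + 1)) ^ 2 * (w i z ^ p * w i z))
          ≤ -c' * (φ z * w i z ^ (2 * p))
            + (C₁ + C₂) * (φ z * (dd d (w i) z - La e (w i) z - f i z) ^ 2) + C' := by
        intro i
        have hw' := hw0 i z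
        have hg0 : 0 ≤ gi e (w i) (w i) z := Finset.sum_nonneg fun j _ => mul_self_nonneg _
        have hf0 : 0 ≤ f i z := reac_nonneg hβ (fun k => (hw0 k z).le) i
        have hfb : b₀ * w i z ^ p ≤ f i z :=
          (mul_le_mul_of_nonneg_right (hbb i) (Real.rpow_nonneg hw'.le _)).trans
            (le_reac hr hβ (fun k => (hw0 k z).le) i)
        have q1 := hK1 (w i) z
        have q2 := hK2 z
        have q3 := hK3 z
        set ε := dd d (w i) z - La e (w i) z - f i z with hε
        have ha : La e (w i) z = dd d (w i) z - f i z - ε := by rw [hε]; ring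
        set G := gi e (w i) (w i) z / w i z with hGd
        have hGw : gi e (w i) (w i) z = G * w i z := by rw [hGd]; field_simp
        have hG0 : 0 ≤ G := by positivity
        rw [hGw] at q1
        have l1 := hlow (η z ^ (n + 2)) (η z ^ (n + 1)) (η z ^ n) (f i z) (dd d (w i) z) ε G (w i z)
          (gi e φ (w i) z) (La e φ z) (dd d φ z) (pow_nonneg (h0 z) _) (pow_nonneg (h0 z) _)
          (by ring) hG0 hw'.le q1 q2 q3
        have l2 := mul_le_mul_of_nonneg_left (hquad (f i z) (dd d (w i) z) ε G hf0 hG0) (hφ0 z)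
        have l3 := hpt n (η z) (f i z) (dd d (w i) z) ε G (w i z) (h0 z) (h1 z) hn1 hnp hw'.le hfb
        have hφ2 : η z ^ (2 * n + 4) = φ z := rfl
        rw [hφ2] at l3
        simp only [hB, hP, hT]
        rw [← hGd, hGw, ha]
        rw [hφs] at l2 l3 ⊢
        linarith
      have hsum := Finset.sum_le_sum fun i (_ : i ∈ Finset.univ) => hi i
      simp only [Finset.sum_add_distrib, Finset.sum_sub_distrib, ← Finset.mul_sum] at hsum hgrad h4 ⊢
      rw [hQz, indicator_of_mem hz]
      simp only [Finset.sum_const, Finset.card_univ, Fintype.card_fin, nsmul_eq_mul] at hsum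
      simp only [hWd, hER]
      have e5 : ∑ i, gi e (f i) (w i) z
        = ∑ i, gi e (fun z => reac β r (fun k => w k z) i) (w i) z := rfl
      have e6 : ∀ i, reac β r (fun k => w k z) i = f i z := fun i => rfl
      simp only [e6] at hgrad
      linarith
    · have hz' : z ∉ tsupport φ := fun h => hz (closure_mono (fun y hy => by
        intro h'; exact hy (by simp [hφd, h'])) h)
      have hη0 := image_eq_zero_of_notMem_tsupport hz
      have hφ0 := image_eq_zero_of_notMem_tsupport hz'
      rw [indicator_of_notMem hz]
      simp only [hB, hP, hT, hQd, hWd, hER]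
      rw [dd_mul hφ hFs, dd_eq_zero_of_notMem_tsupport hz', hφ0, hzL z hz']
      simp [hzφ _ z hz']
  have hfin := hpos.trans (integral_mono (iS.add (iQ.const_mul _))
    (((iW.const_mul (-c')).add (iER.const_mul (C₁ + C₂))).add iI) hkey)
  rw [integral_add' ((iW.const_mul (-c')).add (iER.const_mul (C₁ + C₂))) iI,
    integral_add' (iW.const_mul (-c')) (iER.const_mul (C₁ + C₂)), integral_const_mul,
    integral_const_mul, integral_indicator_const _ (isClosed_tsupport η).measurableSet,
    smul_eq_mul, ← hV] at hfin
  have hER0 : 0 ≤ ∫ z, ER z ∂μ := integral_nonneg fun z =>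
    mul_nonneg (hφ0 z) (Finset.sum_nonneg fun i _ => sq_nonneg _)
  change ∫ z, W z ∂μ ≤ _ + _ * ∫ z, ER z ∂μ
  rw [div_mul_eq_mul_div, ← add_div, le_div_iff₀ hc']
  have h9 : 0 ≤ C' * m * V * ∫ z, ER z ∂μ := by positivity
  nlinarith

end System

open scoped Convolution

section Mollifier

variable {E : Type*} [NormedAddCommGroup E] [NormedSpace ℝ E] [MeasurableSpace E] [BorelSpace E]
  [FiniteDimensional ℝ E]

/-- Convolution of a locally integrable function with a kernel. -/
noncomputable def mol (μ : Measure E) (ρ g : E → ℝ) (z : E) : ℝ := ∫ ζ, ρ (z - ζ) * g ζ ∂μ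

variable {μ : Measure E} [μ.IsAddHaarMeasure]

theorem mol_eq_convolution (ρ g : E → ℝ) :
    mol μ ρ g = (ρ ⋆[ContinuousLinearMap.lsmul ℝ ℝ, μ] g) := by
  ext z
  rw [convolution_lsmul_swap]
  rfl

theorem contDiff_mol {ρ g : E → ℝ} (hρ : ContDiff ℝ ∞ ρ) (hc : HasCompactSupport ρ)
    (hg : LocallyIntegrable g μ) : ContDiff ℝ ∞ (mol μ ρ g) := by
  rw [mol_eq_convolution]
  exact hc.contDiff_convolution_left _ hρ hg

theorem integrable_mol {ρ g : E → ℝ} (hρ : Continuous ρ) (hc : HasCompactSupport ρ)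
    (hg : LocallyIntegrable g μ) (z : E) : Integrable (fun ζ => ρ (z - ζ) * g ζ) μ := by
  have := (hc.convolutionExists_left (ContinuousLinearMap.lsmul ℝ ℝ) hρ hg z).integrable_swap
  simpa [ContinuousLinearMap.flip_apply] using this

theorem hasCompactSupport_dd {ρ : E → ℝ} (hc : HasCompactSupport ρ) (v : E) :
    HasCompactSupport (dd v ρ) :=
  HasCompactSupport.intro hc fun _ hz => dd_eq_zero_of_notMem_tsupport hz v

theorem dd_mol {ρ g : E → ℝ} (hρ : ContDiff ℝ ∞ ρ) (hc : HasCompactSupport ρ)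
    (hg : LocallyIntegrable g μ) (v z : E) : dd v (mol μ ρ g) z = mol μ (dd v ρ) g z := by
  have h := (hc.hasFDerivAt_convolution_left (ContinuousLinearMap.lsmul ℝ ℝ)
    (hρ.of_le (by norm_cast)) hg z).fderiv
  rw [mol_eq_convolution]
  unfold dd
  rw [h, convolution_eq_swap, ContinuousLinearMap.integral_apply]
  · rfl
  · exact ((hc.fderiv ℝ).convolutionExists_left _
      (hρ.continuous_fderiv (by simp)) hg z).integrable_swap

theorem La_mol {N : ℕ} (e : Fin N → E) {ρ g : E → ℝ} (hρ : ContDiff ℝ ∞ ρ)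
    (hc : HasCompactSupport ρ) (hg : LocallyIntegrable g μ) (z : E) :
    La e (mol μ ρ g) z = mol μ (La e ρ) g z := by
  have h1 : ∀ j, dd (e j) (mol μ ρ g) = mol μ (dd (e j) ρ) g := fun j =>
    funext fun z => dd_mol hρ hc hg _ z
  have h2 : mol μ (La e ρ) g z = ∑ j, ∫ ζ, dd (e j) (dd (e j) ρ) (z - ζ) * g ζ ∂μ := by
    rw [← integral_finsetSum]
    · simp only [mol, La, Finset.sum_mul]
    · intro j _
      exact integrable_mol (contDiff_dd (contDiff_dd hρ _) _).continuous
        (hasCompactSupport_dd (hasCompactSupport_dd hc _) _) hg z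
  rw [h2]
  unfold La
  refine Finset.sum_congr rfl fun j _ => ?_
  rw [h1, dd_mol (contDiff_dd hρ _) (hasCompactSupport_dd hc _) hg]
  rfl

theorem mol_nonneg {ρ g : E → ℝ} (hρ : ∀ z, 0 ≤ ρ z) (hg : ∀ z, 0 ≤ g z) (z : E) :
    0 ≤ mol μ ρ g z := integral_nonneg fun _ => mul_nonneg (hρ _) (hg _)

theorem mol_le {ρ g : E → ℝ} {M : ℝ} (hρ0 : ∀ z, 0 ≤ ρ z) (hρ : Continuous ρ)
    (hc : HasCompactSupport ρ) (hg : LocallyIntegrable g μ) (h1 : ∫ z, ρ z ∂μ = 1)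
    (hgM : ∀ z, g z ≤ M) (z : E) : mol μ ρ g z ≤ M := by
  have h2 : ∫ ζ, ρ (z - ζ) * M ∂μ = M := by
    rw [integral_mul_const, integral_sub_left_eq_self ρ μ z, h1, one_mul]
  rw [← h2]
  refine integral_mono (integrable_mol hρ hc hg z)
    (integrable_mol hρ hc (locallyIntegrable_const M) z) fun ζ =>
    mul_le_mul_of_nonneg_left (hgM _) (hρ0 _)

end Mollifier

section Distribution

variable {N : ℕ}

instance instHaarProd (N : ℕ) : Measure.IsAddHaarMeasure (volume : Measure (Eu N × ℝ)) :=
  inferInstanceAs (Measure.IsAddHaarMeasure ((volume : Measure (Eu N)).prod (volume : Measure ℝ)))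

/-- The spatial coordinate directions in space-time. -/
noncomputable def spaceDir (j : Fin N) : Eu N × ℝ := (EuclideanSpace.single j 1, 0)

/-- The time direction in space-time. -/
def timeDir (N : ℕ) : Eu N × ℝ := (0, 1)

theorem pd_slice {Ψ : Eu N × ℝ → ℝ} (hΨ : ContDiff ℝ ∞ Ψ) (j : Fin N) (x : Eu N) (t : ℝ) :
    pd j (fun y => Ψ (y, t)) x = dd (spaceDir j) Ψ (x, t) := by
  have h := HasFDerivAt.comp (g := Ψ) (f := fun y : Eu N => (y, t)) x
    (diff_smooth hΨ (x, t)).hasFDerivAt (hasFDerivAt_prodMk_left (𝕜 := ℝ) x t)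
  have h' : HasFDerivAt (fun y => Ψ (y, t)) _ x := h
  rw [pd, h'.fderiv]
  rfl

theorem lap_slice {Ψ : Eu N × ℝ → ℝ} (hΨ : ContDiff ℝ ∞ Ψ) (x : Eu N) (t : ℝ) :
    lap (fun y => Ψ (y, t)) x = La spaceDir Ψ (x, t) := by
  have h1 : ContDiff ℝ 2 fun y : Eu N => Ψ (y, t) :=
    (hΨ.comp (contDiff_id.prodMk contDiff_const)).of_le (by norm_cast)
  rw [lap_eq h1]
  unfold La
  refine Finset.sum_congr rfl fun j _ => ?_
  have h2 : pd j (fun y => Ψ (y, t)) = fun y => dd (spaceDir j) Ψ (y, t) :=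
    funext fun y => pd_slice hΨ j y t
  rw [h2, pd_slice (contDiff_dd hΨ _)]

theorem hasDerivAt_slice {Ψ : Eu N × ℝ → ℝ} (hΨ : ContDiff ℝ ∞ Ψ) (x : Eu N) (t : ℝ) :
    HasDerivAt (fun s => Ψ (x, s)) (dd (timeDir N) Ψ (x, t)) t := by
  have h := HasFDerivAt.comp (g := Ψ) (f := fun s : ℝ => (x, s)) t
    (diff_smooth hΨ (x, t)).hasFDerivAt (hasFDerivAt_prodMk_right (𝕜 := ℝ) x t)
  have h' : HasFDerivAt (fun s => Ψ (x, s)) _ t := h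
  refine h'.hasDerivAt.congr_deriv ?_
  rfl

theorem measurable_of_separately {f : Eu N → ℝ → ℝ} (h1 : ∀ t, Continuous fun x => f x t)
    (h2 : ∀ x, Continuous (f x)) : Measurable fun P : Eu N × ℝ => f P.1 P.2 :=
  measurable_uncurry_of_continuous_of_measurable h1 fun x => (h2 x).measurable

/-- The one-sided weak inequality integrated over space-time. -/
theorem weak_le {v H : Eu N → ℝ → ℝ} (hv : SepReg v) (hH1 : ∀ t, Continuous fun x => H x t)
    (hH2 : ∀ x, Continuous (H x)) {M : ℝ}
    (hFD : ∀ x ∈ ball (0 : Eu N) 4, ∀ t ∈ Ioo (-4 : ℝ) 4, FD (fun x t => - v x t) x t)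
    (hb : ∀ x ∈ ball (0 : Eu N) 4, ∀ t ∈ Ioo (-4 : ℝ) 4, |v x t| ≤ M ∧ |H x t| ≤ M)
    (hh : ∀ x ∈ ball (0 : Eu N) 4, ∀ t ∈ Ioo (-4 : ℝ) 4, heat v x t ≤ H x t)
    {Ψ : Eu N × ℝ → ℝ} (hΨ : ContDiff ℝ ∞ Ψ) (h0 : ∀ z, 0 ≤ Ψ z)
    (hs : ∀ z ∉ ball (0 : Eu N × ℝ) 3, Ψ z = 0) :
    0 ≤ ∫ z, ((dd (timeDir N) Ψ z + La spaceDir Ψ z) * v z.1 z.2 + Ψ z * H z.1 z.2) := by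
  set D : Eu N × ℝ → ℝ := fun z => dd (timeDir N) Ψ z + La spaceDir Ψ z with hD
  have hDc : Continuous D := ((contDiff_dd hΨ _).add (contDiff_La _ hΨ)).continuous
  have hts : tsupport Ψ ⊆ closedBall 0 3 := closure_minimal (fun z hz => by
    by_contra h
    exact hz (hs z fun h' => h (ball_subset_closedBall h'))) isClosed_closedBall
  have hcs : HasCompactSupport Ψ := (isCompact_closedBall _ _).of_isClosed_subset
    (isClosed_tsupport _) hts
  have hDcs : HasCompactSupport D := by
    refine HasCompactSupport.intro hcs fun z hz => ?_
    simp only [hD, La]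
    rw [dd_eq_zero_of_notMem_tsupport hz]
    simp [dd_dd_eq_zero_of_notMem_tsupport hz]
  have hDz : ∀ z ∉ tsupport Ψ, D z = 0 := fun z hz => by
    simp only [hD, La]
    rw [dd_eq_zero_of_notMem_tsupport hz]
    simp [dd_dd_eq_zero_of_notMem_tsupport hz]
  have hmem : ∀ x t, (x, t) ∈ tsupport Ψ → x ∈ closedBall (0 : Eu N) 3 ∧ t ∈ Icc (-3 : ℝ) 3 := by
    intro x t h
    have := hts h
    rw [← Prod.mk_zero_zero, ← closedBall_prod_same] at this
    refine ⟨this.1, ?_⟩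
    have := this.2
    rw [Real.closedBall_eq_Icc] at this
    simpa using this
  obtain ⟨P, hP⟩ := hΨ.continuous.bounded_above_of_compact_support hcs
  obtain ⟨Q, hQ⟩ := hDc.bounded_above_of_compact_support hDcs
  obtain ⟨L, hL⟩ := (contDiff_dd hΨ (timeDir N)).continuous.bounded_above_of_compact_support
    (hasCompactSupport_dd hcs _)
  set F : Eu N × ℝ → ℝ := fun z => D z * v z.1 z.2 + Ψ z * H z.1 z.2 with hF
  have hFm : Measurable F := (hDc.measurable.mul (measurable_of_separately
    (fun t => (hv.space t).continuous) fun x => (hv.time x).continuous)).add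
    (hΨ.continuous.measurable.mul (measurable_of_separately hH1 hH2))
  have hF0 : ∀ z ∉ tsupport Ψ, F z = 0 := fun z hz => by
    simp only [hF]; rw [hDz z hz, image_eq_zero_of_notMem_tsupport hz]; ring
  have hM0 : 0 ≤ M := (abs_nonneg _).trans (hb 0 (by simp) 0 (by simp)).1
  have hP0 : 0 ≤ P := (norm_nonneg _).trans (hP 0)
  have hQ0 : 0 ≤ Q := (norm_nonneg _).trans (hQ 0)
  have hFb : ∀ x t, |F (x, t)| ≤ (closedBall (0 : Eu N) 3).indicator (fun _ => Q * M + P * M) x := by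
    intro x t
    by_cases hz : (x, t) ∈ tsupport Ψ
    · obtain ⟨hx, ht⟩ := hmem x t hz
      rw [indicator_of_mem hx]
      obtain ⟨q1, q2⟩ := hb x (closedBall_subset_ball (by norm_num) hx) t
        ⟨by linarith [ht.1], by linarith [ht.2]⟩
      simp only [hF]
      refine (abs_add_le _ _).trans (add_le_add ?_ ?_)
      · rw [abs_mul]; exact mul_le_mul (hQ _) q1 (abs_nonneg _) hQ0
      · rw [abs_mul]; exact mul_le_mul (hP _) q2 (abs_nonneg _) hP0
    · rw [hF0 _ hz, abs_zero]
      exact indicator_nonneg (fun _ _ => by positivity) _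
  have hbi : Integrable ((closedBall (0 : Eu N) 3).indicator (fun _ => Q * M + P * M)) volume :=
    (integrable_indicator_iff measurableSet_closedBall).2
      (integrableOn_const (measure_closedBall_lt_top.ne))
  have hFi : Integrable F := by
    have h1 : Integrable ((tsupport Ψ).indicator fun _ => Q * M + P * M) (volume : Measure (Eu N × ℝ)) :=
      (integrable_indicator_iff (isClosed_tsupport _).measurableSet).2
      (integrableOn_const hcs.measure_lt_top.ne)
    refine h1.mono' hFm.aestronglyMeasurable (Eventually.of_forall fun z => ?_)
    by_cases hz : z ∈ tsupport Ψ
    · rw [indicator_of_mem hz]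
      have := hFb z.1 z.2
      rw [indicator_of_mem (hmem z.1 z.2 hz).1] at this
      exact this
    · rw [indicator_of_notMem hz, hF0 z hz]; simp
  set q : ℝ → ℝ := fun t => ∫ x, F (x, t) with hq
  have hqc : Continuous q := by
    refine continuous_of_dominated (bound := (closedBall (0 : Eu N) 3).indicator
      (fun _ => Q * M + P * M)) (fun t => ?_) (fun t => Eventually.of_forall fun x => hFb x t) hbi
      (Eventually.of_forall fun x => ?_)
    · exact (hFm.comp measurable_prodMk_right).aestronglyMeasurable
    · have c1 : Continuous fun t : ℝ => (x, t) := by fun_prop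
      exact ((hDc.comp c1).mul (hv.time x).continuous).add ((hΨ.continuous.comp c1).mul (hH2 x))
  have hw := weak_upper hv (isCompact_closedBall (0 : Eu N) 3) (a := -3) (b := 3) (by norm_num) hH1
    (fun t ht x hx => hFD x (closedBall_subset_ball (by norm_num) hx) t
      ⟨by linarith [ht.1], by linarith [ht.2]⟩) (M := M) (L := L) (P := P)
    (fun x hx t ht => (hb x (closedBall_subset_ball (by norm_num) hx) t
      ⟨by linarith [ht.1], by linarith [ht.2]⟩).1)
    (fun x hx t ht => hh x (closedBall_subset_ball (by norm_num) hx) t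
      ⟨by linarith [ht.1], by linarith [ht.2]⟩)
    (Ψ := fun x t => Ψ (x, t)) (Ψt := fun x t => dd (timeDir N) Ψ (x, t))
    (fun t _ => (hΨ.comp (contDiff_id.prodMk contDiff_const)).of_le (by norm_cast))
    (fun t _ => (contDiff_dd hΨ _).continuous.comp (by fun_prop))
    (fun x hx t _ => image_eq_zero_of_notMem_tsupport fun h => hx (hmem x t h).1)
    (fun x hx t _ => dd_eq_zero_of_notMem_tsupport (fun h => hx (hmem x t h).1) _)
    (fun x t _ => hasDerivAt_slice hΨ x t) (fun x t _ => h0 _)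
    (fun x t _ => (le_abs_self _).trans (hP _)) (fun x t _ => hL _)
    (B := fun t => ∫ τ in (-3)..t, q τ) (B' := q)
    (fun t _ => (intervalIntegral.integral_hasDerivAt_right (hqc.intervalIntegrable _ _)
      (hqc.stronglyMeasurableAtFilter _ _) hqc.continuousAt).continuousAt.continuousWithinAt)
    (fun t _ => intervalIntegral.integral_hasDerivAt_right (hqc.intervalIntegrable _ _)
      (hqc.stronglyMeasurableAtFilter _ _) hqc.continuousAt)
    (fun t _ => le_of_eq (by
      simp only [hq, hF, hD]
      refine integral_congr_ae (Eventually.of_forall fun x => ?_)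
      beta_reduce
      rw [lap_slice hΨ]))
  have z1 : ∀ x : Eu N, Ψ (x, 3) = 0 := fun x => hs _ fun h => by
    rw [← Prod.mk_zero_zero, ← ball_prod_same] at h
    have := h.2; simp at this
  have z2 : ∀ x : Eu N, Ψ (x, -3) = 0 := fun x => hs _ fun h => by
    rw [← Prod.mk_zero_zero, ← ball_prod_same] at h
    have := h.2; simp at this
  simp only [z1, z2, zero_mul, integral_zero, sub_zero, intervalIntegral.integral_same] at hw
  have hfub : ∫ z, F z = ∫ t, q t := integral_prod_symm F hFi
  change 0 ≤ ∫ z, F z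
  rw [hfub]
  have hq0 : ∀ t ∉ Icc (-3 : ℝ) 3, q t = 0 := by
    intro t ht
    have : ∀ x, F (x, t) = 0 := by
      intro x
      exact hF0 _ fun h' => ht (hmem x t h').2
    simp [hq, this]
  have hset : ∫ t, q t = ∫ t in Icc (-3 : ℝ) 3, q t :=
    (setIntegral_eq_integral_of_forall_compl_eq_zero hq0).symm
  rw [hset, integral_Icc_eq_integral_Ioc, ← intervalIntegral.integral_of_le (by norm_num)]
  exact hw

end Distribution

section Mollified

variable {N : ℕ}

theorem weak_eq {v H : Eu N → ℝ → ℝ} (hv : SepReg v) (hH1 : ∀ t, Continuous fun x => H x t)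
    (hH2 : ∀ x, Continuous (H x)) {M : ℝ}
    (hb : ∀ x ∈ ball (0 : Eu N) 4, ∀ t ∈ Ioo (-4 : ℝ) 4, 0 ≤ v x t ∧ v x t ≤ M ∧ 0 ≤ H x t ∧ H x t ≤ M)
    (hh : ∀ x ∈ ball (0 : Eu N) 4, ∀ t ∈ Ioo (-4 : ℝ) 4, heat v x t = H x t)
    {Ψ : Eu N × ℝ → ℝ} (hΨ : ContDiff ℝ ∞ Ψ) (h0 : ∀ z, 0 ≤ Ψ z)
    (hs : ∀ z ∉ ball (0 : Eu N × ℝ) 3, Ψ z = 0) :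
    ∫ z, ((dd (timeDir N) Ψ z + La spaceDir Ψ z) * v z.1 z.2 + Ψ z * H z.1 z.2) = 0 := by
  have hM0 : 0 ≤ M := (hb 0 (by simp) 0 (by simp)).1.trans (hb 0 (by simp) 0 (by simp)).2.1
  have hW : IsOpen (ball (0 : Eu N) 4 ×ˢ Ioo (-4 : ℝ) 4) := isOpen_ball.prod isOpen_Ioo
  have h1 := weak_le hv hH1 hH2 (M := M)
    (fun x hx t ht => FD_neg hv hW (U := M) hM0 (fun P hP => (hb P.1 hP.1 P.2 hP.2).2.1)
      (fun P hP => by rw [hh P.1 hP.1 P.2 hP.2]; exact (hb P.1 hP.1 P.2 hP.2).2.2.2) (x, t) ⟨hx, ht⟩)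
    (fun x hx t ht => by
      obtain ⟨a, b, c, d⟩ := hb x hx t ht
      exact ⟨by rwa [abs_of_nonneg a], by rwa [abs_of_nonneg c]⟩)
    (fun x hx t ht => (hh x hx t ht).le) hΨ h0 hs
  have h2 := weak_le (v := fun x t => - v x t) (H := fun x t => - H x t) hv.neg
    (fun t => (hH1 t).neg) (fun x => (hH2 x).neg) (M := M)
    (fun x hx t ht => by
      simp only [neg_neg]
      exact forward_domination hv hW (C₀ := 0) le_rfl (fun P hP => (hb P.1 hP.1 P.2 hP.2).1)
        (fun P hP => by rw [hh P.1 hP.1 P.2 hP.2, neg_zero]; exact (hb P.1 hP.1 P.2 hP.2).2.2.1)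
        (x, t) ⟨hx, ht⟩)
    (fun x hx t ht => by
      obtain ⟨a, b, c, d⟩ := hb x hx t ht
      rw [abs_neg, abs_neg]
      exact ⟨by rwa [abs_of_nonneg a], by rwa [abs_of_nonneg c]⟩)
    (fun x hx t ht => by rw [heat_neg hv, hh x hx t ht]) hΨ h0 hs
  have h3 : ∫ z, ((dd (timeDir N) Ψ z + La spaceDir Ψ z) * - v z.1 z.2 + Ψ z * - H z.1 z.2)
      = - ∫ z, ((dd (timeDir N) Ψ z + La spaceDir Ψ z) * v z.1 z.2 + Ψ z * H z.1 z.2) := by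
    rw [← integral_neg]
    refine integral_congr_ae (Eventually.of_forall fun z => ?_)
    beta_reduce; ring
  rw [h3] at h2
  linarith

theorem dd_reflect {E : Type*} [NormedAddCommGroup E] [NormedSpace ℝ E] {ρ : E → ℝ}
    (hρ : ContDiff ℝ ∞ ρ) (z v ζ : E) :
    dd v (fun ζ => ρ (z - ζ)) ζ = - dd v ρ (z - ζ) := by
  have h := HasFDerivAt.comp (g := ρ) (f := fun ζ => z - ζ) ζ
    (diff_smooth hρ (z - ζ)).hasFDerivAt ((hasFDerivAt_id ζ).const_sub z)
  have h' : HasFDerivAt (fun ζ => ρ (z - ζ)) _ ζ := h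
  simp only [dd]
  rw [h'.fderiv]
  simp

theorem La_reflect {E : Type*} [NormedAddCommGroup E] [NormedSpace ℝ E] {ρ : E → ℝ}
    (hρ : ContDiff ℝ ∞ ρ) (e : Fin N → E) (z ζ : E) :
    La e (fun ζ => ρ (z - ζ)) ζ = La e ρ (z - ζ) := by
  unfold La
  refine Finset.sum_congr rfl fun j _ => ?_
  have h1 : dd (e j) (fun ζ => ρ (z - ζ)) = fun ζ => (-1) * dd (e j) ρ (z - ζ) :=
    funext fun ζ => by rw [dd_reflect hρ]; ring
  have h2 : ContDiff ℝ ∞ fun ζ => dd (e j) ρ (z - ζ) :=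
    (contDiff_dd hρ _).comp (contDiff_const.sub contDiff_id)
  rw [h1, dd_const_mul h2, dd_reflect (contDiff_dd hρ _)]
  ring

/-- The mollification of a truncated solution solves the mollified equation. -/
theorem mollified_pde {v H : Eu N → ℝ → ℝ} (hv : SepReg v)
    (hH1 : ∀ t, Continuous fun x => H x t) (hH2 : ∀ x, Continuous (H x)) {M : ℝ}
    (hb : ∀ x ∈ ball (0 : Eu N) 4, ∀ t ∈ Ioo (-4 : ℝ) 4, 0 ≤ v x t ∧ v x t ≤ M ∧ 0 ≤ H x t ∧ H x t ≤ M)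
    (hh : ∀ x ∈ ball (0 : Eu N) 4, ∀ t ∈ Ioo (-4 : ℝ) 4, heat v x t = H x t)
    {ρ : Eu N × ℝ → ℝ} (hρ : ContDiff ℝ ∞ ρ) (h0 : ∀ z, 0 ≤ ρ z)
    (hs : ∀ z ∉ ball (0 : Eu N × ℝ) 1, ρ z = 0) {z : Eu N × ℝ} (hz : z ∈ ball (0 : Eu N × ℝ) 2)
    {g G : Eu N × ℝ → ℝ} (hg : LocallyIntegrable g) (hG : LocallyIntegrable G)
    (hgv : ∀ z ∈ ball (0 : Eu N × ℝ) 4, g z = v z.1 z.2)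
    (hGH : ∀ z ∈ ball (0 : Eu N × ℝ) 4, G z = H z.1 z.2) :
    dd (timeDir N) (mol volume ρ g) z - La spaceDir (mol volume ρ g) z = mol volume ρ G z := by
  have hts : tsupport ρ ⊆ closedBall 0 1 := closure_minimal (fun z hz => by
    by_contra h
    exact hz (hs z fun h' => h (ball_subset_closedBall h'))) isClosed_closedBall
  have hcs : HasCompactSupport ρ := (isCompact_closedBall _ _).of_isClosed_subset
    (isClosed_tsupport _) hts
  rw [mem_ball_zero_iff] at hz
  have hΨ : ContDiff ℝ ∞ fun ζ => ρ (z - ζ) := hρ.comp (contDiff_const.sub contDiff_id)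
  have hΨs : ∀ ζ ∉ ball (0 : Eu N × ℝ) 3, ρ (z - ζ) = 0 := by
    intro ζ hζ
    refine hs _ fun h => hζ ?_
    rw [mem_ball_zero_iff] at h ⊢
    have : ζ = z - (z - ζ) := by abel
    rw [this]
    exact (norm_sub_le _ _).trans_lt (by linarith)
  have key := weak_eq hv hH1 hH2 hb hh hΨ (fun ζ => h0 _) hΨs
  have i1 := integrable_mol (contDiff_dd hρ (timeDir N)).continuous (hasCompactSupport_dd hcs _) hg z
  have hLc : HasCompactSupport (La spaceDir ρ) := HasCompactSupport.intro hcs fun y hy => by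
    simp [La, dd_dd_eq_zero_of_notMem_tsupport hy]
  have i2 := integrable_mol (contDiff_La spaceDir hρ).continuous hLc hg z
  have i3 := integrable_mol hρ.continuous hcs hG z
  rw [dd_mol hρ hcs hg, La_mol _ hρ hcs hg]
  have e1 : ∫ ζ, ((dd (timeDir N) (fun ζ => ρ (z - ζ)) ζ + La spaceDir (fun ζ => ρ (z - ζ)) ζ) * v ζ.1 ζ.2
      + ρ (z - ζ) * H ζ.1 ζ.2)
      = ∫ ζ, (La spaceDir ρ (z - ζ) * g ζ - dd (timeDir N) ρ (z - ζ) * g ζ + ρ (z - ζ) * G ζ) := by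
    refine integral_congr_ae (Eventually.of_forall fun ζ => ?_)
    beta_reduce
    rw [dd_reflect hρ, La_reflect hρ]
    by_cases hζ : ζ ∈ ball (0 : Eu N × ℝ) 4
    · rw [hgv ζ hζ, hGH ζ hζ]; ring
    · have : z - ζ ∉ tsupport ρ := fun h => by
        have h := hts h
        rw [mem_closedBall_zero_iff] at h
        apply hζ
        rw [mem_ball_zero_iff]
        have : ζ = z - (z - ζ) := by abel
        rw [this]
        exact (norm_sub_le _ _).trans_lt (by linarith)
      have hL : La spaceDir ρ (z - ζ) = 0 := by simp [La, dd_dd_eq_zero_of_notMem_tsupport this]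
      rw [dd_eq_zero_of_notMem_tsupport this, image_eq_zero_of_notMem_tsupport this, hL]; ring
  rw [e1, integral_add (f := fun ζ => La spaceDir ρ (z - ζ) * g ζ - dd (timeDir N) ρ (z - ζ) * g ζ)
    (i2.sub i1) i3, integral_sub i2 i1] at key
  unfold mol
  linarith

end Mollified

section BoxEstimate

variable {m N : ℕ} {β : Fin m → Fin m → ℝ} {r : ℝ}

/-- Nonnegative separately regular solutions of the system. -/
structure IsSol (β : Fin m → Fin m → ℝ) (r : ℝ) (u : Fin m → Eu N → ℝ → ℝ) : Prop where
  reg : ∀ i, SepReg (u i)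
  nonneg : ∀ i x t, 0 ≤ u i x t
  pde : ∀ i x t, heat (u i) x t = reac β r (fun k => u k x t) i

theorem reac_le (hr : 0 < r) (hβ : ∀ i j, 0 ≤ β i j) {y : Fin m → ℝ} {M : ℝ} (hy : ∀ i, 0 ≤ y i)
    (hM : ∀ i, y i ≤ M) (i : Fin m) : reac β r y i ≤ reac β r (fun _ => M) i := by
  refine Finset.sum_le_sum fun j _ => ?_
  have hM0 : 0 ≤ M := (hy i).trans (hM i)
  exact mul_le_mul (mul_le_mul_of_nonneg_left (Real.rpow_le_rpow (hy i) (hM i) hr.le) (hβ i j))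
    (Real.rpow_le_rpow (hy j) (hM j) (by linarith)) (Real.rpow_nonneg (hy j) _)
    (mul_nonneg (hβ i j) (Real.rpow_nonneg hM0 _))

theorem continuous_reac {X : Type*} [TopologicalSpace X] (hr : 0 < r) {w : Fin m → X → ℝ}
    (hw : ∀ i, Continuous (w i)) (i : Fin m) : Continuous fun x => reac β r (fun k => w k x) i := by
  refine continuous_finsetSum _ fun j _ => ?_
  exact (continuous_const.mul ((hw i).rpow_const fun _ => Or.inr hr.le)).mul
    ((hw j).rpow_const fun _ => Or.inr (by linarith))

theorem tendsto_reac (hr : 0 < r) {w : ℕ → Fin m → ℝ} {y : Fin m → ℝ}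
    (hw : ∀ i, Tendsto (fun k => w k i) atTop (𝓝 (y i))) (i : Fin m) :
    Tendsto (fun k => reac β r (w k) i) atTop (𝓝 (reac β r y i)) := by
  have h : Continuous fun y : Fin m → ℝ => reac β r y i :=
    continuous_reac (w := fun k (y : Fin m → ℝ) => y k) hr (fun k => continuous_apply k) i
  exact (h.tendsto y).comp (tendsto_pi_nhds.2 hw)

/-- The integral estimate on a unit box for solutions bounded on a larger box, with a constant
independent of the bound. -/
theorem box_estimate (hN : 1 ≤ N) (hr : 0 < r) (hsym : ∀ i j, β i j = β j i)
    (hβ : ∀ i j, 0 ≤ β i j) (hdiag : ∀ i, 0 < β i i)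
    (hpB : N = 1 ∨ (2 ≤ N ∧ 2 * r + 1 < ((N : ℝ) * (N + 2)) / ((N : ℝ) - 1) ^ 2)) :
    ∃ C > 0, ∀ u : Fin m → Eu N → ℝ → ℝ, IsSol β r u →
      (∃ M, ∀ i, ∀ x ∈ ball (0 : Eu N) 4, ∀ t ∈ Ioo (-4 : ℝ) 4, u i x t ≤ M) →
      ∫ z in closedBall (0 : Eu N × ℝ) 1, ∑ i, u i z.1 z.2 ^ (2 * (2 * r + 1)) ≤ C := by
  set η : ContDiffBump (0 : Eu N × ℝ) := ⟨1, 2, by norm_num, by norm_num⟩ with hη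
  obtain ⟨n, C, hC, hest⟩ := system_estimate (μ := (volume : Measure (Eu N × ℝ))) hN hr hsym hβ hdiag hpB
    spaceDir (timeDir N) (η := η) η.contDiff η.hasCompactSupport (fun z => η.nonneg) (fun z => η.le_one)
  refine ⟨C, hC, fun u hu ⟨M₀, hM₀⟩ => ?_⟩
  set M := max M₀ 0 with hM
  have hM0 : 0 ≤ M := le_max_right _ _
  have hV : ∀ z ∈ ball (0 : Eu N × ℝ) 4, z.1 ∈ ball (0 : Eu N) 4 ∧ z.2 ∈ Ioo (-4 : ℝ) 4 := by
    rintro ⟨x, t⟩ hz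
    rw [← Prod.mk_zero_zero, ← ball_prod_same] at hz
    refine ⟨hz.1, ?_⟩
    have := hz.2
    rw [Real.ball_eq_Ioo] at this
    simpa using this
  have huM : ∀ i, ∀ x ∈ ball (0 : Eu N) 4, ∀ t ∈ Ioo (-4 : ℝ) 4, u i x t ≤ M := fun i x hx t ht =>
    (hM₀ i x hx t ht).trans (le_max_left _ _)
  set R := ∑ i, reac β r (fun _ => M) i with hR
  have hR1 : ∀ i, reac β r (fun _ => M) i ≤ R := fun i =>
    Finset.single_le_sum (f := fun i => reac β r (fun _ => M) i)
      (fun i _ => reac_nonneg hβ (fun _ => hM0) i) (Finset.mem_univ i)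
  have hR0 : 0 ≤ R := Finset.sum_nonneg fun i _ => reac_nonneg hβ (fun _ => hM0) i
  set f : Fin m → Eu N → ℝ → ℝ := fun i x t => reac β r (fun k => u k x t) i with hf
  have hf1 : ∀ i t, Continuous fun x => f i x t := fun i t =>
    continuous_reac hr (fun k => ((hu.reg k).space t).continuous) i
  have hf2 : ∀ i x, Continuous (f i x) := fun i x =>
    continuous_reac hr (fun k => ((hu.reg k).time x).continuous) i
  set g : Fin m → Eu N × ℝ → ℝ := fun i => (ball (0 : Eu N × ℝ) 4).indicator fun z => u i z.1 z.2 with hg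
  set G : Fin m → Eu N × ℝ → ℝ := fun i => (ball (0 : Eu N × ℝ) 4).indicator fun z => f i z.1 z.2 with hG
  have hgm : ∀ i, Measurable (g i) := fun i => (measurable_of_separately
    (fun t => ((hu.reg i).space t).continuous) (fun x => ((hu.reg i).time x).continuous)).indicator
    measurableSet_ball
  have hGm : ∀ i, Measurable (G i) := fun i => (measurable_of_separately (hf1 i) (hf2 i)).indicator
    measurableSet_ball
  have hg0 : ∀ i z, 0 ≤ g i z := fun i z => indicator_nonneg (fun z _ => hu.nonneg i _ _) z
  have hgM : ∀ i z, g i z ≤ M := fun i z => by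
    by_cases hz : z ∈ ball (0 : Eu N × ℝ) 4
    · simp only [hg]; rw [indicator_of_mem hz]; exact huM i _ (hV z hz).1 _ (hV z hz).2
    · simp only [hg]; rw [indicator_of_notMem hz]; exact hM0
  have hG0 : ∀ i z, 0 ≤ G i z := fun i z => indicator_nonneg (fun z _ =>
    reac_nonneg hβ (fun k => hu.nonneg k _ _) i) z
  have hfR : ∀ i, ∀ x ∈ ball (0 : Eu N) 4, ∀ t ∈ Ioo (-4 : ℝ) 4, f i x t ≤ R := fun i x hx t ht =>
    (reac_le hr hβ (fun k => hu.nonneg k _ _) (fun k => huM k x hx t ht) i).trans (hR1 i)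
  have hGR : ∀ i z, G i z ≤ R := fun i z => by
    by_cases hz : z ∈ ball (0 : Eu N × ℝ) 4
    · simp only [hG]; rw [indicator_of_mem hz]; exact hfR i _ (hV z hz).1 _ (hV z hz).2
    · simp only [hG]; rw [indicator_of_notMem hz]; exact hR0
  have hgl : ∀ i, LocallyIntegrable (g i) := fun i =>
    (locallyIntegrable_const M).mono (hgm i).aestronglyMeasurable (Eventually.of_forall fun z => by
      rw [Real.norm_of_nonneg (hg0 i z), Real.norm_of_nonneg hM0]; exact hgM i z)
  have hGl : ∀ i, LocallyIntegrable (G i) := fun i =>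
    (locallyIntegrable_const R).mono (hGm i).aestronglyMeasurable (Eventually.of_forall fun z => by
      rw [Real.norm_of_nonneg (hG0 i z), Real.norm_of_nonneg hR0]; exact hGR i z)
  set φ : ℕ → ContDiffBump (0 : Eu N × ℝ) := fun k => ⟨1 / (2 * ((k : ℝ) + 1)), 1 / ((k : ℝ) + 1),
    by positivity, by
      have h : (0 : ℝ) < (k : ℝ) + 1 := by positivity
      exact one_div_lt_one_div_of_lt h (by linarith)⟩ with hφ
  have hφr : ∀ k, (φ k).rOut = 1 / ((k : ℝ) + 1) := fun k => rfl
  set ρ : ℕ → Eu N × ℝ → ℝ := fun k => (φ k).normed volume with hρ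
  have hρs : ∀ k, ContDiff ℝ ∞ (ρ k) := fun k => (φ k).contDiff_normed
  have hρ0 : ∀ k z, 0 ≤ ρ k z := fun k z => (φ k).nonneg_normed z
  have hρc : ∀ k, HasCompactSupport (ρ k) := fun k => (φ k).hasCompactSupport_normed
  have hρ1 : ∀ k, ∫ z, ρ k z = 1 := fun k => (φ k).integral_normed
  have hρz : ∀ k, ∀ z ∉ ball (0 : Eu N × ℝ) 1, ρ k z = 0 := by
    intro k z hz
    by_contra h
    have h' : z ∈ Function.support ((φ k).normed volume) := h
    rw [(φ k).support_normed_eq, hφr] at h'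
    refine hz (ball_subset_ball ?_ h')
    rw [div_le_one (by positivity)]
    have : (0 : ℝ) ≤ k := Nat.cast_nonneg k
    linarith
  set w : ℕ → Fin m → Eu N × ℝ → ℝ := fun k i z => mol volume (ρ k) (g i) z + 1 / ((k : ℝ) + 1) with hw
  have hk1 : ∀ k : ℕ, 0 < 1 / ((k : ℝ) + 1) := fun k => by positivity
  have hk2 : ∀ k : ℕ, 1 / ((k : ℝ) + 1) ≤ 1 := fun k => by
    rw [div_le_one (by positivity)]
    have : (0 : ℝ) ≤ k := Nat.cast_nonneg k
    linarith
  have hms : ∀ k i, ContDiff ℝ ∞ (mol volume (ρ k) (g i)) := fun k i =>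
    contDiff_mol (hρs k) (hρc k) (hgl i)
  have hws : ∀ k i, ContDiff ℝ ∞ (w k i) := fun k i => (hms k i).add contDiff_const
  have hm0 : ∀ k i z, 0 ≤ mol volume (ρ k) (g i) z := fun k i z => mol_nonneg (hρ0 k) (hg0 i) z
  have hw0 : ∀ k i z, 0 < w k i z := fun k i z => add_pos_of_nonneg_of_pos (hm0 k i z) (hk1 k)
  have hwM : ∀ k i z, w k i z ≤ M + 1 := fun k i z =>
    add_le_add (mol_le (hρ0 k) (hρs k).continuous (hρc k) (hgl i) (hρ1 k) (hgM i) z) (hk2 k)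
  have hpde : ∀ k i, ∀ z ∈ ball (0 : Eu N × ℝ) 2,
      dd (timeDir N) (w k i) z - La spaceDir (w k i) z = mol volume (ρ k) (G i) z := by
    intro k i z hz
    have hdd : ∀ v, dd v (w k i) = dd v (mol volume (ρ k) (g i)) := fun v => funext fun z => by
      simp only [hw]
      rw [dd_add (hms k i) contDiff_const]
      simp [dd]
    have hLa : La spaceDir (w k i) z = La spaceDir (mol volume (ρ k) (g i)) z := by
      simp only [La, hdd]
    rw [hdd, hLa]
    refine mollified_pde (hu.reg i) (hf1 i) (hf2 i) (M := max M R) (fun x hx t ht => ⟨hu.nonneg i x t,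
      (huM i x hx t ht).trans (le_max_left _ _), reac_nonneg hβ (fun k => hu.nonneg k _ _) i,
      (hfR i x hx t ht).trans (le_max_right _ _)⟩) (fun x hx t ht => hu.pde i x t) (hρs k) (hρ0 k)
      (hρz k) hz (hgl i) (hGl i) (fun z hz => ?_) (fun z hz => ?_)
    · simp only [hg]; rw [indicator_of_mem hz]
    · simp only [hG]; rw [indicator_of_mem hz]
  have hlim : ∀ (h : Eu N × ℝ → ℝ), LocallyIntegrable h → ∀ᵐ z, Tendsto (fun k => mol volume (ρ k) h z)
      atTop (𝓝 (h z)) := by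
    intro h hh
    have hr0 : Tendsto (fun k => (φ k).rOut) atTop (𝓝 0) := by
      simp only [hφr]; exact tendsto_one_div_add_atTop_nhds_zero_nat
    have := ContDiffBump.ae_convolution_tendsto_right_of_locallyIntegrable (K := 2) hr0
      (Eventually.of_forall fun k => le_of_eq (by
        change 1 / ((k : ℝ) + 1) = 2 * (1 / (2 * ((k : ℝ) + 1)))
        field_simp)) hh
    filter_upwards [this] with z hz
    simp only [mol_eq_convolution]
    exact hz
  have hae : ∀ᵐ z, ∀ i, Tendsto (fun k => w k i z) atTop (𝓝 (g i z)) ∧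
      Tendsto (fun k => mol volume (ρ k) (G i) z) atTop (𝓝 (G i z)) := by
    rw [ae_all_iff]
    intro i
    filter_upwards [hlim _ (hgl i), hlim _ (hGl i)] with z h1 h2
    refine ⟨?_, h2⟩
    have := h1.add (tendsto_one_div_add_atTop_nhds_zero_nat (𝕜 := ℝ))
    rw [add_zero] at this
    exact this
  have hηs : Function.support (η : Eu N × ℝ → ℝ) = ball 0 2 := η.support_eq
  set a : Eu N × ℝ → ℝ := fun z => η z ^ (2 * n + 4) with ha
  have hac : Continuous a := η.continuous.pow _
  have ha0 : ∀ z, 0 ≤ a z := fun z => pow_nonneg η.nonneg _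
  have hai : Integrable a := hac.integrable_of_hasCompactSupport
    (HasCompactSupport.intro η.hasCompactSupport fun z hz => by
      simp only [ha]; rw [image_eq_zero_of_notMem_tsupport hz]; exact zero_pow (by omega))
  have haz : ∀ z ∉ ball (0 : Eu N × ℝ) 2, a z = 0 := fun z hz => by
    have : η z = 0 := by
      by_contra h
      exact hz (hηs ▸ h)
    simp only [ha]; rw [this]; exact zero_pow (by omega)
  have hq : 0 ≤ 2 * (2 * r + 1) := by linarith
  -- limit of the left-hand side
  have hL : Tendsto (fun k => ∫ z, a z * ∑ i, w k i z ^ (2 * (2 * r + 1))) atTop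
      (𝓝 (∫ z, a z * ∑ i, g i z ^ (2 * (2 * r + 1)))) := by
    refine tendsto_integral_of_dominated_convergence
      (fun z => a z * (m * (M + 1) ^ (2 * (2 * r + 1)))) (fun k => ?_) (hai.mul_const _) (fun k => ?_) ?_
    · exact (hac.mul (continuous_finsetSum _ fun i _ =>
        (hws k i).continuous.rpow_const fun _ => Or.inr hq)).aestronglyMeasurable
    · refine Eventually.of_forall fun z => ?_
      have h1 : 0 ≤ ∑ i, w k i z ^ (2 * (2 * r + 1)) :=
        Finset.sum_nonneg fun i _ => Real.rpow_nonneg (hw0 k i z).le _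
      rw [Real.norm_of_nonneg (mul_nonneg (ha0 z) h1)]
      refine mul_le_mul_of_nonneg_left ?_ (ha0 z)
      have := Finset.sum_le_sum fun i (_ : i ∈ Finset.univ) =>
        Real.rpow_le_rpow (hw0 k i z).le (hwM k i z) hq
      simpa using this
    · filter_upwards [hae] with z hz
      exact tendsto_const_nhds.mul (tendsto_finsetSum _ fun i _ =>
        ((Real.continuous_rpow_const hq).tendsto _).comp (hz i).1)
  have hRR : Tendsto (fun k => ∫ z, a z * ∑ i, (dd (timeDir N) (w k i) z - La spaceDir (w k i) z
      - reac β r (fun j => w k j z) i) ^ 2) atTop (𝓝 0) := by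
    have h0 : ∫ z : Eu N × ℝ, (0 : ℝ) = 0 := by simp
    rw [← h0]
    set R' := ∑ i, reac β r (fun _ => M + 1) i with hR'
    have hR1' : ∀ i, reac β r (fun _ => M + 1) i ≤ R' := fun i =>
      Finset.single_le_sum (f := fun i => reac β r (fun _ => M + 1) i)
        (fun i _ => reac_nonneg hβ (fun _ => by linarith) i) (Finset.mem_univ i)
    refine tendsto_integral_of_dominated_convergence
      (fun z => a z * (m * (R + R') ^ 2)) (fun k => ?_) (hai.mul_const _) (fun k => ?_) ?_
    · exact (hac.mul (continuous_finsetSum _ fun i _ => ((((contDiff_dd (hws k i) _).sub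
        (contDiff_La _ (hws k i))).sub (contDiff_reac (hws k) (hw0 k) i)).pow 2).continuous)).aestronglyMeasurable
    · refine Eventually.of_forall fun z => ?_
      rw [Real.norm_of_nonneg (mul_nonneg (ha0 z) (Finset.sum_nonneg fun i _ => sq_nonneg _))]
      by_cases hz : z ∈ ball (0 : Eu N × ℝ) 2
      · refine mul_le_mul_of_nonneg_left ?_ (ha0 z)
        have : ∀ i ∈ Finset.univ, (dd (timeDir N) (w k i) z - La spaceDir (w k i) z
          - reac β r (fun j => w k j z) i) ^ 2 ≤ (R + R') ^ 2 := by
          intro i _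
          rw [hpde k i z hz]
          have h1 : 0 ≤ mol volume (ρ k) (G i) z := mol_nonneg (hρ0 k) (hG0 i) z
          have h2 : mol volume (ρ k) (G i) z ≤ R :=
            mol_le (hρ0 k) (hρs k).continuous (hρc k) (hGl i) (hρ1 k) (hGR i) z
          have h3 := reac_nonneg (r := r) hβ (fun j => (hw0 k j z).le) i
          have h4 := (reac_le hr hβ (fun j => (hw0 k j z).le) (fun j => hwM k j z) i).trans (hR1' i)
          rw [← sq_abs]
          refine pow_le_pow_left₀ (abs_nonneg _) ?_ 2
          rw [abs_le]
          constructor <;> linarith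
        have := Finset.sum_le_sum this
        simpa using this
      · rw [haz z hz]; simp
    · filter_upwards [hae] with z hz
      by_cases hz2 : z ∈ ball (0 : Eu N × ℝ) 2
      · have hz4 : z ∈ ball (0 : Eu N × ℝ) 4 := ball_subset_ball (by norm_num) hz2
        have h5 : Tendsto (fun k => a z * ∑ i, (mol volume (ρ k) (G i) z
            - reac β r (fun j => w k j z) i) ^ 2) atTop
            (𝓝 (a z * ∑ i, (G i z - reac β r (fun j => g j z) i) ^ 2)) :=
          tendsto_const_nhds.mul (tendsto_finsetSum _ fun i _ => (((hz i).2.sub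
            (tendsto_reac hr (w := fun k j => w k j z) (fun j => (hz j).1) i)).pow 2))
        have h6 : ∀ i, G i z - reac β r (fun j => g j z) i = 0 := by
          intro i
          simp only [hG, hg]
          rw [indicator_of_mem hz4, sub_eq_zero]
          simp only [hf]
          congr 1
          funext j
          rw [indicator_of_mem hz4]
        simp only [h6] at h5
        have h7 : a z * ∑ i : Fin m, (0 : ℝ) ^ 2 = 0 := by simp
        rw [h7] at h5
        refine h5.congr fun k => ?_
        congr 1
        refine Finset.sum_congr rfl fun i _ => ?_
        rw [hpde k i z hz2]
      · rw [haz z hz2]; simp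
  have hfin : ∫ z, a z * ∑ i, g i z ^ (2 * (2 * r + 1)) ≤ C + C * 0 :=
    le_of_tendsto_of_tendsto' hL (tendsto_const_nhds.add (tendsto_const_nhds.mul hRR))
      fun k => hest (w k) (hws k) (hw0 k)
  rw [mul_zero, add_zero] at hfin
  refine le_trans ?_ hfin
  have hgi : Integrable fun z => a z * ∑ i, g i z ^ (2 * (2 * r + 1)) := by
    refine (hai.mul_const (m * M ^ (2 * (2 * r + 1)))).mono' ?_ (Eventually.of_forall fun z => ?_)
    · exact (hac.measurable.mul (Finset.measurable_sum _ fun i _ =>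
        (hgm i).pow_const _)).aestronglyMeasurable
    · rw [Real.norm_of_nonneg (mul_nonneg (ha0 z)
        (Finset.sum_nonneg fun i _ => Real.rpow_nonneg (hg0 i z) _))]
      refine mul_le_mul_of_nonneg_left ?_ (ha0 z)
      have := Finset.sum_le_sum fun i (_ : i ∈ Finset.univ) =>
        Real.rpow_le_rpow (hg0 i z) (hgM i z) hq
      simpa using this
  have h8 : ∫ z in closedBall (0 : Eu N × ℝ) 1, ∑ i, u i z.1 z.2 ^ (2 * (2 * r + 1))
      = ∫ z in closedBall (0 : Eu N × ℝ) 1, a z * ∑ i, g i z ^ (2 * (2 * r + 1)) := by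
    refine setIntegral_congr_fun measurableSet_closedBall fun z hz => ?_
    have h1 : η z = 1 := η.one_of_mem_closedBall hz
    have h2 : z ∈ ball (0 : Eu N × ℝ) 4 := closedBall_subset_ball (by norm_num) hz
    simp only [ha, hg]
    rw [h1, one_pow, one_mul]
    refine Finset.sum_congr rfl fun i _ => ?_
    rw [indicator_of_mem h2]
  rw [h8]
  exact setIntegral_le_integral hgi (Eventually.of_forall fun z => mul_nonneg (ha0 z)
    (Finset.sum_nonneg fun i _ => Real.rpow_nonneg (hg0 i z) _))

end BoxEstimate

section Scaling

variable {N : ℕ}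

/-- The parabolic rescaling of `v` about the point `(x₁, t₁)` with ratio `l` and weight `l ^ γ`. -/
noncomputable def scl (γ l : ℝ) (x₁ : Eu N) (t₁ : ℝ) (v : Eu N → ℝ → ℝ) (x : Eu N) (t : ℝ) : ℝ :=
  l ^ γ * v (x₁ + l • x) (t₁ + l ^ 2 * t)

theorem SepReg.scl {v : Eu N → ℝ → ℝ} (hv : SepReg v) (γ l : ℝ) (x₁ : Eu N) (t₁ : ℝ) :
    SepReg (scl γ l x₁ t₁ v) := by
  refine ⟨fun t => ?_, fun x => ?_⟩
  · exact contDiff_const.mul ((hv.space _).comp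
      (contDiff_const.add (contDiff_const_smul l)))
  · exact contDiff_const.mul ((hv.time _).comp
      (contDiff_const.add (contDiff_const.mul contDiff_id)))

theorem pd_affine {f : Eu N → ℝ} (hf : ContDiff ℝ 1 f) (l : ℝ) (x₁ : Eu N) (i : Fin N) (x : Eu N) :
    pd i (fun y => f (x₁ + l • y)) x = l * pd i f (x₁ + l • x) := by
  have h1 : HasFDerivAt (fun y : Eu N => x₁ + l • y) (l • ContinuousLinearMap.id ℝ (Eu N)) x :=
    ((hasFDerivAt_id x).const_smul l).const_add x₁
  have h2 := (diff_of_contDiff hf (by norm_num) (x₁ + l • x)).hasFDerivAt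
  have h3 := HasFDerivAt.comp (g := f) (f := fun y : Eu N => x₁ + l • y) x h2 h1
  rw [pd, HasFDerivAt.fderiv (f := fun y => f (x₁ + l • y)) h3]
  simp [pd]

theorem lap_affine {f : Eu N → ℝ} (hf : ContDiff ℝ 2 f) (l : ℝ) (x₁ : Eu N) (x : Eu N) :
    lap (fun y => f (x₁ + l • y)) x = l ^ 2 * lap f (x₁ + l • x) := by
  have hg : ContDiff ℝ 2 fun y : Eu N => f (x₁ + l • y) :=
    hf.comp (contDiff_const.add (contDiff_const_smul l))
  rw [lap_eq hg, lap_eq hf, Finset.mul_sum]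
  refine Finset.sum_congr rfl fun i _ => ?_
  have : pd i (fun y => f (x₁ + l • y)) = fun y => l * pd i f (x₁ + l • y) := funext fun y =>
    pd_affine (hf.of_le (by norm_num)) l x₁ i y
  have hc : ContDiff ℝ 1 fun y : Eu N => pd i f (x₁ + l • y) :=
    (contDiff_one_pd hf i).comp (contDiff_const.add (contDiff_const_smul l))
  rw [this, pd_const_mul l (diff_of_contDiff hc (by norm_num) x), pd_affine (contDiff_one_pd hf i)]
  ring

theorem heat_scl {v : Eu N → ℝ → ℝ} (hv : SepReg v) (γ l : ℝ) (x₁ : Eu N) (t₁ : ℝ) (x : Eu N) (t : ℝ) :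
    heat (scl γ l x₁ t₁ v) x t = l ^ γ * l ^ 2 * heat v (x₁ + l • x) (t₁ + l ^ 2 * t) := by
  have h1 : HasDerivAt (scl γ l x₁ t₁ v x)
      (l ^ γ * (deriv (v (x₁ + l • x)) (t₁ + l ^ 2 * t) * l ^ 2)) t := by
    have ha : HasDerivAt (fun t : ℝ => t₁ + l ^ 2 * t) (l ^ 2) t := by
      simpa using ((hasDerivAt_id t).const_mul (l ^ 2)).const_add t₁
    exact ((hv.hasDerivAt (x₁ + l • x) (t₁ + l ^ 2 * t)).comp t ha).const_mul _
  have h2 : lap (fun y => scl γ l x₁ t₁ v y t) x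
      = l ^ γ * (l ^ 2 * lap (fun y => v y (t₁ + l ^ 2 * t)) (x₁ + l • x)) := by
    have hg : ContDiff ℝ 2 fun y : Eu N => v (x₁ + l • y) (t₁ + l ^ 2 * t) :=
      (hv.space _).comp (contDiff_const.add (contDiff_const_smul l))
    rw [← lap_affine (hv.space _)]
    exact lap_const_mul _ hg x
  rw [heat, heat, h1.deriv, h2]
  ring

theorem SepReg.sum {ι : Type*} {s : Finset ι} {u : ι → Eu N → ℝ → ℝ} (hu : ∀ i, SepReg (u i)) :
    SepReg fun x t => ∑ i ∈ s, u i x t :=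
  ⟨fun t => ContDiff.sum fun i _ => (hu i).space t, fun x => ContDiff.sum fun i _ => (hu i).time x⟩

theorem heat_sum {ι : Type*} (s : Finset ι) {u : ι → Eu N → ℝ → ℝ} (hu : ∀ i, SepReg (u i))
    (x : Eu N) (t : ℝ) :
    heat (fun x t => ∑ i ∈ s, u i x t) x t = ∑ i ∈ s, heat (u i) x t := by
  have h1 : HasDerivAt (fun t => ∑ i ∈ s, u i x t) (∑ i ∈ s, deriv (u i x) t) t :=
    HasDerivAt.fun_sum fun i _ => (hu i).hasDerivAt x t
  simp only [heat]
  rw [h1.deriv, lap_sum s (fun i _ => (hu i).space t), Finset.sum_sub_distrib]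

variable {m : ℕ} {β : Fin m → Fin m → ℝ} {r : ℝ}

theorem reac_mul {l : ℝ} (hr : 0 < r) (hl : 0 ≤ l) {y : Fin m → ℝ} (hy : ∀ i, 0 ≤ y i) (i : Fin m) :
    reac β r (fun k => l * y k) i = l ^ (2 * r + 1) * reac β r y i := by
  rw [reac, reac, Finset.mul_sum]
  refine Finset.sum_congr rfl fun j _ => ?_
  have e : l ^ (2 * r + 1) = l ^ r * l ^ (r + 1) := by
    rw [← Real.rpow_add_of_nonneg hl hr.le (by linarith)]; congr 1; ring
  rw [Real.mul_rpow hl (hy i), Real.mul_rpow hl (hy j), e]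
  ring

theorem IsSol.scl {u : Fin m → Eu N → ℝ → ℝ} (hu : IsSol β r u) (hr : 0 < r) {l : ℝ} (hl : 0 < l)
    (x₁ : Eu N) (t₁ : ℝ) : IsSol β r fun i => scl (1 / r) l x₁ t₁ (u i) := by
  refine ⟨fun i => (hu.reg i).scl _ _ _ _, fun i x t => ?_, fun i x t => ?_⟩
  · exact mul_nonneg (Real.rpow_nonneg hl.le _) (hu.nonneg _ _ _)
  · rw [heat_scl (hu.reg i), hu.pde]
    simp only [_root_.scl]
    rw [reac_mul hr (Real.rpow_nonneg hl.le _) (fun k => hu.nonneg k _ _), ← Real.rpow_mul hl.le,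
      ← Real.rpow_natCast l 2, ← Real.rpow_add hl]
    congr 2
    push_cast
    field_simp
    ring

theorem IsSol.sepReg_sum {u : Fin m → Eu N → ℝ → ℝ} (hu : IsSol β r u) :
    SepReg fun x t => ∑ i, u i x t :=
  SepReg.sum hu.reg

theorem le_sum_of_nonneg {y : Fin m → ℝ} (hy : ∀ i, 0 ≤ y i) (i : Fin m) : y i ≤ ∑ j, y j :=
  Finset.single_le_sum (f := y) (fun j _ => hy j) (Finset.mem_univ i)

theorem IsSol.heat_sum_nonneg {u : Fin m → Eu N → ℝ → ℝ} (hu : IsSol β r u)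
    (hβ : ∀ i j, 0 ≤ β i j) (x : Eu N) (t : ℝ) : 0 ≤ heat (fun x t => ∑ i, u i x t) x t := by
  rw [heat_sum _ hu.reg]
  refine Finset.sum_nonneg fun i _ => ?_
  rw [hu.pde]
  exact reac_nonneg hβ (fun k => hu.nonneg k x t) i

theorem IsSol.heat_sum_le {u : Fin m → Eu N → ℝ → ℝ} (hu : IsSol β r u) (hr : 0 < r)
    (hβ : ∀ i j, 0 ≤ β i j) (x : Eu N) (t : ℝ) :
    heat (fun x t => ∑ i, u i x t) x t
      ≤ (∑ i, ∑ j, β i j) * (∑ i, u i x t) ^ (2 * r + 1) := by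
  have h0 : 0 ≤ ∑ i, u i x t := Finset.sum_nonneg fun i _ => hu.nonneg i x t
  rw [heat_sum _ hu.reg, Finset.sum_mul]
  refine Finset.sum_le_sum fun i _ => ?_
  rw [hu.pde]
  refine (reac_le hr hβ (fun k => hu.nonneg k x t)
    (le_sum_of_nonneg fun k => hu.nonneg k x t) i).trans (le_of_eq ?_)
  rw [reac, Finset.sum_mul]
  refine Finset.sum_congr rfl fun j _ => ?_
  rw [mul_assoc, ← Real.rpow_add_of_nonneg h0 hr.le (by linarith)]
  congr 2
  ring

/-- A scale invariant family of nonnegative functions `s` with `0 ≤ ∂ₜ s - Δ s ≤ K s ^ (2r+1)`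
that satisfies a uniform integral estimate. -/
structure ScaleFamily (N : ℕ) (r K C : ℝ) (S : (Eu N → ℝ → ℝ) → Prop) : Prop where
  reg : ∀ s, S s → SepReg s
  nonneg : ∀ s, S s → ∀ x t, 0 ≤ s x t
  heat_nonneg : ∀ s, S s → ∀ x t, 0 ≤ heat s x t
  heat_le : ∀ s, S s → ∀ x t, heat s x t ≤ K * s x t ^ (2 * r + 1)
  scl_mem : ∀ s, S s → ∀ l x₁ t₁, 0 < l → S (scl (1 / r) l x₁ t₁ s)
  box : ∀ s, S s → (∃ M, ∀ x ∈ ball (0 : Eu N) 4, ∀ t ∈ Ioo (-4 : ℝ) 4, s x t ≤ M) →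
    IntegrableOn (fun t => ∫ x in closedBall (0 : Eu N) 1, s x t ^ (2 * (2 * r + 1))) (Icc (-1) 1) ∧
    ∫ t in Icc (-1 : ℝ) 1, ∫ x in closedBall (0 : Eu N) 1, s x t ^ (2 * (2 * r + 1)) ≤ C

theorem exists_scaleFamily (hN : 1 ≤ N) (hr : 0 < r) (hsym : ∀ i j, β i j = β j i)
    (hβ : ∀ i j, 0 ≤ β i j) (hdiag : ∀ i, 0 < β i i)
    (hpB : N = 1 ∨ (2 ≤ N ∧ 2 * r + 1 < ((N : ℝ) * (N + 2)) / ((N : ℝ) - 1) ^ 2)) :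
    ∃ C, 0 < C ∧ ScaleFamily N r (∑ i, ∑ j, β i j) C
      (fun s => ∃ u : Fin m → Eu N → ℝ → ℝ, IsSol β r u ∧ s = fun x t => ∑ i, u i x t) := by
  obtain ⟨C, hC, hbox⟩ := box_estimate (m := m) hN hr hsym hβ hdiag hpB
  set q : ℝ := 2 * (2 * r + 1) with hq
  have hq1 : 1 ≤ q := by rw [hq]; linarith
  set A : ℝ := (m : ℝ) ^ (q - 1) with hA
  have hA0 : 0 ≤ A := Real.rpow_nonneg (Nat.cast_nonneg m) _
  refine ⟨A * C + 1, by positivity, ?_, ?_, ?_, ?_, ?_, ?_⟩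
  · rintro _ ⟨u, hu, rfl⟩; exact hu.sepReg_sum
  · rintro _ ⟨u, hu, rfl⟩ x t; exact Finset.sum_nonneg fun i _ => hu.nonneg i x t
  · rintro _ ⟨u, hu, rfl⟩ x t; exact hu.heat_sum_nonneg hβ x t
  · rintro _ ⟨u, hu, rfl⟩ x t; exact hu.heat_sum_le hr hβ x t
  · rintro _ ⟨u, hu, rfl⟩ l x₁ t₁ hl
    refine ⟨_, hu.scl hr hl x₁ t₁, ?_⟩
    ext x t
    simp only [scl, Finset.mul_sum]
  · rintro _ ⟨u, hu, rfl⟩ ⟨M, hM⟩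
    have hub : ∀ i, ∀ x ∈ ball (0 : Eu N) 4, ∀ t ∈ Ioo (-4 : ℝ) 4, u i x t ≤ M :=
      fun i x hx t ht => (le_sum_of_nonneg (fun k => hu.nonneg k x t) i).trans (hM x hx t ht)
    have hB := hbox u hu ⟨M, hub⟩
    have hcb : closedBall (0 : Eu N × ℝ) 1 = closedBall (0 : Eu N) 1 ×ˢ Icc (-1 : ℝ) 1 := by
      rw [← Prod.mk_zero_zero, ← closedBall_prod_same, Real.closedBall_eq_Icc]; simp
    have hmu : ∀ i, Measurable fun z : Eu N × ℝ => u i z.1 z.2 := fun i =>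
      measurable_of_separately (fun t => ((hu.reg i).space t).continuous)
        (fun x => ((hu.reg i).time x).continuous)
    have hmem : ∀ z ∈ closedBall (0 : Eu N × ℝ) 1, z.1 ∈ ball (0 : Eu N) 4 ∧ z.2 ∈ Ioo (-4 : ℝ) 4 := by
      intro z hz
      rw [hcb] at hz
      refine ⟨closedBall_subset_ball (by norm_num) hz.1, ?_⟩
      have := hz.2
      constructor <;> linarith [this.1, this.2]
    have hfin : volume (closedBall (0 : Eu N × ℝ) 1) ≠ ⊤ :=
      (isCompact_closedBall _ _).measure_ne_top
    have key : ∀ g : Eu N × ℝ → ℝ, Measurable g → (∀ z, 0 ≤ g z) → ∀ M : ℝ,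
        (∀ z ∈ closedBall (0 : Eu N × ℝ) 1, g z ≤ M) →
        IntegrableOn (fun z => g z ^ q) (closedBall (0 : Eu N × ℝ) 1) := by
      intro g hg h0 M hgM
      refine Measure.integrableOn_of_bounded (M := M ^ q) hfin
        (hg.pow_const q).aestronglyMeasurable ?_
      refine (ae_restrict_iff' measurableSet_closedBall).2 (Eventually.of_forall fun z hz => ?_)
      rw [Real.norm_of_nonneg (Real.rpow_nonneg (h0 z) _)]
      exact Real.rpow_le_rpow (h0 z) (hgM z hz) (by linarith)
    have hI : ∀ i, IntegrableOn (fun z : Eu N × ℝ => u i z.1 z.2 ^ q) (closedBall 0 1) := fun i =>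
      key _ (hmu i) (fun z => hu.nonneg i _ _) M fun z hz =>
        hub i _ (hmem z hz).1 _ (hmem z hz).2
    have hS : IntegrableOn (fun z : Eu N × ℝ => (∑ i, u i z.1 z.2) ^ q) (closedBall 0 1) :=
      key _ (Finset.measurable_fun_sum _ fun i _ => hmu i)
        (fun z => Finset.sum_nonneg fun i _ => hu.nonneg i _ _) M
        fun z hz => hM _ (hmem z hz).1 _ (hmem z hz).2
    have hle : ∫ z in closedBall (0 : Eu N × ℝ) 1, (∑ i, u i z.1 z.2) ^ q ≤ A * C := by
      calc _ ≤ ∫ z in closedBall (0 : Eu N × ℝ) 1, A * ∑ i, u i z.1 z.2 ^ q := by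
            refine integral_mono hS ((integrable_finsetSum _ fun i _ => hI i).const_mul A) fun z => ?_
            have := Real.rpow_sum_le_const_mul_sum_rpow_of_nonneg (s := Finset.univ)
              (f := fun i => u i z.1 z.2) hq1 (fun i _ => hu.nonneg i _ _)
            simpa [hA] using this
        _ = A * ∫ z in closedBall (0 : Eu N × ℝ) 1, ∑ i, u i z.1 z.2 ^ q := integral_const_mul _ _
        _ ≤ A * C := mul_le_mul_of_nonneg_left hB hA0
    rw [hcb] at hS hle
    have hS' : Integrable (fun z : Eu N × ℝ => (∑ i, u i z.1 z.2) ^ q)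
        ((volume.restrict (closedBall (0 : Eu N) 1)).prod (volume.restrict (Icc (-1 : ℝ) 1))) := by
      rw [Measure.prod_restrict, ← Measure.volume_eq_prod]; exact hS
    refine ⟨hS'.integral_prod_right, ?_⟩
    have e : ∫ z in closedBall (0 : Eu N) 1 ×ˢ Icc (-1 : ℝ) 1, (∑ i, u i z.1 z.2) ^ q
        = ∫ t in Icc (-1 : ℝ) 1, ∫ x in closedBall (0 : Eu N) 1, (∑ i, u i x t) ^ q := by
      rw [Measure.volume_eq_prod, ← Measure.prod_restrict, integral_prod_symm _ hS']
    rw [← e]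
    linarith

end Scaling

section Universal

variable {N : ℕ} {r K C : ℝ} {S : (Eu N → ℝ → ℝ) → Prop}

/-- The doubling argument: a near-maximum point of `s` weighted by a power of the parabolic
distance to the boundary. -/
theorem exists_doubling {s : Eu N → ℝ → ℝ} (h0 : ∀ x t, 0 ≤ s x t) {M q : ℝ} (hq : 0 ≤ q)
    (hM : ∀ x ∈ ball (0 : Eu N) 1, ∀ t ∈ Ioo (-1 : ℝ) 1, s x t ≤ M) (hpos : 0 < s 0 0) :
    ∃ x₁ t₁ d, 0 < d ∧ ‖x₁‖ ≤ 1 - d ∧ √|t₁| ≤ 1 - d ∧ s 0 0 ≤ 2 * (d ^ q * s x₁ t₁) ∧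
      ∀ x t, ‖x - x₁‖ ≤ d / 2 → |t - t₁| ≤ d ^ 2 / 4 → s x t ≤ 2 * 2 ^ q * s x₁ t₁ := by
  set δ : Eu N × ℝ → ℝ := fun P => 1 - max ‖P.1‖ (√|P.2|) with hδ
  set Q : Set (Eu N × ℝ) := {P | 0 < δ P} with hQ
  set W : Eu N × ℝ → ℝ := fun P => s P.1 P.2 * δ P ^ q with hW
  have hQmem : ∀ P ∈ Q, P.1 ∈ ball (0 : Eu N) 1 ∧ P.2 ∈ Ioo (-1 : ℝ) 1 := by
    rintro ⟨x, t⟩ (hP : 0 < 1 - max ‖x‖ (√|t|))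
    have h1 : ‖x‖ < 1 := by linarith [le_max_left ‖x‖ (√|t|)]
    have h2 : √|t| < 1 := by linarith [le_max_right ‖x‖ (√|t|)]
    refine ⟨by simpa using h1, abs_lt.1 ?_⟩
    rw [Real.sqrt_lt' one_pos] at h2
    simpa using h2
  have hδ1 : ∀ P, δ P ≤ 1 := fun P => by
    have := (norm_nonneg P.1).trans (le_max_left ‖P.1‖ (√|P.2|))
    simp only [hδ]; linarith
  have hbd : BddAbove (W '' Q) := by
    refine ⟨M, ?_⟩
    rintro _ ⟨P, hP, rfl⟩
    have h1 : δ P ^ q ≤ 1 := Real.rpow_le_one (le_of_lt hP) (hδ1 P) hq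
    calc W P ≤ s P.1 P.2 * 1 := mul_le_mul_of_nonneg_left h1 (h0 _ _)
      _ ≤ M := by rw [mul_one]; exact hM _ (hQmem P hP).1 _ (hQmem P hP).2
  have h0Q : ((0 : Eu N), (0 : ℝ)) ∈ Q := by simp [hQ, hδ]
  have hW0 : W (0, 0) = s 0 0 := by simp [hW, hδ]
  have hsup : s 0 0 ≤ sSup (W '' Q) := hW0 ▸ le_csSup hbd ⟨_, h0Q, rfl⟩
  obtain ⟨_, ⟨P, hP, rfl⟩, hPs⟩ := exists_lt_of_lt_csSup (s := W '' Q) ⟨_, _, h0Q, rfl⟩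
    (show sSup (W '' Q) / 2 < sSup (W '' Q) by linarith)
  have hP0 : 0 < δ P := hP
  refine ⟨P.1, P.2, δ P, hP0, ?_, ?_, ?_, ?_⟩
  · simp only [hδ]; linarith [le_max_left ‖P.1‖ (√|P.2|)]
  · simp only [hδ]; linarith [le_max_right ‖P.1‖ (√|P.2|)]
  · have : W P = δ P ^ q * s P.1 P.2 := by simp only [hW]; ring
    linarith
  · intro x t hx ht
    have hδx : δ P / 2 ≤ δ (x, t) := by
      have h1 : ‖x‖ ≤ ‖P.1‖ + δ P / 2 := by
        calc ‖x‖ = ‖P.1 + (x - P.1)‖ := by congr 1; abel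
          _ ≤ _ := (norm_add_le _ _).trans (by linarith)
      have h2 : √|t| ≤ √|P.2| + δ P / 2 := by
        have h3 : |t| ≤ |P.2| + (δ P / 2) ^ 2 := by
          have := abs_add_le P.2 (t - P.2)
          rw [add_sub_cancel] at this
          nlinarith
        have h4 := Real.sq_sqrt (abs_nonneg P.2)
        have h5 := Real.sqrt_nonneg |P.2|
        refine Real.sqrt_le_iff.2 ⟨by positivity, ?_⟩
        nlinarith [mul_nonneg h5 hP0.le]
      have h3 : max ‖x‖ (√|t|) ≤ max ‖P.1‖ (√|P.2|) + δ P / 2 :=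
        max_le (h1.trans (by linarith [le_max_left ‖P.1‖ (√|P.2|)]))
          (h2.trans (by linarith [le_max_right ‖P.1‖ (√|P.2|)]))
      have h4 : δ P = 1 - max ‖P.1‖ (√|P.2|) := rfl
      have h5 : δ (x, t) = 1 - max ‖x‖ (√|t|) := rfl
      linarith
    have hxQ : (x, t) ∈ Q := show 0 < δ (x, t) by linarith
    have h1 : s x t * δ (x, t) ^ q ≤ 2 * (s P.1 P.2 * δ P ^ q) := by
      have := le_csSup hbd ⟨_, hxQ, rfl⟩
      simp only [hW] at this hPs
      linarith
    have h2 : (δ P / 2) ^ q ≤ δ (x, t) ^ q := Real.rpow_le_rpow (by linarith) hδx hq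
    have h3 : s x t * (δ P / 2) ^ q ≤ 2 * (s P.1 P.2 * δ P ^ q) :=
      (mul_le_mul_of_nonneg_left h2 (h0 _ _)).trans h1
    rw [Real.div_rpow hP0.le (by norm_num)] at h3
    have h4 : 0 < δ P ^ q := Real.rpow_pos_of_pos hP0 _
    have h5 : (0 : ℝ) < 2 ^ q := Real.rpow_pos_of_pos (by norm_num) _
    rw [← mul_div_assoc, div_le_iff₀ h5] at h3
    refine le_of_mul_le_mul_right ?_ h4
    linarith

/-- The mass of a bounded function on a ball gives a lower bound for the integral of a power. -/
theorem le_integral_rpow {q c : ℝ} (hq : 1 < q) (hc : 0 < c) : ∃ c' > 0, ∀ f : Eu N → ℝ,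
    Continuous f → (∀ x, 0 ≤ f x) → c ≤ ∫ x in closedBall (0 : Eu N) (1 / 2), f x →
      c' ≤ ∫ x in closedBall (0 : Eu N) (1 / 2), f x ^ q := by
  set V : ℝ := (volume (closedBall (0 : Eu N) (1 / 2))).toReal with hV
  have hV0 : 0 ≤ V := ENNReal.toReal_nonneg
  set ε : ℝ := c / (2 * (V + 1)) with hε
  have hε0 : 0 < ε := by positivity
  have hεV : ε * V ≤ c / 2 := by
    rw [hε, div_mul_eq_mul_div, div_le_div_iff₀ (by positivity) (by norm_num)]
    nlinarith
  refine ⟨c / 2 * ε ^ (q - 1), by positivity, fun f hf h0 hcf => ?_⟩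
  have hpt : ∀ x, f x ≤ ε + ε ^ (1 - q) * f x ^ q := by
    intro x
    rcases le_or_gt (f x) ε with h | h
    · have := mul_nonneg (Real.rpow_nonneg hε0.le (1 - q)) (Real.rpow_nonneg (h0 x) q)
      linarith
    · have hfx : 0 < f x := hε0.trans h
      have h1 : f x ^ q = f x ^ (q - 1) * f x := by
        rw [← Real.rpow_add_one hfx.ne']; congr 1; ring
      have h2 : ε ^ (q - 1) ≤ f x ^ (q - 1) := Real.rpow_le_rpow hε0.le h.le (by linarith)
      have h3 : ε ^ (1 - q) * ε ^ (q - 1) = 1 := by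
        rw [← Real.rpow_add hε0, show 1 - q + (q - 1) = 0 by ring, Real.rpow_zero]
      have h4 : 1 ≤ ε ^ (1 - q) * f x ^ (q - 1) := by
        exact h3.symm.le.trans (mul_le_mul_of_nonneg_left h2 (Real.rpow_nonneg hε0.le _))
      rw [h1, ← mul_assoc]
      nlinarith
  have hcomp := isCompact_closedBall (0 : Eu N) (1 / 2)
  have hcq : Continuous fun x => f x ^ q := hf.rpow_const fun _ => Or.inr (by linarith)
  have i1 : IntegrableOn f (closedBall (0 : Eu N) (1 / 2)) := hf.continuousOn.integrableOn_compact hcomp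
  have i2 : IntegrableOn (fun x => f x ^ q) (closedBall (0 : Eu N) (1 / 2)) :=
    hcq.continuousOn.integrableOn_compact hcomp
  have i3 : IntegrableOn (fun _ : Eu N => ε) (closedBall (0 : Eu N) (1 / 2)) :=
    continuous_const.continuousOn.integrableOn_compact hcomp
  have hint : ∫ x in closedBall (0 : Eu N) (1 / 2), f x
      ≤ ε * V + ε ^ (1 - q) * ∫ x in closedBall (0 : Eu N) (1 / 2), f x ^ q := by
    calc _ ≤ ∫ x in closedBall (0 : Eu N) (1 / 2), (ε + ε ^ (1 - q) * f x ^ q) :=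
          integral_mono i1 (i3.add (i2.const_mul _)) hpt
      _ = _ := by
          rw [integral_add i3 (i2.const_mul _), integral_const_mul, setIntegral_const]
          simp [hV, Measure.real, mul_comm]
  have h3 : ε ^ (q - 1) * ε ^ (1 - q) = 1 := by
    rw [← Real.rpow_add hε0, show q - 1 + (1 - q) = 0 by ring, Real.rpow_zero]
  set I := ∫ x in closedBall (0 : Eu N) (1 / 2), f x ^ q
  have h4 : c / 2 ≤ ε ^ (1 - q) * I := by linarith
  calc c / 2 * ε ^ (q - 1) ≤ ε ^ (1 - q) * I * ε ^ (q - 1) :=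
        mul_le_mul_of_nonneg_right h4 (Real.rpow_nonneg hε0.le _)
    _ = (ε ^ (q - 1) * ε ^ (1 - q)) * I := by ring
    _ = I := by rw [h3, one_mul]

theorem integral_smul_ball_le {f : Eu N → ℝ} (hf : Continuous f) (h0 : ∀ x, 0 ≤ f x) {l : ℝ}
    (hl : 0 < l) (hl1 : l ≤ 1) :
    l ^ N * ∫ x in closedBall (0 : Eu N) (1 / 2), f (l • x) ≤ ∫ x in closedBall (0 : Eu N) 1, f x := by
  rw [Measure.setIntegral_comp_smul_of_pos volume f _ hl, smul_eq_mul, ← mul_assoc]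
  have hfr : Module.finrank ℝ (Eu N) = N := by simp
  rw [hfr, mul_inv_cancel₀ (by positivity), one_mul]
  refine setIntegral_mono_set (hf.continuousOn.integrableOn_compact (isCompact_closedBall _ _))
    (Eventually.of_forall h0) (LE.le.eventuallyLE ?_)
  rw [_root_.smul_closedBall l (0 : Eu N) (by norm_num), smul_zero, Real.norm_of_nonneg hl.le]
  exact closedBall_subset_closedBall (by linarith)

theorem mul_le_of_le_setIntegral {J : ℝ → ℝ} {s : Set ℝ} (hJ : IntegrableOn J s) (h0 : ∀ t, 0 ≤ J t)
    (hC : ∫ t in s, J t ≤ C) {a b c : ℝ} (hab : Icc a b ⊆ s) (hle : a ≤ b)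
    (hc : ∀ t ∈ Icc a b, c ≤ J t) : (b - a) * c ≤ C := by
  have h1 : (b - a) * c = ∫ t in Icc a b, c := by
    rw [setIntegral_const, Measure.real, Real.volume_Icc, ENNReal.toReal_ofReal (by linarith),
      smul_eq_mul]
  rw [h1]
  exact (setIntegral_mono_on (integrableOn_const measure_Icc_lt_top.ne) (hJ.mono_set hab)
    measurableSet_Icc hc).trans ((setIntegral_mono_set hJ (Eventually.of_forall h0)
      (LE.le.eventuallyLE hab)).trans hC)

set_option maxHeartbeats 1000000 in
theorem ScaleFamily.le_of_relative_bound (hS : ScaleFamily N r K C S) (hr : 0 < r) (hK : 0 ≤ K)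
    (hκ : (N : ℝ) + 2 < 2 * (2 * r + 1) / r) {A : ℝ} (hA : 1 ≤ A) :
    ∃ D > 0, ∀ s, S s →
      (∀ x ∈ ball (0 : Eu N) 4, ∀ t ∈ Ioo (-4 : ℝ) 4, s x t ≤ A * s 0 0) → s 0 0 ≤ D := by
  obtain ⟨C₀, hC₀, hup⟩ := upper_core N
  set γ : ℝ := 1 / r with hγ
  have hγ0 : 0 < γ := by positivity
  set q : ℝ := 2 * (2 * r + 1) with hq
  set L : ℝ := K * A ^ (2 * r) with hL
  have hL0 : 0 ≤ L := mul_nonneg hK (Real.rpow_nonneg (by linarith) _)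
  set a : ℝ := (1 / 2) ^ γ with ha
  have ha0 : 0 < a := Real.rpow_pos_of_pos (by norm_num) _
  obtain ⟨θ, hθ0, hθ1, hθ2⟩ : ∃ θ : ℝ, 0 < θ ∧ θ ≤ 1 / 2 ∧ C₀ * θ * (1 + L) * A ≤ a / 2 := by
    have hB : 0 < C₀ * (1 + L) * A := by positivity
    refine ⟨min (1 / 2) (a / 2 / (C₀ * (1 + L) * A)), by positivity, min_le_left _ _, ?_⟩
    calc C₀ * min (1 / 2) (a / 2 / (C₀ * (1 + L) * A)) * (1 + L) * A
        = (C₀ * (1 + L) * A) * min (1 / 2) (a / 2 / (C₀ * (1 + L) * A)) := by ring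
      _ ≤ (C₀ * (1 + L) * A) * (a / 2 / (C₀ * (1 + L) * A)) :=
          mul_le_mul_of_nonneg_left (min_le_right _ _) hB.le
      _ = a / 2 := mul_div_cancel₀ _ hB.ne'
  obtain ⟨C₁, hC₁, hup⟩ := hup θ hθ0 hθ1
  obtain ⟨c', hc', hlow⟩ := le_integral_rpow (N := N) (q := q) (by rw [hq]; linarith)
    (show 0 < a / (2 * C₁) by positivity)
  set κ : ℝ := q * γ - N - 2 with hκdef
  have hκ0 : 0 < κ := by
    have : q * γ = q / r := by rw [hγ]; ring
    rw [hκdef, this]; linarith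
  set c'' : ℝ := 3 / 4 * θ * c' with hc''
  have hc''0 : 0 < c'' := by positivity
  refine ⟨max 1 ((C / c'') ^ (1 / (r * κ))), by positivity, fun s hs hb => ?_⟩
  set M : ℝ := s 0 0 with hMdef
  rcases le_or_gt M 1 with hM1 | hM1
  · exact hM1.trans (le_max_left _ _)
  refine le_trans ?_ (le_max_right _ _)
  have hM0 : 0 < M := by linarith
  set ρ : ℝ := M ^ (-r) with hρ
  have hρ0 : 0 < ρ := Real.rpow_pos_of_pos hM0 _
  have hρ1 : ρ ≤ 1 := Real.rpow_le_one_of_one_le_of_nonpos hM1.le (by linarith)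
  have hργ : ρ ^ γ * M = 1 := by
    rw [hρ, ← Real.rpow_mul hM0.le, hγ, show -r * (1 / r) = -1 by field_simp, Real.rpow_neg_one,
      inv_mul_cancel₀ hM0.ne']
  set J : ℝ → ℝ := fun t => ∫ x in closedBall (0 : Eu N) 1, s x t ^ q with hJ
  have hs0 := hS.nonneg s hs
  have hreg := hS.reg s hs
  have hsc : ∀ t, Continuous fun x => s x t ^ q := fun t =>
    (hreg.space t).continuous.rpow_const fun _ => Or.inr (by rw [hq]; linarith)
  have hJl : ∀ l, ρ / 2 ≤ l → l ≤ ρ → c' * ρ ^ ((N : ℝ) - q * γ) ≤ J (-(l ^ 2 * θ)) := by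
    intro l hl1 hl2
    have hl0 : 0 < l := by linarith
    have hl01 : l ≤ 1 := hl2.trans hρ1
    have hv := hS.scl_mem s hs l 0 0 hl0
    set v := scl γ l 0 0 s with hvdef
    have hv' : ∀ x t, v x t = l ^ γ * s (l • x) (l ^ 2 * t) := fun x t => by
      simp [hvdef, scl]
    have hlγ : l ^ γ * M ≤ 1 := by
      rw [← hργ]; exact mul_le_mul_of_nonneg_right (Real.rpow_le_rpow hl0.le hl2 hγ0.le) hM0.le
    have hv00 : a ≤ v 0 0 := by
      rw [hv', smul_zero, mul_zero]
      calc a = a * (ρ ^ γ * M) := by rw [hργ, mul_one]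
        _ = (ρ / 2) ^ γ * M := by
          rw [ha, ← mul_assoc, ← Real.mul_rpow (by norm_num) hρ0.le]; congr 2; ring
        _ ≤ _ := mul_le_mul_of_nonneg_right (Real.rpow_le_rpow (by positivity) hl1 hγ0.le) hM0.le
    have hvb : ∀ x ∈ ball (0 : Eu N) 1, ∀ t ∈ Ioo (-1 : ℝ) 1, 0 ≤ v x t ∧ v x t ≤ A ∧
        heat v x t ≤ L * A := by
      intro x hx t ht
      have h1 : v x t ≤ A := by
        have hx' : l • x ∈ ball (0 : Eu N) 4 := by
          rw [mem_ball_zero_iff] at hx ⊢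
          rw [norm_smul, Real.norm_of_nonneg hl0.le]
          nlinarith [norm_nonneg x]
        have hl2' : l ^ 2 ≤ 1 := by nlinarith
        have ht' : l ^ 2 * t ∈ Ioo (-4 : ℝ) 4 := by
          have := abs_lt.2 ht
          refine abs_lt.1 ?_
          rw [abs_mul, abs_of_nonneg (sq_nonneg l)]
          nlinarith [abs_nonneg t]
        rw [hv']
        calc l ^ γ * s (l • x) (l ^ 2 * t) ≤ l ^ γ * (A * M) :=
              mul_le_mul_of_nonneg_left (hb _ hx' _ ht') (Real.rpow_nonneg hl0.le _)
          _ = A * (l ^ γ * M) := by ring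
          _ ≤ A := by nlinarith
      refine ⟨hS.nonneg v hv x t, h1, (hS.heat_le v hv x t).trans ?_⟩
      have hA0 : 0 < A := by linarith
      rw [hL, mul_assoc, ← Real.rpow_add_one hA0.ne']
      exact mul_le_mul_of_nonneg_left (Real.rpow_le_rpow (hS.nonneg v hv x t) h1 (by linarith)) hK
    have h1 := hup v A L (hS.reg v hv) hL0 hvb
    have h2 : a / (2 * C₁) ≤ ∫ x in closedBall (0 : Eu N) (1 / 2), v x (-θ) := by
      rw [div_le_iff₀ (by positivity)]
      nlinarith
    have h3 := hlow (fun x => v x (-θ)) ((hS.reg v hv).space _).continuous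
      (fun x => hS.nonneg v hv x _) h2
    have h4 : ∀ x, v x (-θ) ^ q = l ^ (q * γ) * s (l • x) (-(l ^ 2 * θ)) ^ q := fun x => by
      rw [hv', Real.mul_rpow (Real.rpow_nonneg hl0.le _) (hs0 _ _), ← Real.rpow_mul hl0.le,
        mul_comm γ q, mul_neg]
    simp only [h4] at h3
    rw [integral_const_mul] at h3
    have h5 := integral_smul_ball_le (hsc (-(l ^ 2 * θ))) (fun x => Real.rpow_nonneg (hs0 _ _) _)
      hl0 hl01
    have h6 : ρ ^ ((N : ℝ) - q * γ) ≤ l ^ ((N : ℝ) - q * γ) :=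
      Real.rpow_le_rpow_of_nonpos hl0 hl2 (by linarith)
    have h7 : l ^ ((N : ℝ) - q * γ) * l ^ (q * γ) = l ^ N := by
      rw [← Real.rpow_add hl0, sub_add_cancel, Real.rpow_natCast]
    calc c' * ρ ^ ((N : ℝ) - q * γ) ≤ c' * l ^ ((N : ℝ) - q * γ) :=
          mul_le_mul_of_nonneg_left h6 hc'.le
      _ ≤ (l ^ (q * γ) * ∫ x in closedBall (0 : Eu N) (1 / 2), s (l • x) (-(l ^ 2 * θ)) ^ q)
            * l ^ ((N : ℝ) - q * γ) :=
          mul_le_mul_of_nonneg_right h3 (Real.rpow_nonneg hl0.le _)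
      _ = (l ^ ((N : ℝ) - q * γ) * l ^ (q * γ)) *
          ∫ x in closedBall (0 : Eu N) (1 / 2), s (l • x) (-(l ^ 2 * θ)) ^ q := by ring
      _ ≤ _ := by rw [h7]; exact h5
  obtain ⟨hJi, hJC⟩ := hS.box s hs ⟨A * M, hb⟩
  set I : Set ℝ := Icc (-(ρ ^ 2 * θ)) (-(ρ ^ 2 * θ / 4)) with hI
  have hρ2 : ρ ^ 2 * θ ≤ 1 := by nlinarith
  have hρθ : 0 < ρ ^ 2 * θ := by positivity
  have hIsub : I ⊆ Icc (-1) 1 := Icc_subset_Icc (by linarith) (by linarith)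
  have hJI : ∀ t ∈ I, c' * ρ ^ ((N : ℝ) - q * γ) ≤ J t := by
    intro t ht
    have hnt : 0 ≤ -t / θ := div_nonneg (by linarith [ht.2]) hθ0.le
    have e : t = -(√(-t / θ) ^ 2 * θ) := by
      rw [Real.sq_sqrt hnt, div_mul_cancel₀ _ hθ0.ne', neg_neg]
    rw [e]
    refine hJl _ (Real.le_sqrt_of_sq_le ?_) (Real.sqrt_le_iff.2 ⟨hρ0.le, ?_⟩)
    · rw [le_div_iff₀ hθ0]; linarith [ht.2]
    · rw [div_le_iff₀ hθ0]; linarith [ht.1]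
  have hJ0 : ∀ t, 0 ≤ J t := fun t => integral_nonneg fun x => Real.rpow_nonneg (hs0 _ _) _
  have hfinal : (3 / 4 * (ρ ^ 2 * θ)) * (c' * ρ ^ ((N : ℝ) - q * γ)) ≤ C := by
    have := mul_le_of_le_setIntegral hJi hJ0 hJC hIsub (by linarith) hJI
    refine le_trans (le_of_eq ?_) this
    ring
  have e1 : ρ ^ 2 * ρ ^ ((N : ℝ) - q * γ) = M ^ (r * κ) := by
    rw [← Real.rpow_natCast ρ 2, ← Real.rpow_add hρ0, hρ, ← Real.rpow_mul hM0.le]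
    congr 1
    rw [hκdef]; push_cast; ring
  have h8 : c'' * M ^ (r * κ) ≤ C := by
    rw [← e1, hc'']
    linarith
  have h9 : M ^ (r * κ) ≤ C / c'' := by rw [le_div_iff₀ hc''0]; linarith
  have hrκ : 0 < r * κ := by positivity
  calc M = (M ^ (r * κ)) ^ (1 / (r * κ)) := by
        rw [← Real.rpow_mul hM0.le, mul_one_div_cancel hrκ.ne', Real.rpow_one]
    _ ≤ _ := Real.rpow_le_rpow (Real.rpow_nonneg hM0.le _) h9 (by positivity)

theorem ScaleFamily.universal_bound (hS : ScaleFamily N r K C S) (hr : 0 < r) (hK : 0 ≤ K)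
    (hκ : (N : ℝ) + 2 < 2 * (2 * r + 1) / r) :
    ∃ D > 0, ∀ s, S s →
      (∃ M, ∀ x ∈ ball (0 : Eu N) 1, ∀ t ∈ Ioo (-1 : ℝ) 1, s x t ≤ M) → s 0 0 ≤ D := by
  set γ : ℝ := 1 / r with hγ
  have hγ0 : 0 < γ := by positivity
  have h2γ : 1 ≤ (2 : ℝ) ^ γ := Real.one_le_rpow (by norm_num) hγ0.le
  obtain ⟨D, hD, hU⟩ := hS.le_of_relative_bound hr hK hκ (A := 2 * 2 ^ γ) (by linarith)
  refine ⟨2 * 8 ^ γ * D, by positivity, fun s hs ⟨M, hM⟩ => ?_⟩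
  have hs0 := hS.nonneg s hs
  rcases (hs0 0 0).eq_or_lt with h | hpos
  · rw [← h]; positivity
  obtain ⟨x₁, t₁, d, hd, -, -, hsd, hloc⟩ := exists_doubling hs0 hγ0.le hM hpos
  have hl : 0 < d / 8 := by positivity
  have hv := hS.scl_mem s hs (d / 8) x₁ t₁ hl
  have hdγ : 0 ≤ (d / 8) ^ γ := Real.rpow_nonneg hl.le _
  have hv00 : scl γ (d / 8) x₁ t₁ s 0 0 = (d / 8) ^ γ * s x₁ t₁ := by simp [scl]
  have h1 := hU _ hv fun x hx t ht => by
    rw [hv00]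
    have := hloc (x₁ + (d / 8) • x) (t₁ + (d / 8) ^ 2 * t) (by
        rw [add_sub_cancel_left, norm_smul, Real.norm_of_nonneg hl.le]
        rw [mem_ball_zero_iff] at hx
        nlinarith) (by
        rw [add_sub_cancel_left, abs_mul, abs_of_nonneg (sq_nonneg _)]
        nlinarith [abs_lt.2 ht, sq_nonneg d])
    calc (d / 8) ^ γ * s (x₁ + (d / 8) • x) (t₁ + (d / 8) ^ 2 * t)
        ≤ (d / 8) ^ γ * (2 * 2 ^ γ * s x₁ t₁) := mul_le_mul_of_nonneg_left this hdγ
      _ = _ := by ring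
  rw [hv00] at h1
  have h8 : d ^ γ = 8 ^ γ * (d / 8) ^ γ := by
    rw [← Real.mul_rpow (by norm_num) hl.le]; congr 1; ring
  calc s 0 0 ≤ 2 * (d ^ γ * s x₁ t₁) := hsd
    _ = 2 * 8 ^ γ * ((d / 8) ^ γ * s x₁ t₁) := by rw [h8]; ring
    _ ≤ _ := mul_le_mul_of_nonneg_left h1 (by positivity)

end Universal

section Liouville

variable {N : ℕ} {r K C : ℝ} {S : (Eu N → ℝ → ℝ) → Prop}

theorem integral_affine_ball_le {f : Eu N → ℝ} (hf : Continuous f) (h0 : ∀ x, 0 ≤ f x) {l : ℝ}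
    (hl : 0 < l) (hl1 : l ≤ 1) {x₁ : Eu N} (hx₁ : ‖x₁‖ ≤ 1) :
    l ^ N * ∫ x in closedBall (0 : Eu N) (1 / 2), f (x₁ + l • x)
      ≤ ∫ x in closedBall (0 : Eu N) 2, f x := by
  have hg : Continuous fun x => f (x₁ + x) := hf.comp (continuous_const.add continuous_id)
  refine (integral_smul_ball_le hg (fun x => h0 _) hl hl1).trans ?_
  rw [← (measurePreserving_add_left volume x₁).setIntegral_preimage_emb
    (measurableEmbedding_addLeft x₁) f]
  have hpre : (fun x => x₁ + x) ⁻¹' closedBall (0 : Eu N) 2 = closedBall (-x₁) 2 := by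
    ext x
    simp
  refine setIntegral_mono_set ?_ (Eventually.of_forall fun x => h0 _) (LE.le.eventuallyLE ?_)
  · rw [hpre]
    exact hg.continuousOn.integrableOn_compact (isCompact_closedBall _ _)
  · intro x hx
    rw [mem_closedBall_zero_iff] at hx
    rw [mem_preimage, mem_closedBall_zero_iff]
    linarith [norm_add_le x₁ x]

theorem ScaleFamily.harnack_unit (hS : ScaleFamily N r K C S) (hr : 0 < r) (hK : 0 ≤ K)
    (hκ : (N : ℝ) + 2 < 2 * (2 * r + 1) / r) :
    ∃ D > 0, ∀ s, S s →
      (∃ M, ∀ x ∈ ball (0 : Eu N) 1, ∀ t ∈ Ioo (-1 : ℝ) 1, s x t ≤ M) →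
      ∀ x, ‖x‖ ≤ 2 → s 0 0 ≤ D * s x 4 := by
  obtain ⟨D, hD, hU⟩ := hS.universal_bound hr hK hκ
  obtain ⟨C₀, hC₀, hup⟩ := upper_core N
  obtain ⟨C₂, hC₂, hlow⟩ := low_core N
  set γ : ℝ := 1 / r with hγ
  set L : ℝ := K * D ^ (2 * r) with hL
  have hL0 : 0 ≤ L := mul_nonneg hK (Real.rpow_nonneg hD.le _)
  set A : ℝ := 2 * 2 ^ (N : ℝ) with hA
  have hA0 : 0 < A := by positivity
  obtain ⟨θ, hθ0, hθ1, hθ2⟩ : ∃ θ : ℝ, 0 < θ ∧ θ ≤ 1 / 2 ∧ C₀ * θ * (1 + L) * A ≤ 1 / 2 := by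
    have hB : 0 < C₀ * (1 + L) * A := by positivity
    refine ⟨min (1 / 2) (1 / 2 / (C₀ * (1 + L) * A)), by positivity, min_le_left _ _, ?_⟩
    calc C₀ * min (1 / 2) (1 / 2 / (C₀ * (1 + L) * A)) * (1 + L) * A
        = (C₀ * (1 + L) * A) * min (1 / 2) (1 / 2 / (C₀ * (1 + L) * A)) := by ring
      _ ≤ (C₀ * (1 + L) * A) * (1 / 2 / (C₀ * (1 + L) * A)) :=
          mul_le_mul_of_nonneg_left (min_le_right _ _) hB.le
      _ = 1 / 2 := mul_div_cancel₀ _ hB.ne'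
  obtain ⟨C₁, hC₁, hup⟩ := hup θ hθ0 hθ1
  refine ⟨4 * 4 ^ N * C₁ * C₂, by positivity, fun s hs ⟨M, hM⟩ x hx => ?_⟩
  have hs0 := hS.nonneg s hs
  have hsreg := hS.reg s hs
  rcases (hs0 0 0).eq_or_lt with h | hpos
  · rw [← h]; exact mul_nonneg (by positivity) (hs0 _ _)
  obtain ⟨x₁, t₁, d, hd, hx₁, ht₁, hsd, hloc⟩ := exists_doubling hs0 (Nat.cast_nonneg N) hM hpos
  have hd1 : d ≤ 1 := by linarith [norm_nonneg x₁]
  have ht₁' : |t₁| ≤ 1 := by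
    have := (Real.sqrt_le_left zero_le_one).1 (ht₁.trans (by linarith : 1 - d ≤ 1))
    simpa using this
  set l : ℝ := d / 4 with hl
  have hl0 : 0 < l := by positivity
  have hl1 : l ≤ 1 := by rw [hl]; linarith
  have hlγ : 0 < l ^ γ := Real.rpow_pos_of_pos hl0 _
  have hv := hS.scl_mem s hs l x₁ t₁ hl0
  rw [← hγ] at hv
  set v := scl γ l x₁ t₁ s with hvdef
  have hv' : ∀ y τ, v y τ = l ^ γ * s (x₁ + l • y) (t₁ + l ^ 2 * τ) := fun y τ => rfl
  have hv00 : v 0 0 = l ^ γ * s x₁ t₁ := by rw [hv']; simp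
  have hvU : ∀ y ∈ ball (0 : Eu N) 2, ∀ τ ∈ Ioo (-2 : ℝ) 2, v y τ ≤ A * v 0 0 := by
    intro y hy τ hτ
    have := hloc (x₁ + l • y) (t₁ + l ^ 2 * τ) (by
        rw [add_sub_cancel_left, norm_smul, Real.norm_of_nonneg hl0.le]
        rw [mem_ball_zero_iff] at hy
        nlinarith) (by
        rw [add_sub_cancel_left, abs_mul, abs_of_nonneg (sq_nonneg _)]
        nlinarith [abs_lt.2 hτ, sq_nonneg d])
    rw [hv', hv00]
    calc _ ≤ l ^ γ * (2 * 2 ^ (N : ℝ) * s x₁ t₁) := mul_le_mul_of_nonneg_left this hlγ.le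
      _ = _ := by rw [hA]; ring
  have hvD : ∀ y ∈ ball (0 : Eu N) 1, ∀ τ ∈ Ioo (-1 : ℝ) 1, v y τ ≤ D := by
    intro y hy τ hτ
    have h1 := hU _ (hS.scl_mem v hv 1 y τ one_pos) ⟨A * v 0 0, fun z hz σ hσ => by
      simp only [scl, Real.one_rpow, one_mul, one_smul, one_pow]
      refine hvU _ ?_ _ ?_
      · rw [mem_ball_zero_iff] at *
        linarith [norm_add_le y z]
      · constructor <;> linarith [hσ.1, hσ.2, hτ.1, hτ.2]⟩
    simpa [scl] using h1
  have h1 := hup v (A * v 0 0) L (hS.reg v hv) hL0 fun y hy τ hτ => by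
    have hvn := hS.nonneg v hv y τ
    have h2 := hvU y (ball_subset_ball (by norm_num) hy) τ
      ⟨by linarith [hτ.1], by linarith [hτ.2]⟩
    refine ⟨hvn, h2, (hS.heat_le v hv y τ).trans ?_⟩
    have h3 : v y τ ^ (2 * r + 1) = v y τ ^ (2 * r) * v y τ := by
      rw [Real.rpow_add_of_nonneg hvn (by linarith) zero_le_one, Real.rpow_one]
    rw [h3, hL, mul_assoc]
    refine mul_le_mul_of_nonneg_left ?_ hK
    exact mul_le_mul (Real.rpow_le_rpow hvn (hvD y hy τ hτ) (by linarith)) h2 hvn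
      (Real.rpow_nonneg hD.le _)
  have hvn0 := hS.nonneg v hv 0 0
  have h2 : v 0 0 ≤ 2 * C₁ * ∫ y in closedBall (0 : Eu N) (1 / 2), v y (-θ) := by
    nlinarith
  simp only [hv', integral_const_mul] at h2
  rw [smul_zero, add_zero, mul_zero, add_zero] at h2
  have h3 := integral_affine_ball_le (hsreg.space (t₁ + l ^ 2 * -θ)).continuous
    (fun y => hs0 y _) hl0 hl1 (hx₁.trans (by linarith : 1 - d ≤ 1))
  have hlθ0 : 0 ≤ l ^ 2 * θ := by positivity
  have hlθ1 : l ^ 2 * θ ≤ 1 := by nlinarith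
  have h4 := hlow s hsreg hs0 (hS.heat_nonneg s hs) x (t₁ + l ^ 2 * -θ) 4 hx
    (by linarith [le_abs_self t₁]) (by linarith [neg_abs_le t₁])
  set I := ∫ y in closedBall (0 : Eu N) (1 / 2), s (x₁ + l • y) (t₁ + l ^ 2 * -θ)
  have h5 : s x₁ t₁ ≤ 2 * C₁ * I := by
    refine le_of_mul_le_mul_left ?_ hlγ
    linarith
  have h6 : d ^ (N : ℝ) = 4 ^ N * l ^ N := by
    rw [Real.rpow_natCast, ← mul_pow, hl]; congr 1; ring
  calc s 0 0 ≤ 2 * (4 ^ N * l ^ N * s x₁ t₁) := by rw [← h6]; exact hsd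
    _ ≤ 2 * (4 ^ N * l ^ N * (2 * C₁ * I)) := by gcongr
    _ = 4 * 4 ^ N * C₁ * (l ^ N * I) := by ring
    _ ≤ 4 * 4 ^ N * C₁ * (C₂ * s x 4) := by
        refine mul_le_mul_of_nonneg_left (h3.trans h4) (by positivity)
    _ = _ := by ring

theorem ScaleFamily.scl_bounded {s : Eu N → ℝ → ℝ} {x₁ : Eu N} {t₁ l M : ℝ} (γ : ℝ) (hl : 0 < l)
    (hM : ∀ x ∈ closedBall x₁ l, ∀ t ∈ Icc (t₁ - l ^ 2) (t₁ + l ^ 2), s x t ≤ M) :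
    ∃ M', ∀ x ∈ ball (0 : Eu N) 1, ∀ t ∈ Ioo (-1 : ℝ) 1, scl γ l x₁ t₁ s x t ≤ M' := by
  refine ⟨l ^ γ * M, fun x hx t ht => mul_le_mul_of_nonneg_left (hM _ ?_ _ ?_)
    (Real.rpow_nonneg hl.le _)⟩
  · rw [mem_ball_zero_iff] at hx
    rw [mem_closedBall_iff_norm, add_sub_cancel_left, norm_smul, Real.norm_of_nonneg hl.le]
    nlinarith
  · have := sq_nonneg l
    constructor <;> nlinarith [ht.1, ht.2]

/-- Local boundedness from above of a function of space and time near a point. -/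
def LocBdd (s : Eu N → ℝ → ℝ) (P : Eu N × ℝ) : Prop :=
  ∃ M, ∀ᶠ Q in 𝓝 P, s Q.1 Q.2 ≤ M

theorem exists_bound_of_locBdd {s : Eu N → ℝ → ℝ} {k : Set (Eu N × ℝ)} (hk : IsCompact k)
    (h : ∀ P ∈ k, LocBdd s P) : ∃ M, ∀ P ∈ k, s P.1 P.2 ≤ M := by
  refine hk.induction_on (p := fun k => ∃ M, ∀ P ∈ k, s P.1 P.2 ≤ M) ⟨0, by simp⟩
    (fun _ _ hst ⟨M, hM⟩ => ⟨M, fun P hP => hM P (hst hP)⟩) ?_ ?_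
  · rintro a b ⟨M, hM⟩ ⟨M', hM'⟩
    refine ⟨max M M', fun P hP => hP.elim (fun h => (hM P h).trans (le_max_left _ _))
      (fun h => (hM' P h).trans (le_max_right _ _))⟩
  · intro P hP
    obtain ⟨M, hM⟩ := h P hP
    exact ⟨_, mem_nhdsWithin_of_mem_nhds hM, M, fun Q hQ => hQ⟩

theorem exists_bound_box {s : Eu N → ℝ → ℝ} {x₁ : Eu N} {t₁ l : ℝ}
    (h : ∀ x ∈ closedBall x₁ l, ∀ t ∈ Icc (t₁ - l ^ 2) (t₁ + l ^ 2), LocBdd s (x, t)) :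
    ∃ M, ∀ x ∈ closedBall x₁ l, ∀ t ∈ Icc (t₁ - l ^ 2) (t₁ + l ^ 2), s x t ≤ M := by
  obtain ⟨M, hM⟩ := exists_bound_of_locBdd ((isCompact_closedBall x₁ l).prod isCompact_Icc)
    (s := s) (fun P (hP : P ∈ closedBall x₁ l ×ˢ Icc (t₁ - l ^ 2) (t₁ + l ^ 2)) => h P.1 hP.1 P.2 hP.2)
  exact ⟨M, fun x hx t ht => hM (x, t) ⟨hx, ht⟩⟩

theorem ScaleFamily.locBdd (hS : ScaleFamily N r K C S) (hr : 0 < r) (hK : 0 ≤ K)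
    (hκ : (N : ℝ) + 2 < 2 * (2 * r + 1) / r) {s : Eu N → ℝ → ℝ} (hs : S s) (P : Eu N × ℝ) :
    LocBdd s P := by
  obtain ⟨D, hD, hH⟩ := hS.harnack_unit hr hK hκ
  have hs0 := hS.nonneg s hs
  have hreg := hS.reg s hs
  set A : Set (Eu N × ℝ) := {P | ¬ LocBdd s P} with hA
  have hAc : IsClosed A := by
    rw [← isOpen_compl_iff, isOpen_iff_mem_nhds]
    intro P hP
    obtain ⟨M, hM⟩ := not_not.1 hP
    filter_upwards [hM.eventually_nhds] with Q hQ
    exact not_not.2 ⟨M, hQ⟩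
  by_contra hPA
  have hne : A.Nonempty := ⟨P, hPA⟩
  set F : ℕ → Set (Eu N × ℝ) := fun k =>
    {P | ∀ τ, |τ - P.2| < 1 / ((k : ℝ) + 1) → s P.1 τ ≤ k} with hF
  have hFc : ∀ k, IsClosed (F k) := by
    intro k
    have : F k = ⋂ τ : ℝ, {P : Eu N × ℝ | 1 / ((k : ℝ) + 1) ≤ |τ - P.2|} ∪
        {P : Eu N × ℝ | s P.1 τ ≤ k} := by
      ext P
      simp only [hF, mem_ofPred_eq, mem_iInter, mem_union, ← not_lt, imp_iff_not_or]
    rw [this]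
    refine isClosed_iInter fun τ => IsClosed.union ?_ ?_
    · exact isClosed_le continuous_const (by fun_prop)
    · exact isClosed_le ((hreg.space τ).continuous.comp continuous_fst) continuous_const
  have hcov : ∀ P ∈ closure A, ∃ k, P ∈ F k := by
    rintro ⟨x, t⟩ -
    have hc := (hreg.time x).continuous.continuousAt (x := t)
    obtain ⟨δ, hδ, hδ'⟩ := Metric.eventually_nhds_iff.1
      (hc.eventually (gt_mem_nhds (show s x t < s x t + 1 by linarith)))
    obtain ⟨k₁, hk₁⟩ := exists_nat_one_div_lt hδ
    obtain ⟨k₂, hk₂⟩ := exists_nat_ge (s x t + 1)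
    refine ⟨max k₁ k₂, fun τ hτ => ?_⟩
    have h1 : |τ - t| < δ := by
      refine hτ.trans (lt_of_le_of_lt ?_ hk₁)
      apply one_div_le_one_div_of_le (by positivity)
      push_cast
      linarith [le_max_left (k₁ : ℝ) k₂]
    have h2 : s x τ < s x t + 1 := hδ' h1
    push_cast
    linarith [le_max_right (k₁ : ℝ) k₂]
  obtain ⟨k, Ps, hPs, ε, hε, hsub⟩ := exists_portion hne hFc hcov
  rw [hAc.closure_eq] at hsub
  apply hPs
  obtain ⟨e, he0, he1, he2, he3⟩ : ∃ e : ℝ, 0 < e ∧ e ≤ 1 / 4 ∧ e ≤ ε / 4 ∧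
      e ≤ 1 / (16 * ((k : ℝ) + 1)) :=
    ⟨min (1 / 4) (min (ε / 4) (1 / (16 * ((k : ℝ) + 1)))), by positivity, min_le_left _ _,
      (min_le_right _ _).trans (min_le_left _ _), (min_le_right _ _).trans (min_le_right _ _)⟩
  have he4 : 16 * e ≤ 1 / ((k : ℝ) + 1) := by
    have h1 : (0 : ℝ) < (k : ℝ) + 1 := by positivity
    rw [le_div_iff₀ (by positivity)] at he3 ⊢
    linarith
  refine ⟨max k (D * k), ?_⟩
  filter_upwards [Metric.ball_mem_nhds Ps (show 0 < e ^ 2 by positivity)]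
  rintro ⟨x, t⟩ hP
  have hPd : dist (x, t) Ps < e ^ 2 := hP
  have hee : e ^ 2 ≤ e / 4 := by nlinarith
  by_cases hPA' : (x, t) ∈ A
  · have : (x, t) ∈ F k := hsub ⟨mem_ball.2 (by linarith), hPA'⟩
    refine le_trans (this t ?_) (le_max_left _ _)
    simp only [sub_self, abs_zero]; positivity
  set par : Eu N × ℝ → ℝ := fun Q => max ‖Q.1 - x‖ (√|Q.2 - t|) with hpar
  have hpd : ∀ Q a, par Q ≤ a → ‖Q.1 - x‖ ≤ a ∧ |Q.2 - t| ≤ a ^ 2 := by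
    intro Q a h
    refine ⟨(le_max_left _ _).trans h, ?_⟩
    have h1 : √|Q.2 - t| ≤ a := (le_max_right _ _).trans h
    exact (Real.sqrt_le_iff.1 h1).2
  have hbdd : BddBelow (par '' A) := ⟨0, by
    rintro _ ⟨Q, -, rfl⟩
    exact (norm_nonneg _).trans (le_max_left _ _)⟩
  set d := sInf (par '' A) with hd
  have hd0 : 0 < d := by
    obtain ⟨δ, hδ, hδ'⟩ := Metric.isOpen_iff.1 hAc.isOpen_compl (x, t) hPA'
    refine lt_of_lt_of_le (show 0 < min δ (√δ) by positivity)
      (le_csInf (hne.image _) ?_)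
    rintro _ ⟨Q, hQ, rfl⟩
    have h1 : ¬ dist Q (x, t) < δ := fun h => hδ' h hQ
    rw [Prod.dist_eq, max_lt_iff, not_and_or, not_lt, not_lt, dist_eq_norm, Real.dist_eq] at h1
    rcases h1 with h1 | h1
    · exact (min_le_left _ _).trans (h1.trans (le_max_left _ _))
    · exact (min_le_right _ _).trans ((Real.sqrt_le_sqrt h1).trans (le_max_right _ _))
  have hde : d ≤ e := by
    refine (csInf_le hbdd ⟨Ps, hPs, rfl⟩).trans ?_
    rw [Prod.dist_eq, max_lt_iff, dist_comm, dist_comm (t : ℝ), dist_eq_norm, Real.dist_eq] at hPd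
    refine max_le (hPd.1.le.trans (by nlinarith)) (Real.sqrt_le_iff.2 ⟨he0.le, hPd.2.le⟩)
  obtain ⟨_, ⟨Q, hQ, rfl⟩, hQd⟩ := exists_lt_of_csInf_lt (hne.image par)
    (show d < 4 / 3 * d by linarith)
  set a := par Q with ha
  have hda : d ≤ a := csInf_le hbdd ⟨Q, hQ, rfl⟩
  have ha0 : 0 < a := by linarith
  obtain ⟨hQ1, hQ2⟩ := hpd Q a le_rfl
  set l := 3 / 4 * a with hl
  have hl0 : 0 < l := by positivity
  have hld : l < d := by rw [hl]; linarith
  obtain ⟨M, hM⟩ := exists_bound_box (s := s) (x₁ := x) (t₁ := t) (l := l) fun y hy τ hτ => by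
    by_contra hcon
    have h1 : d ≤ par (y, τ) := csInf_le hbdd ⟨_, hcon, rfl⟩
    have h2 : par (y, τ) ≤ l := by
      refine max_le (mem_closedBall_iff_norm.1 hy) (Real.sqrt_le_iff.2 ⟨hl0.le, abs_le.2 ?_⟩)
      constructor <;> simp only <;> linarith [hτ.1, hτ.2]
    linarith
  have hHar := hH _ (hS.scl_mem s hs l x t hl0) (ScaleFamily.scl_bounded _ hl0 hM)
    (l⁻¹ • (Q.1 - x)) (by
      rw [norm_smul, Real.norm_of_nonneg (by positivity), inv_mul_le_iff₀ hl0]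
      linarith)
  simp only [scl, smul_zero, add_zero, mul_zero] at hHar
  rw [smul_inv_smul₀ hl0.ne', add_sub_cancel] at hHar
  have hlγ : 0 < l ^ (1 / r) := Real.rpow_pos_of_pos hl0 _
  have hsQ : s x t ≤ D * s Q.1 (t + l ^ 2 * 4) := by
    refine le_of_mul_le_mul_left ?_ hlγ
    linarith
  have hae : a ≤ 4 / 3 * e := by linarith
  have ha1 : a ^ 2 ≤ a := by nlinarith
  have hQF : Q ∈ F k := by
    refine hsub ⟨?_, hQ⟩
    have h1 : dist Q (x, t) ≤ a := by
      rw [Prod.dist_eq, dist_eq_norm, Real.dist_eq]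
      exact max_le hQ1 (hQ2.trans ha1)
    have := dist_triangle Q (x, t) Ps
    rw [mem_ball]
    linarith
  have h2 : s Q.1 (t + l ^ 2 * 4) ≤ k := by
    refine hQF _ ?_
    have h3 : |t + l ^ 2 * 4 - Q.2| ≤ 4 * a ^ 2 := by
      have := abs_le.1 hQ2
      rw [hl]
      refine abs_le.2 ⟨?_, ?_⟩ <;> nlinarith [sq_nonneg a]
    refine lt_of_le_of_lt h3 (lt_of_lt_of_le ?_ he4)
    nlinarith
  exact (hsQ.trans (mul_le_mul_of_nonneg_left h2 hD.le)).trans (le_max_right _ _)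

theorem ScaleFamily.eq_zero (hS : ScaleFamily N r K C S) (hr : 0 < r) (hK : 0 ≤ K)
    (hκ : (N : ℝ) + 2 < 2 * (2 * r + 1) / r) {s : Eu N → ℝ → ℝ} (hs : S s) (x : Eu N) (t : ℝ) :
    s x t = 0 := by
  obtain ⟨D, hD, hU⟩ := hS.universal_bound hr hK hκ
  refine le_antisymm ?_ (hS.nonneg s hs x t)
  by_contra hpos
  push Not at hpos
  set R : ℝ := ((D + 1) / s x t) ^ r with hR
  have hq : 0 < (D + 1) / s x t := by positivity
  have hR0 : 0 < R := Real.rpow_pos_of_pos hq _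
  obtain ⟨M, hM⟩ := exists_bound_box (s := s) (x₁ := x) (t₁ := t) (l := R) fun y _ τ _ =>
    hS.locBdd hr hK hκ hs (y, τ)
  have h1 := hU _ (hS.scl_mem s hs R x t hR0) (ScaleFamily.scl_bounded _ hR0 hM)
  have h2 : R ^ (1 / r) = (D + 1) / s x t := by
    rw [hR, ← Real.rpow_mul hq.le, mul_one_div_cancel hr.ne', Real.rpow_one]
  simp only [scl, smul_zero, add_zero, mul_zero] at h1
  rw [h2, div_mul_cancel₀ _ hpos.ne'] at h1
  linarith

theorem scaling_exponent_lt (hN : 1 ≤ N) (hr : 0 < r)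
    (hpB : N = 1 ∨ (2 ≤ N ∧ 2 * r + 1 < ((N : ℝ) * (N + 2)) / ((N : ℝ) - 1) ^ 2)) :
    (N : ℝ) + 2 < 2 * (2 * r + 1) / r := by
  rw [lt_div_iff₀ hr]
  rcases hpB with rfl | ⟨h2, h⟩
  · push_cast; linarith
  · have hN2 : (2 : ℝ) ≤ N := by exact_mod_cast h2
    rw [lt_div_iff₀ (by nlinarith)] at h
    set n : ℝ := (N : ℝ)
    have h3 : 2 * r * (n - 1) ^ 2 < 4 * n - 1 := by nlinarith
    have h4 : (4 * n - 1) * (n - 2) ≤ 4 * (n - 1) ^ 2 := by nlinarith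
    have h5 : 0 < (n - 1) ^ 2 := by nlinarith
    by_contra hcon
    push Not at hcon
    have h6 : 2 ≤ r * (n - 2) := by linarith
    have h7 : 4 * (n - 1) ^ 2 ≤ 2 * r * (n - 1) ^ 2 * (n - 2) := by nlinarith
    rcases hN2.eq_or_lt with h8 | h8
    · rw [← h8] at h6; linarith
    · have h9 : 2 * r * (n - 1) ^ 2 * (n - 2) < (4 * n - 1) * (n - 2) :=
        mul_lt_mul_of_pos_right h3 (by linarith)
      linarith

end Liouville

theorem liouville_whole_space
    (N m : ℕ) (hN : 1 ≤ N) (hm : 2 ≤ m)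
    (r : ℝ) (hr : 0 < r)
    (β : Fin m → Fin m → ℝ)
    (hsym : ∀ i j, β i j = β j i)
    (hoff : ∀ i j, i ≠ j → 0 ≤ β i j)
    (hdiag : ∀ i, 0 < β i i)
    (hpB : N = 1 ∨ (2 ≤ N ∧ 2 * r + 1 < ((N : ℝ) * (N + 2)) / ((N : ℝ) - 1) ^ 2))
    (u : Fin m → EuclideanSpace ℝ (Fin N) → ℝ → ℝ)
    (hregx : ∀ i t, ContDiff ℝ 2 (fun x => u i x t))
    (hregt : ∀ i x, ContDiff ℝ 1 (fun t => u i x t))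
    (hnonneg : ∀ i x t, 0 ≤ u i x t)
    (hpde : ∀ i x t,
      deriv (fun s => u i x s) t - lap (fun y => u i y t) x
        = ∑ j, β i j * u i x t ^ r * u j x t ^ (r + 1)) :
    ∀ i x t, u i x t = 0 := by
  have hβ : ∀ i j, 0 ≤ β i j := fun i j => by
    by_cases h : i = j
    · rw [h]; exact (hdiag j).le
    · exact hoff i j h
  have hu : IsSol β r u := ⟨fun i => ⟨hregx i, hregt i⟩, hnonneg, hpde⟩
  obtain ⟨C, -, hS⟩ := exists_scaleFamily hN hr hsym hβ hdiag hpB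
  intro i x t
  have h0 : ∑ i, u i x t = 0 :=
    hS.eq_zero hr (Finset.sum_nonneg fun i _ => Finset.sum_nonneg fun j _ => hβ i j)
      (scaling_exponent_lt hN hr hpB) ⟨u, hu, rfl⟩ x t
  exact le_antisymm (h0 ▸ le_sum_of_nonneg (fun k => hnonneg k x t) i) (hnonneg i x t)
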